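/- Let K be a field, R = K[x_1,…,x_d] a standard graded polynomial ring in d > 0 indeterminates, and m, n integers with 1 ≤ m ≤ n. Let A be an m×n matrix over R whose entries are all homogeneous of the same degree, such that I = I_m(A) is of generic height (that is, ht I = n−m+1), and suppose ht I_j(A) ≥ (m−j+1)(n−m)+1 for all 1 ≤ j ≤ m−1. Then I is of fiber type. -/

import Mathlib

open Matrix

/-- The ideal generated by the `t × t` minors of a matrix. -/
noncomputable def minorsIdeal {R : Type*} [CommRing R] {α β : Type*}
    (t : ℕ) (A : Matrix α β R) : Ideal R :=
  Ideal.span {d : R | ∃ (f : Fin t → α) (g : Fin t → β),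
    Function.Injective f ∧ Function.Injective g ∧ d = (A.submatrix f g).det}

/-- The height of an ideal: the infimum of the heights of primes containing it. -/
noncomputable def idealHeight {R : Type*} [CommRing R] (I : Ideal R) : ℕ∞ :=
  ⨅ p ∈ {p : PrimeSpectrum R | I ≤ p.asIdeal}, Order.height p

/-- The minimal number of generators of an ideal. -/
noncomputable def mu {R : Type*} [CommRing R] (I : Ideal R) : ℕ :=
  sInf {n : ℕ | ∃ s : Finset R, s.card = n ∧ Ideal.span (s : Set R) = I}

/-- The condition `G_s`. -/
def SatisfiesG {R : Type*} [CommRing R] (I : Ideal R) (s : ℕ) : Prop :=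
  ∀ (p : Ideal R) (hp : p.IsPrime), I ≤ p →
    haveI := hp
    ringKrullDim (Localization.AtPrime p) ≤ ((s - 1 : ℕ) : WithBot ℕ∞) →
    (mu (I.map (algebraMap R (Localization.AtPrime p))) : WithBot ℕ∞) ≤
      ringKrullDim (Localization.AtPrime p)

/-- The defining ideal of the Rees algebra of the ideal generated by the family `f`:
the kernel of the map `R[Tᵢ] → R[u]`, `Tᵢ ↦ fᵢ·u`. -/
noncomputable def reesDefIdeal {R : Type*} [CommRing R] {ι : Type*} (f : ι → R) :
    Ideal (MvPolynomial ι R) :=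
  RingHom.ker (MvPolynomial.aeval fun i => Polynomial.C (f i) * Polynomial.X :
    MvPolynomial ι R →ₐ[R] Polynomial R)

/-- An ideal, presented by a generating family `f`, is of linear type if the defining ideal
of its Rees algebra is generated by elements homogeneous of degree `1` in the variables `Tᵢ`. -/
def IsLinearType {R : Type*} [CommRing R] {ι : Type*} (f : ι → R) : Prop :=
  reesDefIdeal f = Ideal.span
    {p : MvPolynomial ι R | p ∈ reesDefIdeal f ∧ p.IsHomogeneous 1}

/-- An ideal of a `K`-algebra, presented by a generating family `f`, is of fiber type if the
defining ideal of its Rees algebra is generated by its elements homogeneous of degree `1` in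
the variables `Tᵢ` together with its elements lying in the subring `K[Tᵢ]`. -/
def IsFiberType (K : Type*) [CommSemiring K] {R : Type*} [CommRing R] [Algebra K R]
    {ι : Type*} (f : ι → R) : Prop :=
  reesDefIdeal f = Ideal.span
    ({p : MvPolynomial ι R | p ∈ reesDefIdeal f ∧ p.IsHomogeneous 1} ∪
     {p : MvPolynomial ι R | p ∈ reesDefIdeal f ∧
        ∃ q : MvPolynomial ι K, MvPolynomial.map (algebraMap K R) q = p})

universe u

section Grade

open CategoryTheory Abelian Limits Pointwise RingTheory.Sequence

variable {S : Type u} [CommRing S]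

/-- The grade of `J` on `M` is at least `k`: the modules `Ext^i(S/J, M)` vanish for `i < k`. -/
def GradeGE (J : Ideal S) (M : Type u) [AddCommGroup M] [Module S M] (k : ℕ) : Prop :=
  ∀ i < k, Subsingleton (Ext.{u} (ModuleCat.of S (S ⧸ J)) (ModuleCat.of S M) i)

namespace GradeGE

variable {J : Ideal S} {M M' M'' : Type u} [AddCommGroup M] [Module S M]
  [AddCommGroup M'] [Module S M'] [AddCommGroup M''] [Module S M''] {k : ℕ}

theorem mono {l : ℕ} (h : GradeGE J M k) (hl : l ≤ k) : GradeGE J M l :=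
  fun i hi => h i (hi.trans_le hl)

theorem zero : GradeGE J M 0 := fun _ hi => absurd hi (Nat.not_lt_zero _)

/-- The short complex of modules attached to an exact pair of linear maps. -/
abbrev exactComplex (f : M' →ₗ[S] M) (g : M →ₗ[S] M'') (h : Function.Exact f g) :
    ShortComplex (ModuleCat.{u} S) :=
  ModuleCat.shortComplexOfCompEqZero f g h.linearMap_comp_eq_zero

theorem exactComplex_shortExact {f : M' →ₗ[S] M} {g : M →ₗ[S] M''} (h : Function.Exact f g)
    (hf : Function.Injective f) (hg : Function.Surjective g) :
    (exactComplex f g h).ShortExact :=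
  ModuleCat.shortComplex_shortExact _ h hf hg

theorem of_exact_middle {f : M' →ₗ[S] M} {g : M →ₗ[S] M''} (h : Function.Exact f g)
    (hf : Function.Injective f) (hg : Function.Surjective g)
    (h' : GradeGE J M' k) (h'' : GradeGE J M'' k) : GradeGE J M k := by
  intro i hi
  refine subsingleton_of_forall_eq 0 fun x => ?_
  have hS := exactComplex_shortExact h hf hg
  have h3 := h'' i hi
  have h1 := h' i hi
  obtain ⟨y, rfl⟩ := Ext.covariant_sequence_exact₂ _ hS (x : Ext _ (exactComplex f g h).X₂ i)
    (@Subsingleton.elim _ h3 _ _)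
  have : y = 0 := @Subsingleton.elim _ h1 _ _
  rw [this, Ext.zero_comp]

theorem of_exact_left {f : M' →ₗ[S] M} {g : M →ₗ[S] M''} (h : Function.Exact f g)
    (hf : Function.Injective f) (hg : Function.Surjective g)
    (h' : GradeGE J M k) (h'' : GradeGE J M'' (k - 1)) : GradeGE J M' k := by
  have hS := exactComplex_shortExact h hf hg
  intro i hi
  refine subsingleton_of_forall_eq 0 fun x => ?_
  have h1 := h' i hi
  cases i with
  | zero =>
    have : Mono (exactComplex f g h).f := hS.mono_f
    exact Ext.postcomp_mk₀_injective_of_mono _ (exactComplex f g h).f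
      (@Subsingleton.elim _ h1 _ _)
  | succ i =>
    obtain ⟨y, rfl⟩ := Ext.covariant_sequence_exact₁ _ hS
      (x : Ext _ (exactComplex f g h).X₁ (i + 1)) (@Subsingleton.elim _ h1 _ _) rfl
    have : y = 0 := @Subsingleton.elim _ (h'' i (by omega)) _ _
    rw [this, Ext.zero_comp]

theorem of_exact_right {f : M' →ₗ[S] M} {g : M →ₗ[S] M''} (h : Function.Exact f g)
    (hf : Function.Injective f) (hg : Function.Surjective g)
    (h' : GradeGE J M' (k + 1)) (h'' : GradeGE J M k) : GradeGE J M'' k := by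
  have hS := exactComplex_shortExact h hf hg
  intro i hi
  refine subsingleton_of_forall_eq 0 fun x => ?_
  obtain ⟨y, rfl⟩ := Ext.covariant_sequence_exact₃ _ hS
    (x : Ext _ (exactComplex f g h).X₃ i) rfl (@Subsingleton.elim _ (h' (i + 1) (by omega)) _ _)
  have : y = 0 := @Subsingleton.elim _ (h'' i hi) _ _
  rw [this, Ext.zero_comp]

theorem of_linearEquiv (e : M ≃ₗ[S] M') (h : GradeGE J M k) : GradeGE J M' k := by
  refine of_exact_right (M' := PUnit.{u + 1}) (M := M) (f := 0) (g := e.toLinearMap) ?_ ?_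
    e.surjective ?_ h
  · intro x
    simpa using eq_comm
  · exact Function.injective_of_subsingleton _
  · intro i _
    refine subsingleton_of_forall_eq 0 fun x => ?_
    rw [← Ext.comp_mk₀_id x]
    have : 𝟙 (ModuleCat.of S PUnit.{u + 1}) = 0 :=
      (ModuleCat.isZero_of_subsingleton _).eq_of_src _ _
    rw [this, Ext.mk₀_zero, Ext.comp_zero]

theorem of_subsingleton [Subsingleton M] : GradeGE J M k := by
  intro i _
  refine subsingleton_of_forall_eq 0 fun x => ?_
  rw [← Ext.comp_mk₀_id x]
  have : 𝟙 (ModuleCat.of S M) = 0 :=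
    (ModuleCat.isZero_of_subsingleton _).eq_of_src _ _
  rw [this, Ext.mk₀_zero, Ext.comp_zero]

theorem of_regular {x : S} (hx : x ∈ J) (hreg : IsSMulRegular M x)
    (h : GradeGE J (QuotSMulTop x M) k) : GradeGE J M (k + 1) := by
  intro i hi
  have hann : x ∈ Module.annihilator S (ModuleCat.of S (S ⧸ J)) := by
    change x ∈ Module.annihilator S (S ⧸ J)
    rwa [Ideal.annihilator_quotient]
  have hreg' : IsSMulRegular (ModuleCat.of S M) x := hreg
  cases i with
  | zero =>
    refine subsingleton_of_forall_eq 0 fun y => ?_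
    have hS := hreg'.smulShortComplex_shortExact
    have : Mono ((ModuleCat.of S M).smulShortComplex x).f := hS.mono_f
    have h0 := Ext.postcomp_smul_id_eq_zero_of_mem_annihilator
      (M := ModuleCat.of S M) hann 0
    refine Ext.postcomp_mk₀_injective_of_mono (ModuleCat.of S (S ⧸ J))
      ((ModuleCat.of S M).smulShortComplex x).f ?_
    refine (congrArg (fun φ => φ.hom y) h0).trans ?_
    exact (map_zero ((Ext.mk₀ ((ModuleCat.of S M).smulShortComplex x).f).postcomp _
      (add_zero 0))).symm
  | succ i =>
    let g := (AddCommGrpCat.ofHom ((Ext.mk₀ ((ModuleCat.of S M).smulShortComplex x).f).postcomp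
      (ModuleCat.of S (S ⧸ J)) (add_zero (i + 1))))
    have mono_g : Mono g := by
      apply (Ext.covariant_sequence_exact₁' _ hreg'.smulShortComplex_shortExact i (i + 1)
        rfl).mono_g ((AddCommGrpCat.isZero_of_iff_subsingleton.mpr ?_).eq_zero_of_src _)
      exact h i (by omega)
    have zero_g : g = 0 := Ext.postcomp_smul_id_eq_zero_of_mem_annihilator hann (i + 1)
    exact AddCommGrpCat.subsingleton_of_isZero (IsZero.of_mono_eq_zero _ zero_g)

theorem quotSMulTop {x : S} (hreg : IsSMulRegular M x) (h : GradeGE J M (k + 1)) :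
    GradeGE J (QuotSMulTop x M) k :=
  of_exact_right (LinearMap.exact_lsmul_mkQ_smul_top M x) hreg (Submodule.mkQ_surjective _) h
    (h.mono (Nat.le_succ _))

theorem of_isWeaklyRegular {rs : List S} (hrs : ∀ r ∈ rs, r ∈ J) (h : IsWeaklyRegular M rs) :
    GradeGE J M rs.length := by
  induction rs generalizing M with
  | nil => exact zero
  | cons x rs ih =>
    rw [isWeaklyRegular_cons_iff] at h
    exact of_regular (hrs x (by simp)) h.1 (ih (fun r hr => hrs r (by simp [hr])) h.2)

theorem exists_regular [IsNoetherianRing S] [Module.Finite S M] (h : GradeGE J M (k + 1)) :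
    ∃ x ∈ J, IsSMulRegular M x := by
  have h0 : Subsingleton (ModuleCat.of S (S ⧸ J) ⟶ ModuleCat.of S M) :=
    Ext.addEquiv₀.subsingleton_congr.mp (h 0 k.zero_lt_succ)
  have h1 : Subsingleton ((S ⧸ J) →ₗ[S] M) :=
    (ModuleCat.homAddEquiv (M := ModuleCat.of S (S ⧸ J))
      (N := ModuleCat.of S M)).symm.subsingleton
  obtain ⟨x, hx, hreg⟩ := IsSMulRegular.subsingleton_linearMap_iff.mp h1
  rw [Ideal.annihilator_quotient] at hx
  exact ⟨x, hx, hreg⟩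

theorem exists_isWeaklyRegular [IsNoetherianRing S] [Module.Finite S M] (h : GradeGE J M k) :
    ∃ rs : List S, rs.length = k ∧ (∀ r ∈ rs, r ∈ J) ∧ IsWeaklyRegular M rs := by
  induction k generalizing M with
  | zero => exact ⟨[], rfl, by simp, .nil _ _⟩
  | succ k ih =>
    obtain ⟨x, hx, hreg⟩ := h.exists_regular
    obtain ⟨rs, hlen, hmem, hrs⟩ := ih (h.quotSMulTop hreg)
    refine ⟨x :: rs, by simp [hlen], ?_, hrs.cons hreg⟩
    simpa using ⟨hx, hmem⟩

/-- Enlarging the ideal does not decrease the grade. -/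
theorem mono_ideal [IsNoetherianRing S] [Module.Finite S M] {J' : Ideal S}
    (hJ : J ≤ J') (h : GradeGE J M k) : GradeGE J' M k := by
  obtain ⟨rs, rfl, hmem, hrs⟩ := h.exists_isWeaklyRegular
  exact of_isWeaklyRegular (fun r hr => hJ (hmem r hr)) hrs

theorem quotient_inf {P Q : Ideal S} (hP : GradeGE J (S ⧸ P) k) (hQ : GradeGE J (S ⧸ Q) k)
    (hPQ : GradeGE J (S ⧸ (P ⊔ Q)) (k - 1)) : GradeGE J (S ⧸ (P ⊓ Q)) k := by
  have hf1 : P ⊓ Q ≤ LinearMap.ker (P.mkQ.prod Q.mkQ) := by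
    intro x hx
    simpa using! hx
  refine of_exact_left (M' := S ⧸ (P ⊓ Q)) (M := (S ⧸ P) × (S ⧸ Q)) (M'' := S ⧸ (P ⊔ Q))
    (f := Submodule.liftQ (P ⊓ Q) (P.mkQ.prod Q.mkQ) hf1)
    (g := (Submodule.mapQ P (P ⊔ Q) LinearMap.id (by simp)).coprod
      (-(Submodule.mapQ Q (P ⊔ Q) LinearMap.id (by simp)))) ?_ ?_ ?_ ?_ hPQ
  · rintro ⟨a, b⟩
    obtain ⟨a, rfl⟩ := Submodule.mkQ_surjective _ a
    obtain ⟨b, rfl⟩ := Submodule.mkQ_surjective _ b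
    simp only [Submodule.mkQ_apply, LinearMap.coprod_apply, Submodule.mapQ_apply,
      LinearMap.id_apply, LinearMap.neg_apply, ← sub_eq_add_neg]
    rw [← Submodule.Quotient.mk_sub, Submodule.Quotient.mk_eq_zero]
    constructor
    · intro hab
      obtain ⟨p, hp, q, hq, hpq⟩ := Submodule.mem_sup.mp hab
      refine ⟨Submodule.Quotient.mk (a - p), ?_⟩
      simp only [Submodule.liftQ_apply, LinearMap.prod_apply, Function.prod_apply,
        Submodule.mkQ_apply, Prod.mk.injEq]
      constructor
      · rw [Submodule.Quotient.eq]; simpa using hp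
      · rw [Submodule.Quotient.eq]
        have : a - p - b = q := by linear_combination -hpq
        rwa [this]
    · rintro ⟨c, hc⟩
      obtain ⟨c, rfl⟩ := Submodule.mkQ_surjective _ c
      simp only [Submodule.mkQ_apply, Submodule.liftQ_apply, LinearMap.prod_apply,
        Function.prod_apply, Prod.mk.injEq, Submodule.Quotient.eq] at hc
      have : a - b = -(c - a) + (c - b) := by ring
      rw [this]
      exact Submodule.add_mem _ (Submodule.neg_mem _ (Submodule.mem_sup_left hc.1))
        (Submodule.mem_sup_right hc.2)
  · rw [← LinearMap.ker_eq_bot, Submodule.ker_liftQ_eq_bot']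
    ext x
    simp
  · intro c
    obtain ⟨c, rfl⟩ := Submodule.mkQ_surjective _ c
    refine ⟨(Submodule.Quotient.mk c, 0), by simp⟩
  · refine of_exact_middle (M' := S ⧸ P) (M'' := S ⧸ Q) (f := LinearMap.inl S _ _)
      (g := LinearMap.snd S _ _) ?_ LinearMap.inl_injective LinearMap.snd_surjective hP hQ
    intro x
    simp only [LinearMap.snd_apply, LinearMap.coe_inl, Set.mem_range]
    constructor
    · intro hx; exact ⟨x.1, by rw [← hx]⟩
    · rintro ⟨y, rfl⟩; rfl

end GradeGE

end Grade

section Patch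

open CategoryTheory Abelian Limits Pointwise RingTheory.Sequence

variable {S : Type u} [CommRing S]

theorem mem_smul_top_iff_exists {M : Type*} [AddCommGroup M] [Module S M] {x : S} {ξ : M} :
    ξ ∈ x • (⊤ : Submodule S M) ↔ ∃ η, x • η = ξ := by
  simp [Submodule.mem_smul_pointwise_iff_exists]

theorem IsSMulRegular.of_isLocalizedModule_aux {M N : Type*} [AddCommGroup M] [Module S M]
    [AddCommGroup N] [Module S N] {T : Submonoid S} (f : M →ₗ[S] N) [IsLocalizedModule T f]
    {x : S} (hx : IsSMulRegular M x) : IsSMulRegular N x := by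
  rw [isSMulRegular_iff_right_eq_zero_of_smul] at hx ⊢
  intro η hη
  obtain ⟨⟨μ, s⟩, hμ⟩ := IsLocalizedModule.surj T f η
  have h0 : f (x • μ) = f 0 := by
    rw [map_smul, ← hμ, map_zero, Submonoid.smul_def, smul_comm, hη, smul_zero]
  obtain ⟨c, hc⟩ := IsLocalizedModule.exists_of_eq (S := T) h0
  rw [Submonoid.smul_def, Submonoid.smul_def, smul_zero, smul_comm] at hc
  have h1 : (c : S) • μ = 0 := hx _ hc
  have h2 : c • s • η = (0 : N) := by
    rw [hμ, Submonoid.smul_def, ← map_smul, h1, map_zero]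
  rw [← smul_zero c] at h2
  have h3 := IsLocalizedModule.smul_injective f c h2
  rw [← smul_zero s] at h3
  exact IsLocalizedModule.smul_injective f s h3

theorem isLocalizedModule_quotSMulTop_map {M N : Type*} [AddCommGroup M] [Module S M]
    [AddCommGroup N] [Module S N] {T : Submonoid S} (f : M →ₗ[S] N) [IsLocalizedModule T f]
    (x : S) : IsLocalizedModule T (QuotSMulTop.map x f) where
  map_units s := by
    rw [Module.End.isUnit_iff]
    have hb := (Module.End.isUnit_iff _).mp (IsLocalizedModule.map_units f s)
    constructor
    · rw [← LinearMap.ker_eq_bot, LinearMap.ker_eq_bot']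
      intro η hη
      obtain ⟨η, rfl⟩ := Submodule.mkQ_surjective _ η
      rw [Module.algebraMap_end_apply, ← map_smul, Submodule.mkQ_apply,
        Submodule.Quotient.mk_eq_zero, mem_smul_top_iff_exists] at hη
      obtain ⟨η', hη'⟩ := hη
      obtain ⟨η'', rfl⟩ := hb.2 η'
      rw [Submodule.mkQ_apply, Submodule.Quotient.mk_eq_zero, mem_smul_top_iff_exists]
      refine ⟨η'', hb.1 ?_⟩
      simp only [Module.algebraMap_end_apply] at hη' ⊢
      rw [smul_comm, hη']
    · intro η
      obtain ⟨η, rfl⟩ := Submodule.mkQ_surjective _ η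
      obtain ⟨η', rfl⟩ := hb.2 η
      exact ⟨Submodule.mkQ _ η', rfl⟩
  surj η := by
    obtain ⟨η, rfl⟩ := Submodule.mkQ_surjective _ η
    obtain ⟨⟨μ, s⟩, hμ⟩ := IsLocalizedModule.surj T f η
    exact ⟨(Submodule.mkQ _ μ, s), congrArg (Submodule.mkQ (x • (⊤ : Submodule S N))) hμ⟩
  exists_of_eq {a b} hab := by
    obtain ⟨a, rfl⟩ := Submodule.mkQ_surjective _ a
    obtain ⟨b, rfl⟩ := Submodule.mkQ_surjective _ b
    have hab' : Submodule.mkQ (x • (⊤ : Submodule S N)) (f a) = Submodule.mkQ _ (f b) := hab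
    rw [Submodule.mkQ_apply, Submodule.mkQ_apply, Submodule.Quotient.eq,
      mem_smul_top_iff_exists] at hab'
    obtain ⟨η, hη⟩ := hab'
    obtain ⟨⟨μ, s⟩, hμ⟩ := IsLocalizedModule.surj T f η
    have h1 : f (x • μ) = f ((s : S) • (a - b)) := by
      rw [map_smul, ← hμ, Submonoid.smul_def, smul_comm, hη, map_smul, map_sub]
    obtain ⟨c, hc⟩ := IsLocalizedModule.exists_of_eq (S := T) h1
    refine ⟨c * s, ?_⟩
    rw [Submonoid.smul_def, Submonoid.smul_def, ← map_smul, ← map_smul, Submodule.mkQ_apply,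
      Submodule.mkQ_apply, Submodule.Quotient.eq, mem_smul_top_iff_exists]
    refine ⟨(c : S) • μ, ?_⟩
    rw [smul_comm, ← smul_sub, Submonoid.coe_mul, mul_smul]
    exact hc

namespace GradeGE

variable {J : Ideal S} {M M' M'' : Type u} [AddCommGroup M] [Module S M]
  [AddCommGroup M'] [Module S M'] [AddCommGroup M''] [Module S M''] {k : ℕ}

theorem eq_zero_of_smul_eq_zero (h : GradeGE J M (k + 1)) {ξ : M} (hξ : ∀ x ∈ J, x • ξ = 0) :
    ξ = 0 := by
  have h0 : Subsingleton (ModuleCat.of S (S ⧸ J) ⟶ ModuleCat.of S M) :=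
    Ext.addEquiv₀.subsingleton_congr.mp (h 0 k.zero_lt_succ)
  have h1 : Subsingleton ((S ⧸ J) →ₗ[S] M) :=
    (ModuleCat.homAddEquiv (M := ModuleCat.of S (S ⧸ J))
      (N := ModuleCat.of S M)).symm.subsingleton
  have h2 := Subsingleton.elim (Submodule.liftQ J (LinearMap.toSpanSingleton S M ξ)
    (fun x hx => by simpa using hξ x hx)) 0
  have h3 := LinearMap.congr_fun h2 (Submodule.Quotient.mk 1)
  rw [Submodule.liftQ_apply] at h3
  simpa using h3

theorem of_sup_of_localized [IsNoetherianRing S] [Module.Finite S M] (G : Set S)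
    (hG : GradeGE (J ⊔ Ideal.span G) M k)
    (hloc : ∀ g ∈ G, ∃ (N : Type u) (_ : AddCommGroup N) (_ : Module S N) (f : M →ₗ[S] N),
      IsLocalizedModule (Submonoid.powers g) f ∧ GradeGE J N k) : GradeGE J M k := by
  induction k generalizing M with
  | zero => exact zero
  | succ k ih =>
    have hex : ∃ x ∈ J, IsSMulRegular M x := by
      have h1 : Subsingleton ((S ⧸ J) →ₗ[S] M) := by
        refine subsingleton_of_forall_eq 0 fun φ => ?_
        have hJ : ∀ x ∈ J, x • φ (Submodule.Quotient.mk 1) = 0 := by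
          intro x hx
          rw [← map_smul, ← Submodule.Quotient.mk_smul, smul_eq_mul, mul_one,
            (Submodule.Quotient.mk_eq_zero J).mpr hx, map_zero]
        obtain ⟨x, hx, hreg⟩ := hG.exists_regular
        have hle : J ⊔ Ideal.span G ≤
            Ideal.radical
              (LinearMap.ker (LinearMap.toSpanSingleton S M (φ (Submodule.Quotient.mk 1)))) := by
          refine sup_le (le_trans (fun x hx => ?_) Ideal.le_radical) (Ideal.span_le.mpr ?_)
          · simpa using hJ x hx
          · intro g hg
            obtain ⟨N, _, _, f, hf, hN⟩ := hloc g hg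
            have h0 : f (φ (Submodule.Quotient.mk 1)) = f 0 := by
              rw [map_zero]
              refine hN.eq_zero_of_smul_eq_zero fun x hx => ?_
              rw [← map_smul, hJ x hx, map_zero]
            obtain ⟨⟨_, e, rfl⟩, hc⟩ :=
              IsLocalizedModule.exists_of_eq (S := Submonoid.powers g) h0
            refine ⟨e, ?_⟩
            simpa [Submonoid.smul_def] using hc
        obtain ⟨e, he⟩ := hle hx
        have h0 : φ (Submodule.Quotient.mk 1) = 0 :=
          (isSMulRegular_iff_right_eq_zero_of_smul.mp (hreg.pow e)) _ (by simpa using he)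
        ext
        simpa using h0
      obtain ⟨x, hx, hreg⟩ := IsSMulRegular.subsingleton_linearMap_iff.mp h1
      rw [Ideal.annihilator_quotient] at hx
      exact ⟨x, hx, hreg⟩
    obtain ⟨x, hx, hreg⟩ := hex
    refine of_regular hx hreg (ih (hG.quotSMulTop hreg) fun g hg => ?_)
    obtain ⟨N, _, _, f, hf, hN⟩ := hloc g hg
    exact ⟨QuotSMulTop x N, inferInstance, inferInstance, QuotSMulTop.map x f,
      isLocalizedModule_quotSMulTop_map f x,
      hN.quotSMulTop (hreg.of_isLocalizedModule_aux (T := Submonoid.powers g) f)⟩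

end GradeGE

/-- Prime avoidance for a coset, due to Davis. -/
theorem exists_add_notMem_of_finset (x : S) (J : Ideal S) (s : Finset (Ideal S))
    (hprime : ∀ P ∈ s, P.IsPrime) (h : ∀ P ∈ s, ¬ Ideal.span {x} ⊔ J ≤ P) :
    ∃ c ∈ J, ∀ P ∈ s, x + c ∉ P := by
  classical
  induction s using Finset.strongInduction with
  | H s ih =>
    rcases s.eq_empty_or_nonempty with rfl | hne
    · exact ⟨0, J.zero_mem, by simp⟩
    obtain ⟨P, hP⟩ := s.exists_minimal hne
    obtain ⟨c, hc, hcs⟩ := ih (s.erase P) (Finset.erase_ssubset hP.prop)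
      (fun Q hQ => hprime Q (Finset.mem_of_mem_erase hQ))
      (fun Q hQ => h Q (Finset.mem_of_mem_erase hQ))
    by_cases hxc : x + c ∈ P
    · have hPp := hprime P hP.prop
      have hJP : ¬ J ≤ P := by
        intro hle
        refine h P hP.prop (sup_le ?_ hle)
        rw [Ideal.span_singleton_le_iff_mem]
        simpa using P.sub_mem hxc (hle hc)
      have hinf : ¬ J ⊓ (s.erase P).inf id ≤ P := by
        intro hle
        rcases hPp.inf_le.mp hle with h1 | h1
        · exact hJP h1
        · obtain ⟨Q, hQ, hQP⟩ := hPp.inf_le'.mp h1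
          exact (Finset.ne_of_mem_erase hQ)
            (le_antisymm hQP (hP.le_of_le (Finset.mem_of_mem_erase hQ) hQP))
      obtain ⟨j, ⟨hjJ, hjs⟩, hjP⟩ := SetLike.not_le_iff_exists.mp hinf
      refine ⟨c + j, J.add_mem hc hjJ, fun Q hQ hmem => ?_⟩
      by_cases hQP : Q = P
      · subst hQP
        rw [← add_assoc] at hmem
        exact hjP ((Q.add_mem_iff_right hxc).mp hmem)
      · have hQe := Finset.mem_erase.mpr ⟨hQP, hQ⟩
        have hjQ : j ∈ Q := (Finset.inf_le hQe : _ ≤ id Q) hjs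
        rw [← add_assoc] at hmem
        exact hcs Q hQe ((Q.add_mem_iff_left hjQ).mp hmem)
    · refine ⟨c, hc, fun Q hQ => ?_⟩
      by_cases hQP : Q = P
      · rwa [hQP]
      · exact hcs Q (Finset.mem_erase.mpr ⟨hQP, hQ⟩)

/-- If `J` is generated, up to the annihilator of `M`, by as many elements as its grade on `M`,
then `M/JM` has no nonzero element killed by an ideal `I'` raising the grade of `J`. -/
theorem mem_smul_top_of_forall_smul_mem [IsNoetherianRing S] {M : Type u} [AddCommGroup M]
    [Module S M] [Module.Finite S M] {J I' : Ideal S} (ys : List S)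
    (hyJ : Ideal.ofList ys ≤ J) (hJ : J ≤ Ideal.ofList ys ⊔ Module.annihilator S M)
    (h1 : GradeGE J M ys.length) (h2 : GradeGE (J ⊔ I') M (ys.length + 1)) {ξ : M}
    (hξ : ∀ a ∈ I', a • ξ ∈ J • (⊤ : Submodule S M)) : ξ ∈ J • (⊤ : Submodule S M) := by
  induction ys generalizing M with
  | nil =>
    have hbot : J • (⊤ : Submodule S M) = ⊥ := by
      rw [eq_bot_iff, Submodule.smul_le]
      intro a ha μ _
      exact Module.mem_annihilator.mp (by simpa using hJ ha) μ
    rw [hbot] at hξ ⊢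
    refine h2.eq_zero_of_smul_eq_zero fun a ha => ?_
    obtain ⟨b, hb, c, hc, rfl⟩ := Submodule.mem_sup.mp ha
    rw [add_smul, Module.mem_annihilator.mp (by simpa using hJ hb) ξ, (Submodule.mem_bot S).mp
      (hξ c hc), add_zero]
  | cons y ys ih =>
    obtain ⟨w, hwJ, hw⟩ := h1.exists_regular
    obtain ⟨c, hc, hcP⟩ := exists_add_notMem_of_finset y (Ideal.ofList ys)
      (associatedPrimes.finite S M).toFinset
      (fun P hP => IsAssociatedPrime.isPrime ((Set.Finite.mem_toFinset _).mp hP)) (by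
        intro P hP hle
        rw [Set.Finite.mem_toFinset] at hP
        have hwP : w ∈ P := by
          rw [Ideal.ofList_cons] at hJ
          have hann : Module.annihilator S M ≤ P := by
            simpa [Submodule.annihilator_top] using IsAssociatedPrime.annihilator_le hP
          exact sup_le hle hann (hJ hwJ)
        have : w ∈ {r : S | IsSMulRegular M r}ᶜ := by
          rw [← biUnion_associatedPrimes_eq_compl_regular]
          exact Set.mem_biUnion hP hwP
        exact this hw)
    have hreg : IsSMulRegular M (y + c) := by
      by_contra hn
      have : y + c ∈ {r : S | IsSMulRegular M r}ᶜ := hn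
      rw [← biUnion_associatedPrimes_eq_compl_regular] at this
      obtain ⟨P, hP, hmem⟩ := Set.mem_iUnion₂.mp this
      exact hcP P ((Set.Finite.mem_toFinset _).mpr hP) hmem
    rw [Ideal.ofList_cons] at hyJ hJ
    have hyc : y + c ∈ J := J.add_mem (hyJ (Ideal.mem_sup_left (Ideal.mem_span_singleton_self y)))
      (hyJ (Ideal.mem_sup_right hc))
    have hcomap := Submodule.comap_smul_top_of_surjective J
      (Submodule.mkQ ((y + c) • (⊤ : Submodule S M))) (Submodule.mkQ_surjective _)
    have hle : (y + c) • (⊤ : Submodule S M) ≤ J • ⊤ := by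
      intro μ hμ
      obtain ⟨η, rfl⟩ := mem_smul_top_iff_exists.mp hμ
      exact Submodule.smul_mem_smul hyc trivial
    rw [Submodule.ker_mkQ, sup_eq_left.mpr hle] at hcomap
    rw [← hcomap]
    refine ih (M := QuotSMulTop (y + c) M) (le_sup_right.trans hyJ) (hJ.trans ?_)
      (h1.quotSMulTop hreg) (h2.quotSMulTop hreg) ?_
    · have hann : y + c ∈ Module.annihilator S (QuotSMulTop (y + c) M) := by
        rw [Module.mem_annihilator]
        intro μ
        obtain ⟨μ, rfl⟩ := Submodule.mkQ_surjective _ μ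
        rw [← map_smul, Submodule.mkQ_apply, Submodule.Quotient.mk_eq_zero,
          mem_smul_top_iff_exists]
        exact ⟨μ, rfl⟩
      refine sup_le (sup_le ?_ le_sup_left) (le_trans ?_ le_sup_right)
      · rw [Ideal.span_singleton_le_iff_mem]
        have := Submodule.sub_mem _ (Ideal.mem_sup_right hann) (Ideal.mem_sup_left hc)
        simpa using this
      · exact LinearMap.annihilator_le_of_surjective _ (Submodule.mkQ_surjective _)
    · intro a ha
      have := hξ a ha
      rw [← hcomap, Submodule.mem_comap, map_smul] at this
      exact this

end Patch

section RegularRings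

open Pointwise RingTheory.Sequence

theorem GradeGE.quotient_ofList {S : Type u} [CommRing S] {J : Ideal S} {M : Type u}
    [AddCommGroup M] [Module S M] {k : ℕ} {rs : List S} (hrs : IsWeaklyRegular M rs)
    (h : GradeGE J M (k + rs.length)) :
    GradeGE J (M ⧸ (Ideal.ofList rs • ⊤ : Submodule S M)) k := by
  induction rs generalizing M with
  | nil =>
    refine of_linearEquiv (Submodule.quotEquivOfEqBot _ ?_).symm h
    simp
  | cons x rs ih =>
    rw [isWeaklyRegular_cons_iff] at hrs
    exact of_linearEquiv (Submodule.quotOfListConsSMulTopEquivQuotSMulTopInner M x rs).symm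
      (ih hrs.2 (quotSMulTop hrs.1 h))

/-- The quotient of a ring by a principal ideal, in the two available forms. -/
noncomputable def quotSMulTopEquivQuotientSpan {A : Type*} [CommRing A] (z : A) :
    QuotSMulTop z A ≃ₗ[A] A ⧸ Ideal.span {z} :=
  Submodule.quotEquivOfEq _ _ (by
    rw [← Submodule.ideal_span_singleton_smul, smul_eq_mul, Ideal.mul_top])

/-- A Noetherian local ring whose maximal ideal is generated by at most as many elements as its
height is a domain, and its maximal ideal contains a regular sequence of that length. -/
theorem isDomain_and_exists_isWeaklyRegular {A : Type u} [CommRing A] [IsLocalRing A]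
    [IsNoetherianRing A] (rs : List A) (hspan : Ideal.ofList rs = IsLocalRing.maximalIdeal A)
    (hdim : (rs.length : ℕ∞) ≤ (IsLocalRing.maximalIdeal A).height) :
    IsDomain A ∧ ∃ zs : List A, zs.length = rs.length ∧
      (∀ z ∈ zs, z ∈ IsLocalRing.maximalIdeal A) ∧ IsWeaklyRegular A zs := by
  generalize hn : rs.length = n at *
  induction n generalizing A rs with
  | zero =>
    obtain rfl := List.length_eq_zero_iff.mp hn
    rw [Ideal.ofList_nil] at hspan
    exact ⟨(IsLocalRing.isField_iff_maximalIdeal_eq.mpr hspan.symm).isDomain, [], rfl,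
      by simp, .nil _ _⟩
  | succ n ih =>
    obtain ⟨x, rs, rfl⟩ := List.exists_cons_of_length_eq_add_one hn
    rw [Ideal.ofList_cons] at hspan
    obtain ⟨c, hc, hcP⟩ := exists_add_notMem_of_finset x (Ideal.ofList rs)
      (minimalPrimes.finite_of_isNoetherianRing A).toFinset
      (fun P hP => ((Set.Finite.mem_toFinset _).mp hP).1.1) (by
        intro P hP hle
        rw [Set.Finite.mem_toFinset] at hP
        have hPp : P.IsPrime := hP.1.1
        rw [hspan] at hle
        have hPm : IsLocalRing.maximalIdeal A = P :=
          le_antisymm hle (IsLocalRing.le_maximalIdeal hPp.ne_top)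
        rw [← hPm, ← Ideal.height_eq_zero_iff] at hP
        rw [hP] at hdim
        simp at hdim)
    set z := x + c with hz
    have hzm : z ∈ IsLocalRing.maximalIdeal A := by
      rw [← hspan]
      exact add_mem (Ideal.mem_sup_left (Ideal.mem_span_singleton_self x)) (Ideal.mem_sup_right hc)
    have hnt : Nontrivial (A ⧸ Ideal.span {z}) := by
      refine Ideal.Quotient.nontrivial_iff.mpr fun h => ?_
      rw [Ideal.span_singleton_eq_top] at h
      exact (IsLocalRing.mem_maximalIdeal _).mp hzm h
    have hloc : IsLocalRing (A ⧸ Ideal.span {z}) :=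
      .of_surjective' (Ideal.Quotient.mk _) Ideal.Quotient.mk_surjective
    have hmap : (IsLocalRing.maximalIdeal A).map (Ideal.Quotient.mk (Ideal.span {z})) =
        IsLocalRing.maximalIdeal (A ⧸ Ideal.span {z}) :=
      IsLocalRing.map_maximalIdeal_of_surjective _ Ideal.Quotient.mk_surjective
    have hspan' : Ideal.ofList (rs.map (Ideal.Quotient.mk (Ideal.span {z}))) =
        IsLocalRing.maximalIdeal (A ⧸ Ideal.span {z}) := by
      rw [← hmap, ← hspan, ← Ideal.map_ofList, Ideal.map_sup, eq_comm, sup_eq_right,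
        Ideal.map_span, Set.image_singleton, Ideal.span_singleton_le_iff_mem]
      have h1 : Ideal.Quotient.mk (Ideal.span {z}) x = - Ideal.Quotient.mk (Ideal.span {z}) c := by
        rw [← map_neg, Ideal.Quotient.mk_eq_mk_iff_sub_mem, sub_neg_eq_add]
        exact Ideal.mem_span_singleton_self z
      rw [h1]
      exact neg_mem (Ideal.mem_map_of_mem _ hc)
    have hdim' : (n : ℕ∞) ≤ (IsLocalRing.maximalIdeal (A ⧸ Ideal.span {z})).height := by
      have h1 := hdim.trans (Ideal.height_le_height_add_one_of_mem hzm)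
      rw [hmap, Nat.cast_add, Nat.cast_one] at h1
      exact (ENat.add_le_add_iff_right (by simp)).mp h1
    obtain ⟨hdom, zs, hlen, hzs, hreg⟩ := ih _ hspan' (by simpa using hn) hdim'
    have hprime : (Ideal.span {z}).IsPrime := (Ideal.Quotient.isDomain_iff_prime _).mp hdom
    obtain ⟨q, hq, hqz⟩ := Ideal.exists_minimalPrimes_le (bot_le : ⊥ ≤ Ideal.span {z})
    have hzq : z ∉ q := hcP q ((Set.Finite.mem_toFinset _).mpr hq)
    have hqp : q.IsPrime := hq.1.1
    have hq0 : q = ⊥ := by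
      refine Submodule.eq_bot_of_le_smul_of_le_jacobson_bot (IsLocalRing.maximalIdeal A) q
        (IsNoetherian.noetherian q) ?_ (IsLocalRing.maximalIdeal_le_jacobson _)
      intro a ha
      obtain ⟨b, rfl⟩ := Ideal.mem_span_singleton'.mp (hqz ha)
      rw [mul_comm]
      exact Submodule.smul_mem_smul hzm ((hqp.mem_or_mem ha).resolve_right hzq)
    have hA : IsDomain A := by
      rw [hq0] at hqp
      exact IsDomain.of_bot_isPrime A
    have hz0 : z ≠ 0 := fun h => hzq (h ▸ q.zero_mem)
    refine ⟨hA, z :: zs.map Quotient.out, by simp [hlen], ?_, ?_⟩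
    · simp only [List.mem_cons, List.mem_map, forall_eq_or_imp, forall_exists_index, and_imp,
        forall_apply_eq_imp_iff₂]
      refine ⟨hzm, fun w hw => ?_⟩
      have h1 := hzs w hw
      rw [← Ideal.Quotient.mk_out w] at h1
      rw [IsLocalRing.mem_maximalIdeal] at h1 ⊢
      exact fun h => h1 (h.map _)
    · rw [isWeaklyRegular_cons_iff']
      refine ⟨fun a b hab => mul_left_cancel₀ hz0 hab, ?_⟩
      have h2 : (zs.map Quotient.out).map (Ideal.Quotient.mk (Ideal.span {z})) = zs := by
        rw [List.map_map]
        conv_rhs => rw [← List.map_id zs]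
        exact List.map_congr_left fun w _ => Ideal.Quotient.mk_out w
      rw [h2]
      refine ((AddEquiv.isWeaklyRegular_congr
        (e := (quotSMulTopEquivQuotientSpan z).toAddEquiv) ?_).mpr hreg)
      rw [List.forall₂_same]
      intro w _ a
      obtain ⟨w, rfl⟩ := Ideal.Quotient.mk_surjective w
      exact (quotSMulTopEquivQuotientSpan z).map_smul w a

theorem IsRegularLocalRing.gradeGE_maximalIdeal {A : Type u} [CommRing A] [IsRegularLocalRing A]
    {g : ℕ} (hg : (g : ℕ∞) ≤ (IsLocalRing.maximalIdeal A).height) :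
    GradeGE (IsLocalRing.maximalIdeal A) A g := by
  have hfg : (IsLocalRing.maximalIdeal A).FG := IsNoetherian.noetherian _
  have hfin := Submodule.FG.finite_generators hfg
  have hspan : Ideal.ofList hfin.toFinset.toList = IsLocalRing.maximalIdeal A := by
    rw [Ideal.ofList]
    simpa using! Submodule.span_generators (IsLocalRing.maximalIdeal A)
  have hlen : (hfin.toFinset.toList.length : ℕ∞) = (IsLocalRing.maximalIdeal A).height := by
    have h1 := Submodule.FG.generators_ncard hfg
    have h2 := IsRegularLocalRing.spanFinrank_maximalIdeal (R := A)
    rw [← IsLocalRing.maximalIdeal_height_eq_ringKrullDim] at h2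
    rw [Finset.length_toList, ← Set.ncard_eq_toFinset_card _ hfin, h1]
    exact_mod_cast h2
  obtain ⟨-, zs, hzs, hmem, hreg⟩ := isDomain_and_exists_isWeaklyRegular _ hspan hlen.le
  refine (GradeGE.of_isWeaklyRegular hmem hreg).mono ?_
  rw [hzs]
  exact_mod_cast hg.trans hlen.ge

theorem IsRegularRing.gradeGE_of_le_height {R : Type u} [CommRing R] [IsRegularRing R]
    {I : Ideal R} {g : ℕ} (hI : ∀ P : Ideal R, P.IsPrime → I ≤ P → (g : ℕ∞) ≤ P.height) :
    GradeGE I R g := by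
  have key : ∀ k ≤ g, ∃ rs : List R, rs.length = k ∧ (∀ r ∈ rs, r ∈ I) ∧
      IsWeaklyRegular R rs := by
    intro k
    induction k with
    | zero => exact fun _ => ⟨[], rfl, by simp, .nil _ _⟩
    | succ k ih =>
      intro hk
      obtain ⟨rs, hlen, hmem, hreg⟩ := ih (by omega)
      suffices h : ∃ x ∈ I, IsSMulRegular (R ⧸ (Ideal.ofList rs • ⊤ : Submodule R R)) x by
        obtain ⟨x, hx, hxreg⟩ := h
        refine ⟨rs ++ [x], by simp [hlen], ?_, ?_⟩
        · intro r hr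
          rcases List.mem_append.mp hr with h | h
          · exact hmem r h
          · rw [List.mem_singleton.mp h]; exact hx
        · rw [isWeaklyRegular_append_iff]
          exact ⟨hreg, (isWeaklyRegular_singleton_iff _ _).mpr hxreg⟩
      by_contra! hno
      have hsub : (I : Set R) ⊆
          ⋃ P ∈ associatedPrimes R (R ⧸ (Ideal.ofList rs • ⊤ : Submodule R R)), P := by
        rw [biUnion_associatedPrimes_eq_compl_regular]
        exact fun x hx => hno x hx
      obtain ⟨P, hP, hIP⟩ := (Ideal.subset_union_prime_finite (associatedPrimes.finite R
        (R ⧸ (Ideal.ofList rs • ⊤ : Submodule R R))) ⊥ ⊥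
        (fun P hP _ _ => IsAssociatedPrime.isPrime hP)).mp hsub
      have hPp : P.IsPrime := IsAssociatedPrime.isPrime hP
      obtain ⟨r, hr⟩ : ∃ r : R, ∀ a, a ∈ P ↔ a * r ∈ Ideal.ofList rs := by
        obtain ⟨ξ, hξ⟩ := (isAssociatedPrime_iff.mp hP).2
        obtain ⟨r, rfl⟩ := Submodule.mkQ_surjective _ ξ
        refine ⟨r, fun a => ?_⟩
        rw [hξ]
        simp only [Submodule.mem_colon_singleton, Submodule.mem_bot]
        rw [← map_smul, Submodule.mkQ_apply, Submodule.Quotient.mk_eq_zero]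
        simp
      have hht := hI P hPp hIP
      have hht' : (g : ℕ∞) ≤ (IsLocalRing.maximalIdeal (Localization.AtPrime P)).height := by
        have h1 := IsLocalization.AtPrime.ringKrullDim_eq_height P (Localization.AtPrime P)
        rw [← IsLocalRing.maximalIdeal_height_eq_ringKrullDim] at h1
        rw [WithBot.coe_injective h1]
        exact hht
      have hregP := hreg.of_isLocalization (Localization.AtPrime P) P.primeCompl
      have hgrade : GradeGE (IsLocalRing.maximalIdeal (Localization.AtPrime P))
          (Localization.AtPrime P) (1 + (rs.map (algebraMap R (Localization.AtPrime P))).length) :=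
        (IsRegularLocalRing.gradeGE_maximalIdeal hht').mono (by simp [hlen]; omega)
      have h0 := (hgrade.quotient_ofList hregP).eq_zero_of_smul_eq_zero
        (ξ := Submodule.Quotient.mk (algebraMap R (Localization.AtPrime P) r)) (by
          intro x hx
          rw [← Localization.AtPrime.map_eq_maximalIdeal] at hx
          rw [← Submodule.Quotient.mk_smul, Submodule.Quotient.mk_eq_zero, smul_eq_mul, smul_eq_mul,
            Ideal.mul_top, ← Ideal.map_ofList]
          refine Submodule.span_induction (p := fun x _ => x * algebraMap R _ r ∈
            (Ideal.ofList rs).map (algebraMap R (Localization.AtPrime P))) ?_ ?_ ?_ ?_ hx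
          · rintro _ ⟨a, ha, rfl⟩
            rw [← map_mul]
            exact Ideal.mem_map_of_mem _ ((hr a).mp ha)
          · simp
          · intro a b _ _ ha hb
            rw [add_mul]
            exact add_mem ha hb
          · intro a b _ hb
            rw [smul_eq_mul, mul_assoc]
            exact Ideal.mul_mem_left _ _ hb)
      rw [Submodule.Quotient.mk_eq_zero, smul_eq_mul, Ideal.mul_top, ← Ideal.map_ofList,
        IsLocalization.algebraMap_mem_map_algebraMap_iff P.primeCompl] at h0
      obtain ⟨s, hs, hsr⟩ := h0
      exact hs ((hr s).mpr hsr)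
  obtain ⟨rs, hlen, hmem, hreg⟩ := key g le_rfl
  exact hlen ▸ GradeGE.of_isWeaklyRegular hmem hreg

theorem le_height_of_le_idealHeight {R : Type*} [CommRing R] {I : Ideal R} {g : ℕ∞}
    (h : g ≤ idealHeight I) (P : Ideal R) (hP : P.IsPrime) (hIP : I ≤ P) : g ≤ P.height := by
  have h1 : g ≤ Order.height (⟨P, hP⟩ : PrimeSpectrum R) := 
    h.trans (iInf₂_le (⟨P, hP⟩ : PrimeSpectrum R) hIP)
  rwa [← PrimeSpectrum.height_eq_orderHeight] at h1

end RegularRings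

section Garnir

/-- Strictly increasing sequences of `m` column indices. -/
abbrev Cols (m N : ℕ) := {f : Fin m → Fin N // StrictMono f}

variable {m N : ℕ} {D : Type*} [CommRing D]

/-- The maximal minor of `M` on the columns `a`. -/
noncomputable def colMinor (M : Matrix (Fin m) (Fin N) D) (a : Fin m → Fin N) : D :=
  (M.submatrix id a).det

/-- The weight of a column sequence. -/
def colWt (a : Fin m → Fin N) : ℕ := ∑ i, (a i : ℕ)

theorem colMinor_eq_zero (M : Matrix (Fin m) (Fin N) D) {a : Fin m → Fin N}
    (ha : ¬ Function.Injective a) : colMinor M a = 0 := by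
  simp only [Function.Injective, not_forall] at ha
  obtain ⟨i, j, hij, hne⟩ := ha
  exact Matrix.det_zero_of_column_eq hne fun k => by simp [hij]

theorem colMinor_map {E : Type*} [CommRing E] (φ : D →+* E) (M : Matrix (Fin m) (Fin N) D)
    (a : Fin m → Fin N) : colMinor (M.map φ) a = φ (colMinor M a) := by
  simp only [colMinor]
  rw [RingHom.map_det]
  rfl

theorem exists_cols_of_injective {a : Fin m → Fin N} (ha : Function.Injective a) :
    ∃ (s : Cols m N) (σ : Equiv.Perm (Fin m)), s.1 = a ∘ σ := by
  refine ⟨⟨a ∘ Tuple.sort a, ?_⟩, Tuple.sort a, rfl⟩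
  exact (Tuple.monotone_sort a).strictMono_of_injective (ha.comp (Tuple.sort a).injective)

theorem colWt_comp (a : Fin m → Fin N) (σ : Equiv.Perm (Fin m)) : colWt (a ∘ σ) = colWt a :=
  Equiv.sum_comp σ fun i => (a i : ℕ)

theorem colMinor_comp (M : Matrix (Fin m) (Fin N) D) (a : Fin m → Fin N)
    (σ : Equiv.Perm (Fin m)) : colMinor M (a ∘ σ) = ((Equiv.Perm.sign σ : ℤ) : D) * colMinor M a := by
  rw [colMinor, colMinor, ← Matrix.det_permute']
  rfl

/-- The pairs that may occur when straightening the product of the minors `x` and `y`. -/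
structure ColStep (x y p q : Cols m N) : Prop where
  wt_lt : colWt p.1 < colWt x.1
  wt_add : colWt p.1 + colWt q.1 = colWt x.1 + colWt y.1
  left_lt : ∀ n : ℕ, (∀ i, (x.1 i : ℕ) < n) → ∀ i, (p.1 i : ℕ) < n
  right_lt : ∀ n : ℕ, (∀ i, (x.1 i : ℕ) < n) → (∀ i, (y.1 i : ℕ) < n) → ∀ i, (q.1 i : ℕ) < n

/-- The minor of `M` as an alternating map in the columns selected by `p`. -/
noncomputable def partialMinor (p : Fin m → Prop) [DecidablePred p] (w : Fin m → Fin m → D) :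
    (Fin m → D) [⋀^{k // p k}]→ₗ[D] D :=
  { (Matrix.detRowAlternating (n := Fin m) (R := D)).toMultilinearMap.domDomRestrict p
      (fun k => w k.1) with
    map_eq_zero_of_eq' := by
      intro v i j hv hij
      simp only [MultilinearMap.toFun_eq_coe, MultilinearMap.domDomRestrict_apply]
      apply (Matrix.detRowAlternating (n := Fin m) (R := D)).map_eq_zero_of_eq
        (i := i.1) (j := j.1)
      · simp [i.2, j.2, hv]
      · exact fun h => hij (Subtype.ext h) }

theorem partialMinor_apply (p : Fin m → Prop) [DecidablePred p] (w : Fin m → Fin m → D)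
    (u : {k // p k} → Fin m → D) :
    partialMinor p w u = Matrix.det (fun k => if h : p k then u ⟨k, h⟩ else w k) := rfl

theorem alternatingMap_eq_zero_of_card_lt {ι : Type*} [Fintype ι] {P : Type*} [AddCommGroup P]
    [Module D P] (f : (Fin m → D) [⋀^ι]→ₗ[D] P) (h : m < Fintype.card ι) : f = 0 := by
  refine Module.Basis.ext_alternating (Pi.basisFun D (Fin m)) fun v hv => ?_
  have := Fintype.card_le_of_injective v hv
  simp at this
  omega

theorem sum_lt_sum_of_split {α β : Type*} [Fintype α] [Fintype β] (h : α ⊕ β → ℤ)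
    (hl : ∀ a, 0 ≤ h (Sum.inl a)) (hr : ∀ b, h (Sum.inr b) < 0) (σ : Equiv.Perm (α ⊕ β))
    {a₀ : α} {b₀ : β} (hσ : σ (Sum.inl a₀) = Sum.inr b₀) :
    ∑ a, h (σ (Sum.inl a)) < ∑ a, h (Sum.inl a) := by
  classical
  have e1 : ∑ a, h (σ (Sum.inl a)) < ∑ a, max (h (σ (Sum.inl a))) 0 := by
    refine Finset.sum_lt_sum (fun _ _ => le_max_left _ _) ⟨a₀, Finset.mem_univ _, ?_⟩
    rw [hσ, max_eq_right (hr _).le]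
    exact hr _
  have e2 : ∑ a, max (h (σ (Sum.inl a))) 0 ≤ ∑ s, max (h (σ s)) 0 := by
    rw [Fintype.sum_sum_type]
    exact le_add_of_nonneg_right (Finset.sum_nonneg fun _ _ => le_max_right _ _)
  have e3 : ∑ s, max (h (σ s)) 0 = ∑ a, h (Sum.inl a) := by
    rw [Equiv.sum_comp σ fun s => max (h s) 0, Fintype.sum_sum_type]
    simp [max_eq_left (hl _), max_eq_right (hr _).le]
  linarith

theorem mem_of_sum_eq_zero {ι E : Type*} [Fintype ι] [AddCommGroup E] {S : Submodule ℤ E}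
    {f : ι → E} (h : ∑ i, f i = 0) {i : ι} (hi : ∀ j, j ≠ i → f j ∈ S) : f i ∈ S := by
  classical
  rw [← Finset.add_sum_erase _ _ (Finset.mem_univ i)] at h
  rw [eq_neg_of_add_eq_zero_left h]
  exact neg_mem (sum_mem fun c hc => hi c (Finset.ne_of_mem_erase hc))

theorem colMinor_mul_mem_span (M : Matrix (Fin m) (Fin N) D) {x y : Cols m N} (hxy : ¬ x ≤ y) :
    colMinor M x.1 * colMinor M y.1 ∈ Submodule.span ℤ
      {d | ∃ p q : Cols m N, ColStep x y p q ∧ d = colMinor M p.1 * colMinor M q.1} := by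
  classical
  obtain ⟨i₀, hi₀⟩ : ∃ i, y.1 i < x.1 i := by
    by_contra! h
    exact hxy h
  let w : Fin N → Fin m → D := fun j i => M i j
  have hw : ∀ a : Fin m → Fin N, colMinor M a = Matrix.det (fun k => w (a k)) := by
    intro a
    rw [colMinor, ← Matrix.det_transpose]
    rfl
  let fa := partialMinor (fun k => i₀ ≤ k) (fun k => w (x.1 k))
  let fb := partialMinor (fun k => k ≤ i₀) (fun k => w (y.1 k))
  let idx : {k // i₀ ≤ k} ⊕ {k // k ≤ i₀} → Fin N :=
    Sum.elim (fun k => x.1 k.1) (fun k => y.1 k.1)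
  have hzero : fa.domCoprod fb = 0 := by
    apply alternatingMap_eq_zero_of_card_lt
    rw [Fintype.card_sum, Fintype.card_subtype, Fintype.card_subtype]
    have e1 : (Finset.univ.filter fun k => i₀ ≤ k) = Finset.Ici i₀ := by ext; simp
    have e2 : (Finset.univ.filter fun k => k ≤ i₀) = Finset.Iic i₀ := by ext; simp
    rw [e1, e2, Fin.card_Ici, Fin.card_Iic]
    have := i₀.2
    omega
  have hsum := congrArg (fun F => LinearMap.mul' D D (F fun s => w (idx s))) hzero
  simp only [AlternatingMap.domCoprod_apply, AlternatingMap.zero_apply, map_zero] at hsum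
  rw [_root_.sum_apply, map_sum] at hsum
  let Xσ : Equiv.Perm ({k // i₀ ≤ k} ⊕ {k // k ≤ i₀}) → Fin m → Fin N := fun σ k =>
    if h : i₀ ≤ k then idx (σ (Sum.inl ⟨k, h⟩)) else x.1 k
  let Yσ : Equiv.Perm ({k // i₀ ≤ k} ⊕ {k // k ≤ i₀}) → Fin m → Fin N := fun σ k =>
    if h : k ≤ i₀ then idx (σ (Sum.inr ⟨k, h⟩)) else y.1 k
  have hterm : ∀ σ : Equiv.Perm ({k // i₀ ≤ k} ⊕ {k // k ≤ i₀}),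
      LinearMap.mul' D D (AlternatingMap.domCoprod.summand fa fb (Quotient.mk'' σ)
        fun s => w (idx s)) =
      ((Equiv.Perm.sign σ : ℤ) : D) * (colMinor M (Xσ σ) * colMinor M (Yσ σ)) := by
    intro σ
    rw [AlternatingMap.domCoprod.summand_mk'', _root_.smul_apply,
      MultilinearMap.domDomCongr_apply, MultilinearMap.domCoprod_apply, hw, hw]
    have ha : fa (fun k => w (idx (σ (Sum.inl k)))) = Matrix.det (fun k => w (Xσ σ k)) := by
      rw [partialMinor_apply]
      congr 1
      funext k
      simp only [Xσ]
      split_ifs <;> rfl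
    have hb : fb (fun k => w (idx (σ (Sum.inr k)))) = Matrix.det (fun k => w (Yσ σ k)) := by
      rw [partialMinor_apply]
      congr 1
      funext k
      simp only [Yσ]
      split_ifs <;> rfl
    simp only [AlternatingMap.coe_multilinearMap]
    rw [ha, hb, Units.smul_def, map_zsmul, LinearMap.mul'_apply, zsmul_eq_mul]
  have hone : LinearMap.mul' D D (AlternatingMap.domCoprod.summand fa fb (Quotient.mk'' 1)
      fun s => w (idx s)) = colMinor M x.1 * colMinor M y.1 := by
    have e1 : Xσ 1 = x.1 := by funext k; simp [Xσ, idx]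
    have e2 : Yσ 1 = y.1 := by funext k; simp [Yσ, idx]
    rw [hterm, e1, e2]; simp
  have hothers : ∀ c : Equiv.Perm.ModSumCongr {k // i₀ ≤ k} {k // k ≤ i₀},
      c ≠ Quotient.mk'' 1 →
      LinearMap.mul' D D (AlternatingMap.domCoprod.summand fa fb c fun s => w (idx s)) ∈
      Submodule.span ℤ
      {d | ∃ p q : Cols m N, ColStep x y p q ∧ d = colMinor M p.1 * colMinor M q.1} := by
    intro c
    induction c using Quotient.inductionOn' with | _ σ
    intro hσ
    obtain ⟨a₀, b₀, hab⟩ : ∃ a b, σ (Sum.inl a) = Sum.inr b := by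
      by_contra! hno
      apply hσ
      rw [Quotient.eq'', QuotientGroup.leftRel_apply]
      rw [mul_one]
      apply inv_mem
      apply Equiv.Perm.mem_sumCongrHom_range_of_perm_mapsTo_inl
      rintro _ ⟨a, rfl⟩
      rcases h : σ (Sum.inl a) with a' | b'
      · exact ⟨a', rfl⟩
      · exact absurd h (hno a b')
    rw [hterm]
    by_cases hX : Function.Injective (Xσ σ)
    swap
    · rw [colMinor_eq_zero M hX]; simp
    by_cases hY : Function.Injective (Yσ σ)
    swap
    · rw [colMinor_eq_zero M hY]; simp
    obtain ⟨p, τ, hp⟩ := exists_cols_of_injective hX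
    obtain ⟨q, τ', hq⟩ := exists_cols_of_injective hY
    have hcm : ∀ (p : Cols m N) (a : Fin m → Fin N) (τ : Equiv.Perm (Fin m)), p.1 = a ∘ τ →
        colMinor M a = ((Equiv.Perm.sign τ⁻¹ : ℤ) : D) * colMinor M p.1 := by
      intro p a τ h
      rw [← colMinor_comp, h]
      congr 1
      funext k
      simp
    rw [hcm p _ τ hp, hcm q _ τ' hq]
    have hmem : colMinor M p.1 * colMinor M q.1 ∈ Submodule.span ℤ
      {d | ∃ p q : Cols m N, ColStep x y p q ∧ d = colMinor M p.1 * colMinor M q.1} := by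
      refine Submodule.subset_span ⟨p, q, ?_, rfl⟩
      have hwp : colWt p.1 = colWt (Xσ σ) := by rw [hp, colWt_comp]
      have hwq : colWt q.1 = colWt (Yσ σ) := by rw [hq, colWt_comp]
      have split : ∀ (P : Fin m → Prop) [DecidablePred P] (g : {k // P k} → ℕ) (e : Fin m → ℕ),
          (∑ k, if h : P k then g ⟨k, h⟩ else e k) = ∑ k, g k + ∑ k : {k // ¬ P k}, e k.1 := by
        intro P _ g e
        rw [← Fintype.sum_subtype_add_sum_subtype P]
        congr 1
        · exact Finset.sum_congr rfl fun k _ => by simp [k.2]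
        · exact Finset.sum_congr rfl fun k _ => by simp [k.2]
      have hXw : colWt (Xσ σ) = ∑ k : {k // i₀ ≤ k}, (idx (σ (Sum.inl k)) : ℕ) +
          ∑ k : {k // ¬ i₀ ≤ k}, (x.1 k.1 : ℕ) := by
        rw [← split (fun k => i₀ ≤ k) (fun k => (idx (σ (Sum.inl k)) : ℕ)) (fun k => x.1 k)]
        refine Finset.sum_congr rfl fun k _ => ?_
        simp only [Xσ]
        split_ifs <;> rfl
      have hYw : colWt (Yσ σ) = ∑ k : {k // k ≤ i₀}, (idx (σ (Sum.inr k)) : ℕ) +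
          ∑ k : {k // ¬ k ≤ i₀}, (y.1 k.1 : ℕ) := by
        rw [← split (fun k => k ≤ i₀) (fun k => (idx (σ (Sum.inr k)) : ℕ)) (fun k => y.1 k)]
        refine Finset.sum_congr rfl fun k _ => ?_
        simp only [Yσ]
        split_ifs <;> rfl
      have hxw : colWt x.1 = ∑ k : {k // i₀ ≤ k}, (idx (Sum.inl k) : ℕ) +
          ∑ k : {k // ¬ i₀ ≤ k}, (x.1 k.1 : ℕ) := by
        rw [colWt, ← Fintype.sum_subtype_add_sum_subtype (fun k => i₀ ≤ k)]
        rfl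
      have hyw : colWt y.1 = ∑ k : {k // k ≤ i₀}, (idx (Sum.inr k) : ℕ) +
          ∑ k : {k // ¬ k ≤ i₀}, (y.1 k.1 : ℕ) := by
        rw [colWt, ← Fintype.sum_subtype_add_sum_subtype (fun k => k ≤ i₀)]
        rfl
      have htot := Equiv.sum_comp σ fun s => (idx s : ℕ)
      rw [Fintype.sum_sum_type, Fintype.sum_sum_type] at htot
      have hlt := sum_lt_sum_of_split (fun s => ((idx s : ℕ) : ℤ) - (x.1 i₀ : ℕ))
        (fun a => by
          have : x.1 i₀ ≤ x.1 a.1 := x.2.monotone a.2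
          simp only [idx, Sum.elim_inl]
          have : (x.1 i₀ : ℕ) ≤ x.1 a.1 := this
          omega)
        (fun b => by
          have : y.1 b.1 ≤ y.1 i₀ := y.2.monotone b.2
          simp only [idx, Sum.elim_inr]
          have : (y.1 b.1 : ℕ) < x.1 i₀ := this.trans_lt hi₀
          omega) σ hab
      simp only [Finset.sum_sub_distrib] at hlt
      have hlt' : ∑ k : {k // i₀ ≤ k}, (idx (σ (Sum.inl k)) : ℕ) <
          ∑ k : {k // i₀ ≤ k}, (idx (Sum.inl k) : ℕ) := by
        zify
        linarith
      have hidx : ∀ n : ℕ, (∀ i, (x.1 i : ℕ) < n) → ∀ s, (idx s : ℕ) < n := by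
        rintro n hn (a | b)
        · exact hn _
        · have : y.1 b.1 ≤ y.1 i₀ := y.2.monotone b.2
          have : (y.1 b.1 : ℕ) < x.1 i₀ := this.trans_lt hi₀
          exact this.trans (hn _)
      refine ⟨by omega, by omega, fun n hn i => ?_, fun n hn hn' i => ?_⟩
      · rw [hp]
        simp only [Function.comp, Xσ]
        split_ifs
        · exact hidx n hn _
        · exact hn _
      · rw [hq]
        simp only [Function.comp, Yσ]
        split_ifs
        · exact hidx n hn _
        · exact hn' _
    have : ∀ (a b c : ℤ) (d e : D), (a : D) * ((b : D) * d * ((c : D) * e)) =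
        (a * b * c) • (d * e) := by
      intro a b c d e
      rw [zsmul_eq_mul]; push_cast; ring
    rw [this]
    exact Submodule.smul_mem _ _ hmem
  rw [← hone]
  exact mem_of_sum_eq_zero hsum hothers

end Garnir

section Straighten

variable {m N : ℕ} {R E : Type*} [CommRing R] [CommRing E] [Algebra R E]

/-- The column sequences using only the first `n` columns. -/
def ColsLT (n : ℕ) (x : Cols m N) : Prop := ∀ i, (x.1 i : ℕ) < n

/-- The product of a word in which the first `k` letters are evaluated by `t` and the others
by `v`. -/
def wordVal (t v : Cols m N → E) : ℕ → List (Cols m N) → E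
  | _, [] => 1
  | 0, x :: l => v x * wordVal t v 0 l
  | k + 1, x :: l => t x * wordVal t v k l

/-- The first `k` letters of the word only use the first `n` columns. -/
def wordGood (n : ℕ) : ℕ → List (Cols m N) → Prop
  | _, [] => True
  | 0, _ :: _ => True
  | k + 1, x :: l => ColsLT n x ∧ wordGood n k l

theorem wordVal_zero (t v : Cols m N → E) (l : List (Cols m N)) :
    wordVal t v 0 l = (l.map v).prod := by
  induction l with
  | nil => rfl
  | cons x l ih => simp [wordVal, ih]

theorem wordVal_cons (t v : Cols m N → E) (k : ℕ) (x : Cols m N) (l : List (Cols m N)) :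
    wordVal t v k (x :: l) = (if 0 < k then t x else v x) * wordVal t v (k - 1) l := by
  cases k <;> simp [wordVal]

theorem wordGood_cons (n k : ℕ) (x : Cols m N) (l : List (Cols m N)) :
    wordGood n k (x :: l) ↔ (0 < k → ColsLT n x) ∧ wordGood n (k - 1) l := by
  cases k with
  | zero => cases l <;> simp [wordGood]
  | succ k => simp [wordGood]

/-- The sorted words of length `L` whose first `k` letters only use the first `n` columns. -/
def sortedWords (n k L : ℕ) : Set (List (Cols m N)) :=
  {l | l.Pairwise (· ≤ ·) ∧ l.length = L ∧ wordGood n k l}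

variable {t v : Cols m N → E} {n : ℕ}

theorem wordVal_mem_span
    (hvv : ∀ x y, ¬ x ≤ y → v x * v y ∈ Submodule.span R
      {d | ∃ p q, ColStep x y p q ∧ d = v p * v q})
    (htv : ∀ x y, ¬ x ≤ y → ColsLT n x → t x * v y ∈ Submodule.span R
      {d | ∃ p q, ColStep x y p q ∧ d = t p * v q})
    (htt : ∀ x y, ¬ x ≤ y → ColsLT n x → ColsLT n y → t x * t y ∈ Submodule.span R
      {d | ∃ p q, ColStep x y p q ∧ d = t p * t q})
    (L : ℕ) : ∀ (k : ℕ) (l : List (Cols m N)), l.length = L → wordGood n k l →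
      wordVal t v k l ∈ Submodule.span R (wordVal t v k '' sortedWords n k L) := by
  have hstep : ∀ k x y, ¬ x ≤ y → (0 < k → ColsLT n x) → (0 < k - 1 → ColsLT n y) →
      (if 0 < k then t x else v x) * (if 0 < k - 1 then t y else v y) ∈ Submodule.span R
      {d | ∃ p q, ColStep x y p q ∧
        d = (if 0 < k then t p else v p) * (if 0 < k - 1 then t q else v q)} := by
    intro k x y hxy hx hy
    by_cases h0 : 0 < k
    · by_cases h1 : 0 < k - 1
      · simpa only [h0, h1, if_true] using htt x y hxy (hx h0) (hy h1)
      · simpa only [h0, h1, if_true, if_false] using htv x y hxy (hx h0)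
    · have h1 : ¬ 0 < k - 1 := by omega
      simpa only [h0, h1, if_false] using hvv x y hxy
  induction L with
  | zero =>
    intro k l hl hg
    exact Submodule.subset_span ⟨l, ⟨by simp [List.length_eq_zero_iff.1 hl], hl, hg⟩, rfl⟩
  | succ L ih =>
    have main : ∀ (w k : ℕ) (x : Cols m N) (l : List (Cols m N)), colWt x.1 = w →
        l.length = L → wordGood n k (x :: l) → wordVal t v k (x :: l) ∈
          Submodule.span R (wordVal t v k '' sortedWords n k (L + 1)) := by
      intro w
      induction w using Nat.strong_induction_on with | _ w ihw
      intro k x l hxw hl hg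
      rw [wordGood_cons] at hg
      have hsub : ∀ l' ∈ sortedWords n (k - 1) L, wordVal t v k (x :: l') ∈
          Submodule.span R (wordVal t v k '' sortedWords n k (L + 1)) := by
        rintro l' ⟨hs, hl', hg'⟩
        match l', hs, hl', hg' with
        | [], _, hl', _ =>
          exact Submodule.subset_span ⟨[x], ⟨by simp, by simp at hl' ⊢; omega,
            by rw [wordGood_cons]; exact ⟨hg.1, by simp [wordGood]⟩⟩, rfl⟩
        | y :: l₁, hs, hl', hg' =>
          by_cases hxy : x ≤ y
          · refine Submodule.subset_span ⟨x :: y :: l₁, ⟨?_, by simpa using hl', ?_⟩, rfl⟩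
            · rw [List.pairwise_cons]
              refine ⟨fun z hz => ?_, hs⟩
              rcases List.mem_cons.1 hz with rfl | hz
              · exact hxy
              · exact hxy.trans ((List.pairwise_cons.1 hs).1 z hz)
            · rw [wordGood_cons]; exact ⟨hg.1, hg'⟩
          · rw [wordGood_cons] at hg'
            have h := hstep k x y hxy hg.1 hg'.1
            rw [wordVal_cons, wordVal_cons, ← mul_assoc]
            have h2 := Submodule.mem_map_of_mem (f := LinearMap.mulRight R
              (wordVal t v (k - 1 - 1) l₁)) h
            rw [Submodule.map_span] at h2
            refine Submodule.span_le.2 ?_ h2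
            rintro _ ⟨_, ⟨p, q, hpq, rfl⟩, rfl⟩
            have := ihw (colWt p.1) (hxw ▸ hpq.wt_lt) k p (q :: l₁) rfl (by simpa using hl') (by
              rw [wordGood_cons, wordGood_cons]
              exact ⟨fun h => hpq.left_lt n (hg.1 h),
                fun h => hpq.right_lt n (hg.1 (by omega)) (hg'.1 h), hg'.2⟩)
            rw [wordVal_cons, wordVal_cons, ← mul_assoc] at this
            exact this
      have h := ih (k - 1) l hl hg.2
      have h2 := Submodule.mem_map_of_mem (f := LinearMap.mulLeft R
        (if 0 < k then t x else v x)) h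
      rw [Submodule.map_span] at h2
      rw [wordVal_cons]
      refine Submodule.span_le.2 ?_ h2
      rintro _ ⟨_, ⟨l', hl', rfl⟩, rfl⟩
      have := hsub l' hl'
      rwa [wordVal_cons] at this
    intro k l hl hg
    match l, hl, hg with
    | x :: l, hl, hg => exact main _ k x l rfl (by simpa using hl) hg

end Straighten

section Independence

variable {Λ R E : Type*} [PartialOrder Λ] [CommRing R] [CommRing E] [Algebra R E]

/-- Sorted words avoiding the letter `top`. -/
def basisWords (top : Λ) : Set (List Λ) := {l | l.Pairwise (· ≤ ·) ∧ top ∉ l}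

theorem basisWords_tail {top x : Λ} {l : List Λ} (h : x :: l ∈ basisWords top) :
    l ∈ basisWords top :=
  ⟨(List.pairwise_cons.1 h.1).2, fun hl => h.2 (List.mem_cons_of_mem _ hl)⟩

theorem le_headD_of_cons_mem {top x : Λ} (htop : ∀ y, y ≤ top) {l : List Λ}
    (h : x :: l ∈ basisWords top) : x ≤ l.headD top := by
  cases l with
  | nil => exact htop x
  | cons y l => exact (List.pairwise_cons.1 h.1).1 y (by simp)

theorem eq_cons_of_headD_eq {Λ : Type*} {top y : Λ} (hy : y ≠ top) {l : List Λ} (h : l.headD top = y) :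
    ∃ l', l = y :: l' := by
  cases l with
  | nil => exact absurd h.symm hy
  | cons x l => exact ⟨l, by simpa using h⟩

theorem eq_nil_of_headD_eq_top {top : Λ} {l : List Λ} (hl : l ∈ basisWords top)
    (h : l.headD top = top) : l = [] := by
  cases l with
  | nil => rfl
  | cons x l => exact absurd (by simp at h; simp [h]) hl.2

theorem kill_wordProd_eq_zero {top : Λ} {d : Λ → E} {kill : Λ → E →ₐ[R] E}
    (hzero : ∀ z ε, ¬ z ≤ ε → kill z (d ε) = 0) (htop : ∀ y, y ≤ top)
    {z : Λ} {l : List Λ} (h : ¬ z ≤ l.headD top) : kill z (l.map d).prod = 0 := by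
  cases l with
  | nil => exact absurd (htop z) h
  | cons x l =>
    rw [List.map_cons, List.prod_cons, map_mul, hzero z x (by simpa using h), zero_mul]

theorem not_le_headD_of_kill_eq_zero {top : Λ} {d : Λ → E} {kill : Λ → E →ₐ[R] E}
    (hinj : Function.Injective (algebraMap R E))
    (hzero : ∀ z ε, ¬ z ≤ ε → kill z (d ε) = 0) (htop : ∀ y, y ≤ top)
    (hcomp : ∀ z y, z ≤ y → ∀ e, kill y (kill z e) = kill y e)
    (hreg : ∀ z, IsLeftRegular (kill z (d z))) (r : ℕ) : ∀ (z : Λ) (c : List Λ →₀ R),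
      (∀ l ∈ c.support, l ∈ basisWords top ∧ l.length ≤ r) →
      kill z (Finsupp.linearCombination R (fun l => (l.map d).prod) c) = 0 →
      ∀ l ∈ c.support, ¬ z ≤ l.headD top := by
  classical
  induction r with
  | zero =>
    intro z c hc h l hl _
    have hnil : ∀ l ∈ c.support, l = [] := fun l hl => List.length_eq_zero_iff.1
      (Nat.le_zero.1 (hc l hl).2)
    have : c = Finsupp.single [] (c []) := by
      ext l
      by_cases h0 : l ∈ c.support
      · rw [hnil l h0]; simp
      · have h1 : c l = 0 := by simpa using h0
        by_cases h2 : l = []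
        · subst h2; simp
        · rw [h1, Finsupp.single_eq_of_ne h2]
    rw [this, Finsupp.linearCombination_single] at h
    simp only [List.map_nil, List.prod_nil, Algebra.smul_def, mul_one, AlgHom.commutes] at h
    rw [map_eq_zero_iff _ hinj] at h
    have h3 := hnil l hl
    subst h3
    simp [h] at hl
  | succ r ih =>
    intro z c hc h l₀ hl₀ hzl₀
    let Q := (c.support.filter fun l => z ≤ l.headD top).image fun l => l.headD top
    obtain ⟨y, hyQ, hymax⟩ := Finset.exists_maximal (s := Q)
      ⟨_, Finset.mem_image_of_mem _ (Finset.mem_filter.2 ⟨hl₀, hzl₀⟩)⟩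
    obtain ⟨l₁, hl₁, hl₁y⟩ := Finset.mem_image.1 hyQ
    obtain ⟨hl₁c, hzl₁⟩ := Finset.mem_filter.1 hl₁
    have hzy : z ≤ y := hl₁y ▸ hzl₁
    have hky : kill y (Finsupp.linearCombination R (fun l => (l.map d).prod) c) = 0 := by
      rw [← hcomp z y hzy, h, map_zero]
    have hsurv : ∀ l ∈ c.support, y ≤ l.headD top → l.headD top = y := by
      intro l hl hyl
      exact le_antisymm (hymax (Finset.mem_image_of_mem _
        (Finset.mem_filter.2 ⟨hl, hzy.trans hyl⟩)) hyl) hyl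
    have hky' : ∑ l ∈ c.support with l.headD top = y, c l • kill y (l.map d).prod = 0 := by
      rw [Finsupp.linearCombination_apply, Finsupp.sum, map_sum] at hky
      rw [← hky, Finset.sum_filter]
      refine Finset.sum_congr rfl fun l hl => ?_
      split_ifs with hly
      · rw [map_smul]
      · rw [map_smul, kill_wordProd_eq_zero hzero htop (fun h' => hly (hsurv l hl h')), smul_zero]
    by_cases hyt : y = top
    · have hl₁' : l₁ = [] := eq_nil_of_headD_eq_top (hc _ hl₁c).1 (hl₁y.trans hyt)
      have : (c.support.filter fun l => l.headD top = y) = {[]} := by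
        ext l
        simp only [Finset.mem_filter, Finset.mem_singleton]
        constructor
        · exact fun h' => eq_nil_of_headD_eq_top (hc _ h'.1).1 (h'.2.trans hyt)
        · rintro rfl
          exact ⟨hl₁' ▸ hl₁c, by simp [hyt]⟩
      rw [this] at hky'
      simp only [Finset.sum_singleton, List.map_nil, List.prod_nil, map_one, Algebra.smul_def,
        mul_one] at hky'
      rw [map_eq_zero_iff _ hinj] at hky'
      rw [hl₁'] at hl₁c
      simp [hky'] at hl₁c
    · let c' : List Λ →₀ R := c.comapDomain (fun l => y :: l)
        (fun a _ b _ hab => (List.cons_injective hab))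
      have hc' : ∀ l, c' l = c (y :: l) := fun l => Finsupp.comapDomain_apply _ _ _ _
      have hmem : ∀ l ∈ c'.support, y :: l ∈ c.support := by
        intro l hl
        rw [Finsupp.mem_support_iff, hc'] at hl
        exact Finsupp.mem_support_iff.2 hl
      have hprod : kill y (d y) *
          kill y (Finsupp.linearCombination R (fun l => (l.map d).prod) c') = 0 := by
        rw [← hky', Finsupp.linearCombination_apply, Finsupp.sum, map_sum, Finset.mul_sum]
        refine Finset.sum_bij (fun l _ => y :: l) ?_ ?_ ?_ ?_
        · intro l hl
          exact Finset.mem_filter.2 ⟨hmem l hl, by simp⟩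
        · intro a _ b _ hab
          exact List.cons_injective hab
        · intro l hl
          obtain ⟨hl, hly⟩ := Finset.mem_filter.1 hl
          obtain ⟨l', rfl⟩ := eq_cons_of_headD_eq hyt hly
          refine ⟨l', ?_, rfl⟩
          rw [Finsupp.mem_support_iff, hc']
          exact Finsupp.mem_support_iff.1 hl
        · intro l _
          rw [map_smul, hc', List.map_cons, List.prod_cons, map_mul, mul_smul_comm]
      have h0 : kill y (Finsupp.linearCombination R (fun l => (l.map d).prod) c') = 0 :=
        hreg y (by simpa using hprod)
      have hfin := ih y c' (fun l hl => ⟨basisWords_tail (hc _ (hmem l hl)).1, by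
        have := (hc _ (hmem l hl)).2; simp at this; omega⟩) h0
      obtain ⟨l', rfl⟩ := eq_cons_of_headD_eq hyt hl₁y
      refine hfin l' ?_ (le_headD_of_cons_mem htop (hc _ hl₁c).1)
      rw [Finsupp.mem_support_iff, hc']
      exact Finsupp.mem_support_iff.1 hl₁c

end Independence

section Degenerate

open MvPolynomial

variable (m n : ℕ) (R : Type u) [CommRing R]

/-- The largest column sequence `n, …, n + m - 1`. -/
def topCols : Cols m (n + m) := ⟨fun i => Fin.natAdd n i, fun _ _ h => by simpa using h⟩

variable {m n}

theorem cols_le_natAdd (z : Cols m (n + m)) (i : Fin m) : z.1 i ≤ Fin.natAdd n i := by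
  rw [Fin.le_def, Fin.val_natAdd]
  have key : ∀ k : ℕ, ∀ j : Fin m, (j : ℕ) + k + 1 = m → (z.1 j : ℕ) + k + 1 ≤ n + m := by
    intro k
    induction k with
    | zero => intro j _; have := (z.1 j).2; omega
    | succ k ih =>
      intro j hj
      have h1 := ih ⟨j + 1, by omega⟩ (by simp; omega)
      have h2 : z.1 j < z.1 ⟨j + 1, by omega⟩ := z.2 (by simp [Fin.lt_def])
      rw [Fin.lt_def] at h2
      omega
  have := key (m - 1 - i) i (by omega)
  omega

theorem le_topCols (z : Cols m (n + m)) : z ≤ topCols m n := fun i => cols_le_natAdd z i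

variable (m n)

/-- The generic matrix whose last square block is lower unitriangular. -/
noncomputable def triGeneric : Matrix (Fin m) (Fin (n + m)) (MvPolynomial (Fin m × Fin (n + m)) R) :=
  fun i j => if (j : ℕ) < n + i then X (i, j) else if (j : ℕ) = n + i then 1 else 0

variable {m n}

/-- Setting to zero the variables to the left of the staircase given by `z`. -/
noncomputable def killCols (z : Cols m (n + m)) :
    MvPolynomial (Fin m × Fin (n + m)) R →ₐ[R] MvPolynomial (Fin m × Fin (n + m)) R :=
  aeval fun p => if p.2 < z.1 p.1 then 0 else X p

theorem killCols_comp {z y : Cols m (n + m)} (h : z ≤ y)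
    (e : MvPolynomial (Fin m × Fin (n + m)) R) :
    killCols R y (killCols R z e) = killCols R y e := by
  have : (killCols R y).comp (killCols R z) = killCols R y := by
    ext1 p
    simp only [killCols, AlgHom.comp_apply, aeval_X]
    split_ifs with h1 h2 h2
    · simp
    · exact absurd (h1.trans_le (h p.1)) h2
    · simp [h2]
    · simp [h2]
  exact DFunLike.congr_fun this e

theorem killCols_triGeneric_eq_zero (z : Cols m (n + m)) {i : Fin m} {j : Fin (n + m)}
    (h : j < z.1 i) : killCols R z (triGeneric m n R i j) = 0 := by
  have h1 := cols_le_natAdd z i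
  rw [Fin.le_def, Fin.val_natAdd] at h1
  rw [Fin.lt_def] at h
  have h2 : (j : ℕ) < n + i := by omega
  rw [triGeneric, if_pos h2, killCols, aeval_X, if_pos (by rwa [Fin.lt_def])]

theorem killCols_colMinor (z : Cols m (n + m)) (a : Fin m → Fin (n + m)) :
    killCols R z (colMinor (triGeneric m n R) a) =
      colMinor ((triGeneric m n R).map (killCols R z)) a :=
  (colMinor_map (killCols R z).toRingHom _ a).symm

theorem killCols_colMinor_eq_zero (z ε : Cols m (n + m)) (h : ¬ z ≤ ε) :
    killCols R z (colMinor (triGeneric m n R) ε.1) = 0 := by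
  classical
  rw [killCols_colMinor, colMinor, Matrix.det_apply']
  refine Finset.sum_eq_zero fun σ _ => ?_
  obtain ⟨i, hi⟩ : ∃ i, ε.1 i < z.1 i := by
    by_contra! h'
    exact h h'
  obtain ⟨k, hk, hk'⟩ : ∃ k, σ k ≥ i ∧ k ≤ i := by
    by_contra! h'
    have : (Finset.Iic i).card ≤ (Finset.Iio i).card :=
      Finset.card_le_card_of_injOn σ (fun k hk => by
        simp only [Finset.coe_Iic, Set.mem_Iic, Finset.coe_Iio, Set.mem_Iio] at hk ⊢
        by_contra h2
        exact absurd hk (not_le.2 (h' k (not_lt.1 h2)))) σ.injective.injOn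
    simp at this
  rw [Finset.prod_eq_zero (Finset.mem_univ k), mul_zero]
  exact killCols_triGeneric_eq_zero R z
    (((ε.2.monotone hk').trans_lt hi).trans_le (z.2.monotone hk))

theorem isLeftRegular_killCols_colMinor (z : Cols m (n + m)) :
    IsLeftRegular (killCols R z (colMinor (triGeneric m n R) z.1)) := by
  rw [killCols_colMinor, colMinor, Matrix.det_of_isUpperTriangular]
  · refine (IsRegular.left ?_)
    refine IsRegular.prod fun i _ => ?_
    have h1 := cols_le_natAdd z i
    rw [Fin.le_def, Fin.val_natAdd] at h1
    simp only [Matrix.submatrix_apply, Matrix.map_apply, id, triGeneric]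
    split_ifs with h2 h3
    · simp [killCols]
    · rw [map_one]; exact isRegular_one
    · omega
  · intro i j hij
    exact killCols_triGeneric_eq_zero R z (z.2 hij)

end Degenerate

section GenericMinors

open MvPolynomial

variable (m n : ℕ) (R : Type u) [CommRing R]

/-- The generic matrix with an identity block appended. -/
noncomputable def augGeneric :
    Matrix (Fin m) (Fin (n + m)) (MvPolynomial (Fin m × Fin n) R) :=
  fun i j => Fin.addCases (fun j => X (i, j)) (fun k => (1 : Matrix _ _ _) i k) j

variable {m n}

/-- The maximal minors of the augmented generic matrix. -/
noncomputable def genMinor (x : Cols m (n + m)) : MvPolynomial (Fin m × Fin n) R :=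
  colMinor (augGeneric m n R) x.1

/-- Products of maximal minors of the augmented generic matrix. -/
noncomputable def genWord (l : List (Cols m (n + m))) : MvPolynomial (Fin m × Fin n) R :=
  (l.map (genMinor R)).prod

theorem genMinor_topCols : genMinor R (topCols m n) = 1 := by
  have : (augGeneric m n R).submatrix id (topCols m n).1 = 1 := by
    refine Matrix.ext fun i j => ?_
    simp [augGeneric, topCols, Matrix.one_apply]
  rw [genMinor, colMinor, this, Matrix.det_one]

theorem adjoin_range_genMinor :
    Algebra.adjoin R (Set.range (genMinor R : Cols m (n + m) → _)) = ⊤ := by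
  classical
  rw [eq_top_iff, ← adjoin_range_X]
  refine Algebra.adjoin_le ?_
  rintro _ ⟨⟨i, j⟩, rfl⟩
  let a : Fin m → Fin (n + m) := Function.update (topCols m n).1 i (Fin.castAdd m j)
  have ha : colMinor (augGeneric m n R) a = X (i, j) := by
    have : (augGeneric m n R).submatrix id a = (1 : Matrix (Fin m) (Fin m) _).updateCol i
        (fun k => X (k, j)) := by
      refine Matrix.ext fun k l => ?_
      by_cases h : l = i
      · subst h; simp [a, augGeneric]
      · simp [a, augGeneric, h, topCols, Matrix.one_apply]
    rw [colMinor, this, ← Matrix.cramer_apply, Matrix.cramer_one]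
    rfl
  rw [← ha]
  by_cases hinj : Function.Injective a
  · obtain ⟨s, σ, hs⟩ := exists_cols_of_injective hinj
    have : a = s.1 ∘ ⇑σ⁻¹ := by rw [hs]; funext k; simp
    rw [this, colMinor_comp]
    have h1 := Algebra.subset_adjoin (R := R)
      (s := Set.range (genMinor R : Cols m (n + m) → _)) (Set.mem_range_self s)
    exact mul_mem (intCast_mem _ _) h1
  · rw [colMinor_eq_zero _ hinj]
    exact zero_mem _

/-- The last square block of `triGeneric`. -/
noncomputable def triBlock : Matrix (Fin m) (Fin m) (MvPolynomial (Fin m × Fin (n + m)) R) :=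
  (triGeneric m n R).submatrix id (Fin.natAdd n)

theorem det_triBlock : (triBlock R : Matrix (Fin m) (Fin m)
    (MvPolynomial (Fin m × Fin (n + m)) R)).det = 1 := by
  rw [Matrix.det_of_isLowerTriangular]
  · simp [triBlock, triGeneric]
  · intro i j hij
    have hij : i < j := hij
    simp [triBlock, triGeneric, hij.le, hij.ne', Fin.val_eq_val]

/-- The matrix `triGeneric` normalized to have an identity block. -/
noncomputable def triNormal :
    Matrix (Fin m) (Fin (n + m)) (MvPolynomial (Fin m × Fin (n + m)) R) :=
  (triBlock R : Matrix (Fin m) (Fin m) (MvPolynomial (Fin m × Fin (n + m)) R))⁻¹ *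
    triGeneric m n R

/-- The substitution turning the augmented generic matrix into a multiple of `triGeneric`. -/
noncomputable def toTri :
    MvPolynomial (Fin m × Fin n) R →ₐ[R] MvPolynomial (Fin m × Fin (n + m)) R :=
  aeval fun p => triNormal R p.1 (Fin.castAdd m p.2)

theorem toTri_genMinor (x : Cols m (n + m)) :
    toTri R (genMinor R x) = colMinor (triGeneric m n R) x.1 := by
  have hu : IsUnit (triBlock R : Matrix (Fin m) (Fin m)
    (MvPolynomial (Fin m × Fin (n + m)) R)).det := by rw [det_triBlock]; exact isUnit_one
  have hmap : (augGeneric m n R).map (toTri R) = triNormal R := by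
    refine Matrix.ext fun i j => ?_
    refine Fin.addCases (fun j => ?_) (fun k => ?_) j
    · simp [augGeneric, toTri]
    · have h1 : triNormal R i (Fin.natAdd n k) =
          ((triBlock R : Matrix (Fin m) (Fin m) (MvPolynomial (Fin m × Fin (n + m)) R))⁻¹ *
            triBlock R : Matrix (Fin m) (Fin m) _) i k := rfl
      rw [h1, Matrix.nonsing_inv_mul _ hu]
      simp [augGeneric, Matrix.one_apply, apply_ite (toTri R)]
  have h := colMinor_map (toTri R).toRingHom (augGeneric m n R) x.1
  rw [genMinor]
  refine Eq.trans h.symm ?_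
  change colMinor ((augGeneric m n R).map (toTri R)) x.1 = _
  have h2 : (triNormal R).submatrix id x.1 =
      (triBlock R : Matrix (Fin m) (Fin m) (MvPolynomial (Fin m × Fin (n + m)) R))⁻¹ *
        (triGeneric m n R).submatrix id x.1 := rfl
  rw [hmap, colMinor, h2, Matrix.det_mul, Matrix.det_nonsing_inv, det_triBlock,
    Ring.inverse_one, one_mul]
  rfl

/-- The degeneration attached to a column sequence. -/
noncomputable def degen (z : Cols m (n + m)) :
    MvPolynomial (Fin m × Fin n) R →ₐ[R] MvPolynomial (Fin m × Fin (n + m)) R :=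
  (killCols R z).comp (toTri R)

theorem degen_genMinor_eq_zero {z x : Cols m (n + m)} (h : ¬ z ≤ x) :
    degen R z (genMinor R x) = 0 := by
  rw [degen, AlgHom.comp_apply, toTri_genMinor, killCols_colMinor_eq_zero R z x h]

theorem isLeftRegular_degen_genMinor (z : Cols m (n + m)) :
    IsLeftRegular (degen R z (genMinor R z)) := by
  rw [degen, AlgHom.comp_apply, toTri_genMinor]
  exact isLeftRegular_killCols_colMinor R z

theorem ker_degen_mono {z y : Cols m (n + m)} (h : z ≤ y) :
    RingHom.ker (degen R z) ≤ RingHom.ker (degen R y) := by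
  intro a ha
  rw [RingHom.mem_ker, degen, AlgHom.comp_apply] at ha ⊢
  rw [← killCols_comp R h, ha, map_zero]

theorem toTri_genWord (l : List (Cols m (n + m))) :
    toTri R (genWord R l) = (l.map fun x => colMinor (triGeneric m n R) x.1).prod := by
  rw [genWord, map_list_prod, List.map_map]
  congr 1
  exact List.map_congr_left fun x _ => toTri_genMinor R x

theorem degen_genWord_eq_zero {z : Cols m (n + m)} {l : List (Cols m (n + m))}
    (h : ¬ z ≤ l.headD (topCols m n)) : degen R z (genWord R l) = 0 := by
  rw [degen, AlgHom.comp_apply, toTri_genWord]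
  exact kill_wordProd_eq_zero (killCols_colMinor_eq_zero R) le_topCols h

theorem not_le_headD_of_degen_eq_zero {z : Cols m (n + m)} {c : List (Cols m (n + m)) →₀ R}
    (hc : ∀ l ∈ c.support, l ∈ basisWords (topCols m n))
    (h : degen R z (Finsupp.linearCombination R (genWord R) c) = 0) :
    ∀ l ∈ c.support, ¬ z ≤ l.headD (topCols m n) := by
  have h' : killCols R z (Finsupp.linearCombination R
      (fun l => (l.map fun x => colMinor (triGeneric m n R) x.1).prod) c) = 0 := by
    rw [degen, AlgHom.comp_apply] at h
    rw [← h]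
    congr 1
    rw [Finsupp.linearCombination_apply, Finsupp.linearCombination_apply, Finsupp.sum,
      Finsupp.sum, map_sum]
    exact Finset.sum_congr rfl fun l _ => by rw [map_smul, toTri_genWord]
  have hinj : Function.Injective
      (algebraMap R (MvPolynomial (Fin m × Fin (n + m)) R)) := C_injective _ _
  exact not_le_headD_of_kill_eq_zero hinj (killCols_colMinor_eq_zero R) le_topCols
    (fun z y h => killCols_comp R h) (isLeftRegular_killCols_colMinor R)
    (c.support.sup List.length) z c
    (fun l hl => ⟨hc l hl, Finset.le_sup (f := List.length) hl⟩) h'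

theorem eq_zero_of_linearCombination_genWord {c : List (Cols m (n + m)) →₀ R}
    (hc : ∀ l ∈ c.support, l ∈ basisWords (topCols m n))
    (h : Finsupp.linearCombination R (genWord R) c = 0) : c = 0 := by
  by_contra hne
  obtain ⟨l, hl⟩ := Finsupp.support_nonempty_iff.2 hne
  exact not_le_headD_of_degen_eq_zero R (z := l.headD (topCols m n)) hc
    (by rw [h, map_zero]) l hl le_rfl

/-- The basis words whose first `k` letters exist and only use the first `n` columns. -/
def goodWords (m n k : ℕ) : Set (List (Cols m (n + m))) :=
  {l | l ∈ basisWords (topCols m n) ∧ k ≤ l.length ∧ wordGood n k l}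

/-- Discarding the letter `topCols`. -/
theorem exists_goodWord_eq {E : Type*} [CommRing E] {t v : Cols m (n + m) → E} (hm : 0 < m)
    (hv : v (topCols m n) = 1) {k : ℕ} {l : List (Cols m (n + m))} (hl : l.Pairwise (· ≤ ·))
    (hk : k ≤ l.length) (hg : wordGood n k l) :
    ∃ l' ∈ goodWords m n k, wordVal t v k l' = wordVal t v k l := by
  have hT : ∀ x : Cols m (n + m), ColsLT n x → x ≠ topCols m n := by
    rintro x hx rfl
    have := hx ⟨0, hm⟩
    simp [topCols] at this
  refine ⟨l.filter (fun x => decide (x ≠ topCols m n)), ⟨⟨hl.filter _, by simp⟩, ?_⟩, ?_⟩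
  · clear hl
    induction l generalizing k with
    | nil => exact ⟨hk, hg⟩
    | cons x l ih =>
      cases k with
      | zero => exact ⟨Nat.zero_le _, by cases (List.filter _ (x :: l)) <;> trivial⟩
      | succ k =>
        obtain ⟨h1, h2⟩ := ih (k := k) (by simpa using hk) hg.2
        rw [List.filter_cons_of_pos (by simpa using hT x hg.1)]
        exact ⟨by simpa using h1, hg.1, h2⟩
  · clear hl
    induction l generalizing k with
    | nil => rfl
    | cons x l ih =>
      cases k with
      | zero =>
        have h1 := ih (k := 0) (Nat.zero_le _) (by cases l <;> trivial)
        by_cases hx : x = topCols m n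
        · rw [List.filter_cons_of_neg (by simpa using hx), h1, wordVal, hx, hv, one_mul]
        · rw [List.filter_cons_of_pos (by simpa using hx), wordVal, wordVal, h1]
      | succ k =>
        have h1 := ih (k := k) (by simpa using hk) hg.2
        rw [List.filter_cons_of_pos (by simpa using hT x hg.1), wordVal, wordVal, h1]

/-- Straightening, with the letter `topCols` discarded. -/
theorem wordVal_mem_span_goodWords {E : Type*} [CommRing E] [Algebra R E]
    {t v : Cols m (n + m) → E} (hm : 0 < m) (hv : v (topCols m n) = 1)
    (hvv : ∀ x y, ¬ x ≤ y → v x * v y ∈ Submodule.span R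
      {d | ∃ p q, ColStep x y p q ∧ d = v p * v q})
    (htv : ∀ x y, ¬ x ≤ y → ColsLT n x → t x * v y ∈ Submodule.span R
      {d | ∃ p q, ColStep x y p q ∧ d = t p * v q})
    (htt : ∀ x y, ¬ x ≤ y → ColsLT n x → ColsLT n y → t x * t y ∈ Submodule.span R
      {d | ∃ p q, ColStep x y p q ∧ d = t p * t q})
    {k : ℕ} {l : List (Cols m (n + m))} (hk : k ≤ l.length) (hg : wordGood n k l) :
    wordVal t v k l ∈ Submodule.span R (wordVal t v k '' goodWords m n k) := by
  refine Submodule.span_le.2 ?_ (wordVal_mem_span hvv htv htt l.length k l rfl hg)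
  rintro _ ⟨l', ⟨h1, h2, h3⟩, rfl⟩
  obtain ⟨l'', h4, h5⟩ := exists_goodWord_eq (t := t) hm hv h1 (h2 ▸ hk) h3
  exact h5 ▸ Submodule.subset_span ⟨l'', h4, rfl⟩

theorem genMinor_mul_mem_span {x y : Cols m (n + m)} (hxy : ¬ x ≤ y) :
    genMinor R x * genMinor R y ∈ Submodule.span R
      {d | ∃ p q, ColStep x y p q ∧ d = genMinor R p * genMinor R q} :=
  Submodule.span_le_restrictScalars ℤ R _ (colMinor_mul_mem_span (augGeneric m n R) hxy)

theorem wordVal_self {E : Type*} [CommRing E] {N : ℕ} (v : Cols m N → E) (k : ℕ)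
    (l : List (Cols m N)) : wordVal v v k l = (l.map v).prod := by
  induction l generalizing k with
  | nil => simp [wordVal]
  | cons x l ih => rw [wordVal_cons, ih]; simp

theorem genWord_mem_span (hm : 0 < m) {k : ℕ} {l : List (Cols m (n + m))} (hk : k ≤ l.length)
    (hg : wordGood n k l) : genWord R l ∈ Submodule.span R (genWord R '' goodWords m n k) := by
  have h := wordVal_mem_span_goodWords R (t := genMinor R) (v := genMinor R) hm
    (genMinor_topCols R) (fun x y h => genMinor_mul_mem_span R h)
    (fun x y h _ => genMinor_mul_mem_span R h) (fun x y h _ _ => genMinor_mul_mem_span R h) hk hg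
  have : wordVal (genMinor R) (genMinor R) k = genWord (m := m) (n := n) R :=
    funext fun l => wordVal_self _ _ _
  rwa [this] at h

variable (m n) in
/-- The ideal of maximal minors of the generic matrix. -/
noncomputable def genIdeal : Ideal (MvPolynomial (Fin m × Fin n) R) :=
  Ideal.span (genMinor R '' {x : Cols m (n + m) | ColsLT n x})

theorem genWord_mem_pow {k : ℕ} {l : List (Cols m (n + m))} (hk : k ≤ l.length)
    (hg : wordGood n k l) : genWord R l ∈ genIdeal m n R ^ k := by
  induction l generalizing k with
  | nil => obtain rfl : k = 0 := by simpa using hk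
           simp
  | cons x l ih =>
    cases k with
    | zero => simp
    | succ k =>
      rw [genWord, List.map_cons, List.prod_cons, pow_succ']
      exact Ideal.mul_mem_mul (Ideal.subset_span ⟨x, hg.1, rfl⟩) (ih (by simpa using hk) hg.2)

theorem mem_span_genWord_of_mem_pow {k : ℕ} {a : MvPolynomial (Fin m × Fin n) R}
    (ha : a ∈ genIdeal m n R ^ k) : a ∈ Submodule.span R
      (genWord R '' {l : List (Cols m (n + m)) | k ≤ l.length ∧ wordGood n k l}) := by
  induction k generalizing a with
  | zero =>
    have h : a ∈ Algebra.adjoin R (Set.range (genMinor R : Cols m (n + m) → _)) := by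
      rw [adjoin_range_genMinor]; trivial
    rw [← Subalgebra.mem_toSubmodule, Algebra.adjoin_eq_span] at h
    refine Submodule.span_mono ?_ h
    intro b hb
    obtain ⟨L, hL, rfl⟩ := Submonoid.exists_list_of_mem_closure hb
    obtain ⟨l, rfl⟩ : ∃ l : List (Cols m (n + m)), l.map (genMinor R) = L := by
      rw [← Set.mem_range, Set.range_list_map]
      exact hL
    exact ⟨l, ⟨Nat.zero_le _, by cases l <;> trivial⟩, rfl⟩
  | succ k ih =>
    rw [pow_succ'] at ha
    induction ha using Submodule.mul_induction_on' with
    | add _ _ _ _ h1 h2 => exact add_mem h1 h2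
    | mem_mul_mem r hr b hb =>
      induction hr using Submodule.span_induction generalizing b with
      | zero => simp
      | add _ _ _ _ h1 h2 => rw [add_mul]; exact add_mem (h1 b hb) (h2 b hb)
      | smul s _ _ h1 =>
        rw [smul_eq_mul, mul_comm s, mul_assoc]
        exact h1 _ (Ideal.mul_mem_left _ _ hb)
      | mem r hr =>
        obtain ⟨x, hx, rfl⟩ := hr
        have h2 := Submodule.mem_map_of_mem (f := LinearMap.mulLeft R (genMinor R x)) (ih hb)
        rw [Submodule.map_span] at h2
        refine Submodule.span_mono ?_ h2
        rintro _ ⟨_, ⟨l, ⟨hl, hg⟩, rfl⟩, rfl⟩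
        exact ⟨x :: l, ⟨by simpa using hl, hx, hg⟩, rfl⟩

theorem exists_linearCombination_of_mem_pow (hm : 0 < m) {k : ℕ}
    {a : MvPolynomial (Fin m × Fin n) R} (ha : a ∈ genIdeal m n R ^ k) :
    ∃ c : List (Cols m (n + m)) →₀ R, (∀ l ∈ c.support, l ∈ goodWords m n k) ∧
      Finsupp.linearCombination R (genWord R) c = a := by
  have h : a ∈ Submodule.span R (genWord R '' goodWords m n k) := by
    refine Submodule.span_le.2 ?_ (mem_span_genWord_of_mem_pow R ha)
    rintro _ ⟨l, ⟨hk, hg⟩, rfl⟩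
    exact genWord_mem_span R hm hk hg
  obtain ⟨c, hc, rfl⟩ := (Finsupp.mem_span_image_iff_linearCombination R).1 h
  exact ⟨c, fun l hl => hc hl, rfl⟩

end GenericMinors

section Rees

open MvPolynomial

variable {S ι : Type*} [CommRing S]

theorem aeval_C_mul_X_of_isHomogeneous (f : ι → S) {p : MvPolynomial ι S} {k : ℕ}
    (hp : p.IsHomogeneous k) :
    aeval (fun i => Polynomial.C (f i) * Polynomial.X) p =
      Polynomial.C (aeval f p) * Polynomial.X ^ k := by
  rw [aeval_def, eval₂_eq, aeval_def, eval₂_eq, map_sum, Finset.sum_mul]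
  refine Finset.sum_congr rfl fun d hd => ?_
  have hdk : ∑ i ∈ d.support, d i = k := by
    have := hp (mem_support_iff.1 hd)
    exact (DFunLike.congr_fun Finsupp.degree_eq_weight_one d).trans this
  simp only [mul_pow, Finset.prod_mul_distrib, map_mul, map_prod, map_pow, Algebra.algebraMap_self,
    RingHom.id_apply, mul_assoc]
  rw [Finset.prod_pow_eq_pow_sum, hdk]
  rfl

theorem aeval_C_mul_X (f : ι → S) (p : MvPolynomial ι S) :
    aeval (fun i => Polynomial.C (f i) * Polynomial.X) p =
      ∑ k ∈ Finset.range (p.totalDegree + 1),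
        Polynomial.C (aeval f (homogeneousComponent k p)) * Polynomial.X ^ k := by
  conv_lhs => rw [← sum_homogeneousComponent p, map_sum]
  exact Finset.sum_congr rfl fun k _ =>
    aeval_C_mul_X_of_isHomogeneous f (homogeneousComponent_isHomogeneous k p)

theorem mem_reesDefIdeal_iff {f : ι → S} {p : MvPolynomial ι S} :
    p ∈ reesDefIdeal f ↔ ∀ k, aeval f (homogeneousComponent k p) = 0 := by
  rw [reesDefIdeal, RingHom.mem_ker]
  constructor
  · intro h k
    by_cases hk : p.totalDegree < k
    · rw [homogeneousComponent_eq_zero k p hk, map_zero]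
    · rw [aeval_C_mul_X] at h
      have := congrArg (fun q => Polynomial.coeff q k) h
      simp only [Polynomial.finsetSum_coeff, Polynomial.coeff_C_mul_X_pow, Polynomial.coeff_zero]
        at this
      rw [Finset.sum_ite_eq, if_pos (by simp; omega)] at this
      exact this
  · intro h
    rw [aeval_C_mul_X]
    exact Finset.sum_eq_zero fun k _ => by rw [h k]; simp

theorem mem_reesDefIdeal_of_isHomogeneous {f : ι → S} {p : MvPolynomial ι S} {k : ℕ}
    (hp : p.IsHomogeneous k) : p ∈ reesDefIdeal f ↔ aeval f p = 0 := by
  rw [reesDefIdeal, RingHom.mem_ker, aeval_C_mul_X_of_isHomogeneous f hp]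
  constructor
  · intro h
    have := congrArg (fun q => Polynomial.coeff q k) h
    simpa using this
  · intro h; simp [h]

theorem aeval_eq_zero_of_mem_reesDefIdeal {f : ι → S} {p : MvPolynomial ι S}
    (hp : p ∈ reesDefIdeal f) : aeval f p = 0 := by
  rw [← sum_homogeneousComponent p, map_sum]
  exact Finset.sum_eq_zero fun k _ => mem_reesDefIdeal_iff.1 hp k

/-- The ideal generated by the linear and the constant-coefficient elements of the defining
ideal of the Rees algebra. -/
noncomputable def fiberIdeal (K : Type*) [CommSemiring K] [Algebra K S] (f : ι → S) :
    Ideal (MvPolynomial ι S) :=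
  Ideal.span ({p : MvPolynomial ι S | p ∈ reesDefIdeal f ∧ p.IsHomogeneous 1} ∪
     {p : MvPolynomial ι S | p ∈ reesDefIdeal f ∧
        ∃ q : MvPolynomial ι K, MvPolynomial.map (algebraMap K S) q = p})

theorem fiberIdeal_le (K : Type*) [CommSemiring K] [Algebra K S] (f : ι → S) :
    fiberIdeal K f ≤ reesDefIdeal f :=
  Ideal.span_le.2 (by rintro p (hp | hp) <;> exact hp.1)

theorem isFiberType_of_isHomogeneous (K : Type*) [CommSemiring K] [Algebra K S] {f : ι → S}
    (h : ∀ (k : ℕ) (p : MvPolynomial ι S), p.IsHomogeneous k → aeval f p = 0 →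
      p ∈ fiberIdeal K f) : IsFiberType K f := by
  refine le_antisymm (fun p hp => ?_) (fiberIdeal_le K f)
  rw [← sum_homogeneousComponent p]
  exact sum_mem fun k _ => h k _ (homogeneousComponent_isHomogeneous k p)
    (mem_reesDefIdeal_iff.1 hp k)

end Rees

section GenericFiber

open MvPolynomial

variable {m n : ℕ} (R : Type u) [CommRing R] {ι : Type*}
  (e : ι ≃ {x : Cols m (n + m) // ColsLT n x})

/-- The image of a polynomial in the quotient by the ideal `fiberIdeal`. -/
noncomputable abbrev fiberMk : MvPolynomial ι (MvPolynomial (Fin m × Fin n) R) →ₐ[R]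
    MvPolynomial ι (MvPolynomial (Fin m × Fin n) R) ⧸
      fiberIdeal ℤ (fun i => genMinor R (e i).1) :=
  Ideal.Quotient.mkₐ R _

open Classical in
/-- The variable attached to a column sequence. -/
noncomputable def fiberVar (A : Type*) [CommRing A] (x : Cols m (n + m)) : MvPolynomial ι A :=
  if h : ColsLT n x then X (e.symm ⟨x, h⟩) else 0

theorem isHomogeneous_fiberVar (A : Type*) [CommRing A] (x : Cols m (n + m)) :
    (fiberVar e A x).IsHomogeneous 1 := by
  rw [fiberVar]
  split_ifs
  · exact isHomogeneous_X _ _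
  · exact isHomogeneous_zero _ _ _

theorem map_fiberVar {A B : Type*} [CommRing A] [CommRing B] (φ : A →+* B)
    (x : Cols m (n + m)) : map φ (fiberVar e A x) = fiberVar e B x := by
  rw [fiberVar, fiberVar]
  split_ifs <;> simp

theorem aeval_fiberVar {x : Cols m (n + m)} (hx : ColsLT n x) :
    aeval (fun i => genMinor R (e i).1) (fiberVar e (MvPolynomial (Fin m × Fin n) R) x) =
      genMinor R x := by
  rw [fiberVar, dif_pos hx, aeval_X, Equiv.apply_symm_apply]

theorem exists_colStep_relation {x y : Cols m (n + m)} (hxy : ¬ x ≤ y) :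
    ∃ c : Cols m (n + m) × Cols m (n + m) →₀ ℤ, (∀ p ∈ c.support, ColStep x y p.1 p.2) ∧
      genMinor R x * genMinor R y = c.sum fun p a => a • (genMinor R p.1 * genMinor R p.2) := by
  have h := colMinor_mul_mem_span (augGeneric m n R) hxy
  have hset : {d | ∃ p q : Cols m (n + m), ColStep x y p q ∧
      d = colMinor (augGeneric m n R) p.1 * colMinor (augGeneric m n R) q.1} =
      (fun p : Cols m (n + m) × Cols m (n + m) => genMinor R p.1 * genMinor R p.2) ''
        {p | ColStep x y p.1 p.2} := by
    ext d
    constructor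
    · rintro ⟨p, q, h, rfl⟩; exact ⟨(p, q), h, rfl⟩
    · rintro ⟨p, h, rfl⟩; exact ⟨p.1, p.2, h, rfl⟩
  rw [hset, Finsupp.mem_span_image_iff_linearCombination] at h
  obtain ⟨c, hc, h⟩ := h
  exact ⟨c, fun p hp => hc hp, h.symm⟩

theorem fiberMk_mul_mem_span {x y : Cols m (n + m)} (hxy : ¬ x ≤ y)
    (t v : Cols m (n + m) → MvPolynomial ι (MvPolynomial (Fin m × Fin n) R))
    (hrel : ∀ c : Cols m (n + m) × Cols m (n + m) →₀ ℤ,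
      (∀ p ∈ c.support, ColStep x y p.1 p.2) →
      (genMinor R x * genMinor R y = c.sum fun p a => a • (genMinor R p.1 * genMinor R p.2)) →
      t x * v y - c.sum (fun p a => a • (t p.1 * v p.2)) ∈
        fiberIdeal ℤ (fun i => genMinor R (e i).1)) :
    fiberMk R e (t x) * fiberMk R e (v y) ∈ Submodule.span R
      {d | ∃ p q, ColStep x y p q ∧ d = fiberMk R e (t p) * fiberMk R e (v q)} := by
  obtain ⟨c, hc, h⟩ := exists_colStep_relation R hxy
  have h1 := hrel c hc h
  rw [← Ideal.Quotient.eq_zero_iff_mem, map_sub, sub_eq_zero, Finsupp.sum, map_sum] at h1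
  have h2 : fiberMk R e (t x) * fiberMk R e (v y) =
      ∑ p ∈ c.support, c p • (fiberMk R e (t p.1) * fiberMk R e (v p.2)) := by
    rw [← map_mul]
    refine Eq.trans h1 (Finset.sum_congr rfl fun p _ => ?_)
    rw [← map_mul, map_zsmul]
    rfl
  rw [h2]
  refine sum_mem fun p hp => ?_
  rw [← Int.cast_smul_eq_zsmul R]
  exact Submodule.smul_mem _ _ (Submodule.subset_span ⟨p.1, p.2, hc p hp, rfl⟩)

theorem aeval_wordVal {k : ℕ} {l : List (Cols m (n + m))} (hg : wordGood n k l) :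
    aeval (fun i => genMinor R (e i).1) (wordVal (fiberVar e _) (fun x => C (genMinor R x)) k l) =
      genWord R l := by
  induction l generalizing k with
  | nil => simp [wordVal, genWord]
  | cons x l ih =>
    cases k with
    | zero =>
      rw [wordVal, map_mul, ih (by cases l <;> trivial), aeval_C, genWord, genWord,
        List.map_cons, List.prod_cons]
      rfl
    | succ k =>
      rw [wordVal, map_mul, ih hg.2, aeval_fiberVar R e hg.1, genWord, genWord, List.map_cons,
        List.prod_cons]

theorem map_wordVal {A B : Type*} [CommRing A] [CommRing B] (φ : A →+* B) {N : ℕ}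
    (t v : Cols m N → A) (k : ℕ) (l : List (Cols m N)) :
    φ (wordVal t v k l) = wordVal (fun x => φ (t x)) (fun x => φ (v x)) k l := by
  induction l generalizing k with
  | nil => simp [wordVal]
  | cons x l ih => cases k <;> simp [wordVal, ih]

theorem mem_span_wordVal_of_isHomogeneous (k : ℕ) :
    ∀ p : MvPolynomial ι (MvPolynomial (Fin m × Fin n) R), p.IsHomogeneous k →
    p ∈ Submodule.span R (wordVal (fiberVar e _) (fun x => C (genMinor R x)) k ''
      {l | k ≤ l.length ∧ wordGood n k l}) := by
  suffices h : ∀ (d : ι →₀ ℕ) (s : MvPolynomial (Fin m × Fin n) R), d.degree = k →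
      monomial d s ∈ Submodule.span R (wordVal (fiberVar e _) (fun x => C (genMinor R x)) k ''
        {l | k ≤ l.length ∧ wordGood n k l}) by
    intro p hp
    rw [p.as_sum]
    refine sum_mem fun d hd => h d _ ?_
    have := hp (mem_support_iff.1 hd)
    exact (DFunLike.congr_fun Finsupp.degree_eq_weight_one d).trans this
  induction k with
  | zero =>
    intro d s hd
    rw [Finsupp.degree_eq_zero_iff] at hd
    subst hd
    have h : s ∈ genIdeal m n R ^ 0 := by simp
    have h2 := Submodule.mem_map_of_mem (f := ((Algebra.ofId (MvPolynomial (Fin m × Fin n) R)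
      (MvPolynomial ι (MvPolynomial (Fin m × Fin n) R))).restrictScalars R).toLinearMap)
      (mem_span_genWord_of_mem_pow R h)
    rw [Submodule.map_span] at h2
    refine Submodule.span_mono ?_ h2
    rintro _ ⟨_, ⟨l, hl, rfl⟩, rfl⟩
    refine ⟨l, hl, ?_⟩
    rw [wordVal_zero]
    change _ = C (genWord R l)
    rw [genWord, map_list_prod, List.map_map]
    rfl
  | succ k ih =>
    intro d s hd
    obtain ⟨i, hi⟩ : ∃ i, d i ≠ 0 := by
      by_contra! h
      have : d = 0 := Finsupp.ext h
      simp [this] at hd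
    have hle : Finsupp.single i 1 ≤ d := by
      rw [Finsupp.single_le_iff]; omega
    have hd' : d = Finsupp.single i 1 + (d - Finsupp.single i 1) :=
      (add_tsub_cancel_of_le hle).symm
    have hdeg : (d - Finsupp.single i 1).degree = k := by
      have := congrArg Finsupp.degree hd'
      rw [map_add, Finsupp.degree_single, hd] at this
      omega
    have hmon : monomial d s = fiberVar e _ (e i).1 * monomial (d - Finsupp.single i 1) s := by
      rw [fiberVar, dif_pos (e i).2, Subtype.coe_eta, Equiv.symm_apply_apply]
      conv_lhs => rw [hd']
      rw [X, monomial_mul, one_mul]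
    rw [hmon]
    have h2 := Submodule.mem_map_of_mem (f := LinearMap.mulLeft R
      (fiberVar e (MvPolynomial (Fin m × Fin n) R) (e i).1)) (ih _ s hdeg)
    rw [Submodule.map_span] at h2
    refine Submodule.span_mono ?_ h2
    rintro _ ⟨_, ⟨l, ⟨hl, hg⟩, rfl⟩, rfl⟩
    exact ⟨(e i).1 :: l, ⟨by simpa using hl, (e i).2, hg⟩, rfl⟩

theorem isHomogeneous_fiberRelation {A : Type*} [CommRing A] {t v : Cols m (n + m) → MvPolynomial ι A}
    {j : ℕ} (h : ∀ x y, (t x * v y).IsHomogeneous j) (x y : Cols m (n + m))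
    (c : Cols m (n + m) × Cols m (n + m) →₀ ℤ) :
    (t x * v y - c.sum (fun p a => a • (t p.1 * v p.2))).IsHomogeneous j := by
  refine (h x y).sub (IsHomogeneous.sum _ _ _ fun p _ => ?_)
  have : c p • (t p.1 * v p.2) = C ((c p : ℤ) : A) * (t p.1 * v p.2) := by
    rw [zsmul_eq_mul, map_intCast]
  change (c p • (t p.1 * v p.2)).IsHomogeneous j
  rw [this]
  simpa using (isHomogeneous_C ι ((c p : ℤ) : A)).mul (h p.1 p.2)

theorem aeval_fiberRelation_eq_zero
    {t v : Cols m (n + m) → MvPolynomial ι (MvPolynomial (Fin m × Fin n) R)}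
    {x y : Cols m (n + m)} {c : Cols m (n + m) × Cols m (n + m) →₀ ℤ}
    (hc : genMinor R x * genMinor R y = c.sum fun p a => a • (genMinor R p.1 * genMinor R p.2))
    (h1 : aeval (fun i => genMinor R (e i).1) (t x) = genMinor R x)
    (h2 : aeval (fun i => genMinor R (e i).1) (v y) = genMinor R y)
    (h3 : ∀ p ∈ c.support, aeval (fun i => genMinor R (e i).1) (t p.1) = genMinor R p.1 ∧
      aeval (fun i => genMinor R (e i).1) (v p.2) = genMinor R p.2) :
    aeval (fun i => genMinor R (e i).1)
      (t x * v y - c.sum (fun p a => a • (t p.1 * v p.2))) = 0 := by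
  rw [map_sub, map_mul, h1, h2, hc, sub_eq_zero, Finsupp.sum, Finsupp.sum, map_sum]
  refine Finset.sum_congr rfl fun p hp => ?_
  rw [map_zsmul, map_mul, (h3 p hp).1, (h3 p hp).2]

theorem fiberMk_C_mul_C_mem_span {x y : Cols m (n + m)} (hxy : ¬ x ≤ y) :
    fiberMk R e (C (genMinor R x)) * fiberMk R e (C (genMinor R y)) ∈ Submodule.span R
      {d | ∃ p q, ColStep x y p q ∧
        d = fiberMk R e (C (genMinor R p)) * fiberMk R e (C (genMinor R q))} := by
  refine fiberMk_mul_mem_span R e hxy (fun x => C (genMinor R x)) (fun x => C (genMinor R x))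
    fun c hc h => ?_
  have : C (genMinor R x) * C (genMinor R y) - c.sum (fun p a =>
      a • (C (genMinor R p.1) * C (genMinor R p.2))) =
      (0 : MvPolynomial ι (MvPolynomial (Fin m × Fin n) R)) := by
    rw [← map_mul, h, sub_eq_zero, Finsupp.sum, Finsupp.sum, map_sum]
    exact Finset.sum_congr rfl fun p _ => by rw [map_zsmul, map_mul]
  rw [this]
  exact zero_mem _

theorem fiberMk_fiberVar_mul_C_mem_span {x y : Cols m (n + m)} (hxy : ¬ x ≤ y)
    (hx : ColsLT n x) :
    fiberMk R e (fiberVar e _ x) * fiberMk R e (C (genMinor R y)) ∈ Submodule.span R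
      {d | ∃ p q, ColStep x y p q ∧
        d = fiberMk R e (fiberVar e _ p) * fiberMk R e (C (genMinor R q))} := by
  refine fiberMk_mul_mem_span R e hxy (fiberVar e _) (fun x => C (genMinor R x))
    fun c hc h => ?_
  have hh := isHomogeneous_fiberRelation (j := 1)
    (t := fiberVar e (MvPolynomial (Fin m × Fin n) R)) (v := fun x => C (genMinor R x))
    (fun x y => by
      simpa using (isHomogeneous_fiberVar e _ x).mul (isHomogeneous_C ι (genMinor R y))) x y c
  refine Ideal.subset_span (Or.inl ⟨?_, hh⟩)
  rw [mem_reesDefIdeal_of_isHomogeneous hh]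
  have hC : ∀ z, aeval (fun i => genMinor R (e i).1)
      (C (genMinor R z) : MvPolynomial ι (MvPolynomial (Fin m × Fin n) R)) = genMinor R z :=
    fun z => by rw [aeval_C, Algebra.algebraMap_self, RingHom.id_apply]
  exact aeval_fiberRelation_eq_zero R e (t := fiberVar e _) (v := fun x => C (genMinor R x)) h
    (aeval_fiberVar R e hx) (hC y) fun p hp =>
    ⟨aeval_fiberVar R e ((hc p hp).left_lt n hx), hC p.2⟩

theorem fiberMk_fiberVar_mul_fiberVar_mem_span {x y : Cols m (n + m)} (hxy : ¬ x ≤ y)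
    (hx : ColsLT n x) (hy : ColsLT n y) :
    fiberMk R e (fiberVar e _ x) * fiberMk R e (fiberVar e _ y) ∈ Submodule.span R
      {d | ∃ p q, ColStep x y p q ∧
        d = fiberMk R e (fiberVar e _ p) * fiberMk R e (fiberVar e _ q)} := by
  refine fiberMk_mul_mem_span R e hxy (fiberVar e _) (fiberVar e _) fun c hc h => ?_
  have hh := isHomogeneous_fiberRelation (j := 2)
    (t := fiberVar e (MvPolynomial (Fin m × Fin n) R))
    (v := fiberVar e (MvPolynomial (Fin m × Fin n) R)) (fun x y =>
      (isHomogeneous_fiberVar e _ x).mul (isHomogeneous_fiberVar e _ y)) x y c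
  refine Ideal.subset_span (Or.inr ⟨?_, fiberVar e ℤ x * fiberVar e ℤ y -
      c.sum (fun p a => a • (fiberVar e ℤ p.1 * fiberVar e ℤ p.2)), ?_⟩)
  · rw [mem_reesDefIdeal_of_isHomogeneous hh]
    exact aeval_fiberRelation_eq_zero R e h (aeval_fiberVar R e hx) (aeval_fiberVar R e hy)
      fun p hp => ⟨aeval_fiberVar R e ((hc p hp).left_lt n hx),
        aeval_fiberVar R e ((hc p hp).right_lt n hx hy)⟩
  · rw [map_sub, map_mul, map_fiberVar, map_fiberVar, Finsupp.sum, Finsupp.sum, map_sum]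
    congr 1
    exact Finset.sum_congr rfl fun p _ => by
      rw [map_zsmul, map_mul, map_fiberVar, map_fiberVar]

theorem isFiberType_genMinor (hm : 0 < m) : IsFiberType ℤ (fun i => genMinor R (e i).1) := by
  refine isFiberType_of_isHomogeneous ℤ fun k F hF hF0 => ?_
  have hstraight : ∀ (l : List (Cols m (n + m))), k ≤ l.length → wordGood n k l →
      wordVal (fun x => fiberMk R e (fiberVar e _ x)) (fun x => fiberMk R e (C (genMinor R x))) k l
      ∈ Submodule.span R (wordVal (fun x => fiberMk R e (fiberVar e _ x))
        (fun x => fiberMk R e (C (genMinor R x))) k '' goodWords m n k) := by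
    intro l hl hg
    exact wordVal_mem_span_goodWords R hm
      (by rw [genMinor_topCols, map_one, map_one])
      (fun x y hxy => fiberMk_C_mul_C_mem_span R e hxy)
      (fun x y hxy hx => fiberMk_fiberVar_mul_C_mem_span R e hxy hx)
      (fun x y hxy hx hy => fiberMk_fiberVar_mul_fiberVar_mem_span R e hxy hx hy) hl hg
  have hmem : fiberMk R e F ∈ Submodule.span R (wordVal (fun x => fiberMk R e (fiberVar e _ x))
        (fun x => fiberMk R e (C (genMinor R x))) k '' goodWords m n k) := by
    have h2 := Submodule.mem_map_of_mem (f := (fiberMk R e).toLinearMap)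
      (mem_span_wordVal_of_isHomogeneous R e k F hF)
    rw [Submodule.map_span] at h2
    refine Submodule.span_le.2 ?_ h2
    rintro _ ⟨_, ⟨l, ⟨hl, hg⟩, rfl⟩, rfl⟩
    have h3 := map_wordVal (fiberMk R e).toRingHom (fiberVar e _) (fun x => C (genMinor R x)) k l
    change (fiberMk R e).toRingHom _ ∈ _
    rw [h3]
    exact hstraight l hl hg
  obtain ⟨c, hc, hcF⟩ := (Finsupp.mem_span_image_iff_linearCombination R).1 hmem
  have hdiff : F - Finsupp.linearCombination R
      (wordVal (fiberVar e _) (fun x => C (genMinor R x)) k) c ∈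
      fiberIdeal ℤ (fun i => genMinor R (e i).1) := by
    rw [← Ideal.Quotient.eq_zero_iff_mem, map_sub, sub_eq_zero]
    change fiberMk R e F = fiberMk R e _
    rw [← hcF, Finsupp.linearCombination_apply, Finsupp.linearCombination_apply, Finsupp.sum,
      Finsupp.sum, map_sum]
    refine Finset.sum_congr rfl fun l _ => ?_
    rw [map_smul]
    congr 1
    exact (map_wordVal (fiberMk R e).toRingHom _ _ k l).symm
  have hzero : Finsupp.linearCombination R (genWord R) c = 0 := by
    have h1 := aeval_eq_zero_of_mem_reesDefIdeal (fiberIdeal_le ℤ _ hdiff)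
    rw [map_sub, hF0, zero_sub, neg_eq_zero] at h1
    rw [← h1, Finsupp.linearCombination_apply, Finsupp.linearCombination_apply, Finsupp.sum,
      Finsupp.sum, map_sum]
    refine Finset.sum_congr rfl fun l hl => ?_
    have h3 := aeval_wordVal R e (hc hl).2.2
    rw [← h3]
    exact (map_smul ((aeval fun i => genMinor R (e i).1).restrictScalars R) (c l) _).symm
  have hc0 := eq_zero_of_linearCombination_genWord R (fun l hl => (hc hl).1) hzero
  rw [hc0] at hdiff
  simpa using hdiff

end GenericFiber

section Layers

open MvPolynomial

variable {m n : ℕ} (R : Type u) [CommRing R]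

/-- The elements killed by the degenerations attached to a set of column sequences. -/
noncomputable def layer (U : Set (Cols m (n + m))) : Ideal (MvPolynomial (Fin m × Fin n) R) :=
  ⨅ z ∈ U, RingHom.ker (degen R z)

variable {R} in
theorem mem_layer {U : Set (Cols m (n + m))} {a : MvPolynomial (Fin m × Fin n) R} :
    a ∈ layer R U ↔ ∀ z ∈ U, degen R z a = 0 := by
  simp only [layer, Submodule.mem_iInf, RingHom.mem_ker]

theorem layer_anti {U V : Set (Cols m (n + m))} (h : U ⊆ V) : layer R V ≤ layer R U :=
  fun _ ha => mem_layer.2 fun z hz => mem_layer.1 ha z (h hz)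

theorem layer_empty : layer R (∅ : Set (Cols m (n + m))) = ⊤ := by simp [layer]

theorem layer_union (U V : Set (Cols m (n + m))) :
    layer R (U ∪ V) = layer R U ⊓ layer R V := by
  ext a
  simp only [Submodule.mem_inf, mem_layer, Set.mem_union, or_imp, forall_and]

theorem layer_Ici (z : Cols m (n + m)) : layer R (Set.Ici z) = RingHom.ker (degen R z) := by
  ext a
  rw [mem_layer]
  exact ⟨fun h => h z (Set.mem_Ici.2 le_rfl), fun h y hy => ker_degen_mono R hy h⟩

theorem genWord_mem_layer {U : Set (Cols m (n + m))} (hU : IsUpperSet U)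
    {l : List (Cols m (n + m))} (h : l.headD (topCols m n) ∉ U) : genWord R l ∈ layer R U :=
  mem_layer.2 fun _ hz => degen_genWord_eq_zero R fun hle => h (hU hle hz)

theorem headD_notMem_of_mem_layer {U : Set (Cols m (n + m))} {c : List (Cols m (n + m)) →₀ R}
    (hc : ∀ l ∈ c.support, l ∈ basisWords (topCols m n))
    (h : Finsupp.linearCombination R (genWord R) c ∈ layer R U) :
    ∀ l ∈ c.support, l.headD (topCols m n) ∉ U := fun l hl hlU =>
  not_le_headD_of_degen_eq_zero R hc (mem_layer.1 h _ hlU) l hl le_rfl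

theorem linearCombination_genWord_mem {c : List (Cols m (n + m)) →₀ R}
    {P : Ideal (MvPolynomial (Fin m × Fin n) R)} (h : ∀ l ∈ c.support, genWord R l ∈ P) :
    Finsupp.linearCombination R (genWord R) c ∈ P := by
  rw [Finsupp.linearCombination_apply, Finsupp.sum]
  exact sum_mem fun l hl => Submodule.smul_of_tower_mem P _ (h l hl)

theorem exists_linearCombination_genWord (hm : 0 < m) (a : MvPolynomial (Fin m × Fin n) R) :
    ∃ c : List (Cols m (n + m)) →₀ R, (∀ l ∈ c.support, l ∈ basisWords (topCols m n)) ∧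
      Finsupp.linearCombination R (genWord R) c = a := by
  obtain ⟨c, hc, h⟩ := exists_linearCombination_of_mem_pow R hm (k := 0) (a := a) (by simp)
  exact ⟨c, fun l hl => (hc l hl).1, h⟩

theorem layer_univ (hm : 0 < m) : layer R (Set.univ : Set (Cols m (n + m))) = ⊥ := by
  rw [eq_bot_iff]
  intro a ha
  obtain ⟨c, hc, rfl⟩ := exists_linearCombination_genWord R hm a
  have h : c.support = ∅ := Finset.eq_empty_of_forall_notMem fun l hl =>
    headD_notMem_of_mem_layer R hc ha l hl trivial
  rw [Finsupp.support_eq_empty] at h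
  simp [h]

theorem layer_inter (hm : 0 < m) {U V : Set (Cols m (n + m))} (hU : IsUpperSet U)
    (hV : IsUpperSet V) : layer R (U ∩ V) = layer R U ⊔ layer R V := by
  refine le_antisymm (fun a ha => ?_)
    (sup_le (layer_anti R Set.inter_subset_left) (layer_anti R Set.inter_subset_right))
  obtain ⟨c, hc, rfl⟩ := exists_linearCombination_genWord R hm a
  refine linearCombination_genWord_mem R fun l hl => ?_
  have h := headD_notMem_of_mem_layer R hc ha l hl
  by_cases hlU : l.headD (topCols m n) ∈ U
  · exact Ideal.mem_sup_right (genWord_mem_layer R hV fun hlV => h ⟨hlU, hlV⟩)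
  · exact Ideal.mem_sup_left (genWord_mem_layer R hU hlU)

theorem layer_Ioi (hm : 0 < m) {z : Cols m (n + m)} (hz : z ≠ topCols m n) :
    layer R (Set.Ioi z) = layer R (Set.Ici z) ⊔ Ideal.span {genMinor R z} := by
  refine le_antisymm (fun a ha => ?_) (sup_le (layer_anti R Set.Ioi_subset_Ici_self) ?_)
  · obtain ⟨c, hc, rfl⟩ := exists_linearCombination_genWord R hm a
    refine linearCombination_genWord_mem R fun l hl => ?_
    have h := headD_notMem_of_mem_layer R hc ha l hl
    by_cases hlz : l.headD (topCols m n) = z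
    · obtain ⟨l', rfl⟩ := eq_cons_of_headD_eq hz hlz
      refine Ideal.mem_sup_right (Ideal.mem_span_singleton.2 ⟨genWord R l', ?_⟩)
      simp [genWord]
    · exact Ideal.mem_sup_left (genWord_mem_layer R (isUpperSet_Ici z) fun hle =>
        h (lt_of_le_of_ne hle (Ne.symm hlz)))
  · rw [Ideal.span_singleton_le_iff_mem]
    exact mem_layer.2 fun y hy => degen_genMinor_eq_zero R (not_le_of_gt hy)

theorem genMinor_mul_mem_layer_Ici_iff {z : Cols m (n + m)}
    {b : MvPolynomial (Fin m × Fin n) R} :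
    genMinor R z * b ∈ layer R (Set.Ici z) ↔ b ∈ layer R (Set.Ici z) := by
  rw [layer_Ici, RingHom.mem_ker, RingHom.mem_ker, map_mul]
  exact ⟨fun h => isLeftRegular_degen_genMinor R z (by simpa using h), fun h => by simp [h]⟩

theorem genMinor_mem_of_X_mem {𝔟 : Ideal (MvPolynomial (Fin m × Fin n) R)}
    (hX : ∀ p, X p ∈ 𝔟) {x : Cols m (n + m)} (hx : x ≠ topCols m n) : genMinor R x ∈ 𝔟 := by
  rw [← Ideal.Quotient.eq_zero_iff_mem, genMinor, ← colMinor_map, colMinor]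
  obtain ⟨i, hi⟩ : ∃ i, (x.1 i : ℕ) < n := by
    by_contra! h
    refine hx (le_antisymm (le_topCols x) fun i => ?_)
    change Fin.natAdd n i ≤ x.1 i
    have key : ∀ k : ℕ, ∀ j : Fin m, (j : ℕ) = k → n + k ≤ x.1 j := by
      intro k
      induction k with
      | zero => exact fun j _ => h j
      | succ k ih =>
        intro j hj
        have h1 := ih ⟨k, by omega⟩ rfl
        have h2 : x.1 ⟨k, by omega⟩ < x.1 j := x.2 (by rw [Fin.lt_def]; simp; omega)
        rw [Fin.lt_def] at h2
        omega
    have := key i i rfl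
    rw [Fin.le_def]
    simpa using this
  refine Matrix.det_eq_zero_of_column_eq_zero i fun j => ?_
  have h1 : x.1 i = Fin.castAdd m ⟨x.1 i, hi⟩ := rfl
  simp only [Matrix.submatrix_apply, Matrix.map_apply, id]
  rw [h1, augGeneric, Fin.addCases_left]
  exact Ideal.Quotient.eq_zero_iff_mem.2 (hX _)

end Layers

section ColsCombinatorics

variable {m n N : ℕ}

/-- The pointwise maximum of column sequences. -/
def colsSup (x y : Cols m N) : Cols m N :=
  ⟨x.1 ⊔ y.1, fun _ _ h => max_lt_max (x.2 h) (y.2 h)⟩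

theorem colsSup_le_iff {x y z : Cols m N} : colsSup x y ≤ z ↔ x ≤ z ∧ y ≤ z :=
  sup_le_iff (a := x.1) (b := y.1) (c := z.1)

theorem le_colsSup_left (x y : Cols m N) : x ≤ colsSup x y := (colsSup_le_iff.1 le_rfl).1

theorem colWt_mono {x y : Cols m N} (h : x ≤ y) : colWt x.1 ≤ colWt y.1 :=
  Finset.sum_le_sum fun i _ => Fin.le_def.1 (h i)

theorem eq_of_le_of_colWt_le {x y : Cols m N} (h : x ≤ y) (hw : colWt y.1 ≤ colWt x.1) :
    x = y := by
  refine Subtype.ext (funext fun i => Fin.ext ?_)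
  have h1 := (Finset.sum_eq_sum_iff_of_le (s := Finset.univ) (f := fun i => (x.1 i : ℕ))
    (g := fun i => (y.1 i : ℕ)) fun i _ => Fin.le_def.1 (h i)).1
    (le_antisymm (colWt_mono h) hw)
  exact h1 i (Finset.mem_univ i)

theorem colWt_colsSup {ε x y : Cols m N} (hx : ε ≤ x) (hy : ε ≤ y)
    (hwx : colWt x.1 = colWt ε.1 + 1) (hwy : colWt y.1 = colWt ε.1 + 1) (hne : x ≠ y) :
    colWt (colsSup x y).1 = colWt x.1 + 1 := by
  have h1 : colWt (colsSup x y).1 + ∑ i, ((min (x.1 i) (y.1 i) : Fin N) : ℕ) =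
      colWt x.1 + colWt y.1 := by
    simp only [colWt, ← Finset.sum_add_distrib]
    refine Finset.sum_congr rfl fun i _ => ?_
    change ((max (x.1 i) (y.1 i) : Fin N) : ℕ) + _ = _
    rcases le_total (x.1 i) (y.1 i) with h | h <;> (simp [h]; try omega)
  have h2 : colWt ε.1 ≤ ∑ i, ((min (x.1 i) (y.1 i) : Fin N) : ℕ) :=
    Finset.sum_le_sum fun i _ => Fin.le_def.1 (le_min (hx i) (hy i))
  have h3 : colWt x.1 < colWt (colsSup x y).1 := by
    refine lt_of_le_of_ne (colWt_mono (le_colsSup_left x y)) fun h => hne ?_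
    have := eq_of_le_of_colWt_le (le_colsSup_left x y) h.ge
    exact (eq_of_le_of_colWt_le (this ▸ (colsSup_le_iff.1 le_rfl).2) (by omega)).symm
  omega

theorem exists_le_colWt_succ {ε x : Cols m N} (h : ε < x) :
    ∃ δ : Cols m N, ε ≤ δ ∧ δ ≤ x ∧ colWt δ.1 = colWt ε.1 + 1 := by
  classical
  have hne : (Finset.univ.filter fun i => ε.1 i < x.1 i).Nonempty := by
    by_contra! h0
    refine h.not_ge fun i => ?_
    have := Finset.filter_eq_empty_iff.1 h0 (Finset.mem_univ i)
    exact not_lt.1 this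
  obtain ⟨i, hi, hmax⟩ := Finset.exists_maximal hne
  have hi : ε.1 i < x.1 i := (Finset.mem_filter.1 hi).2
  have hmax : ∀ j, i < j → ε.1 j = x.1 j := fun j hj => le_antisymm (h.le j) <| not_lt.1 fun hlt =>
    (hmax (Finset.mem_filter.2 ⟨Finset.mem_univ j, hlt⟩) hj.le).not_gt hj
  have hlt : (ε.1 i : ℕ) + 1 < N := by have := (x.1 i).2; rw [Fin.lt_def] at hi; omega
  let f : Fin m → Fin N := Function.update ε.1 i ⟨ε.1 i + 1, hlt⟩
  have hf : StrictMono f := by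
    intro a b hab
    rw [Fin.lt_def]
    by_cases ha : a = i
    · have hb : b ≠ i := fun hb => hab.ne (ha.trans hb.symm)
      subst ha
      simp only [f, Function.update_self, Function.update_of_ne hb]
      have h1 : (x.1 a : ℕ) < x.1 b := Fin.lt_def.1 (x.2 hab)
      rw [hmax b hab]
      rw [Fin.lt_def] at hi
      omega
    · by_cases hb : b = i
      · subst hb
        simp only [f, Function.update_self, Function.update_of_ne ha]
        have h1 : (ε.1 a : ℕ) < ε.1 b := Fin.lt_def.1 (ε.2 hab)
        omega
      · simp only [f, Function.update_of_ne ha, Function.update_of_ne hb]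
        exact Fin.lt_def.1 (ε.2 hab)
  refine ⟨⟨f, hf⟩, fun j => ?_, fun j => ?_, ?_⟩
  · by_cases hj : j = i
    · subst hj
      rw [Fin.le_def]
      simp [f]
    · simp [f, hj]
  · by_cases hj : j = i
    · subst hj
      rw [Fin.le_def]
      rw [Fin.lt_def] at hi
      simpa [f] using hi
    · simpa [f, hj] using h.le j
  · simp only [colWt]
    rw [← Finset.add_sum_erase _ _ (Finset.mem_univ i),
      ← Finset.add_sum_erase _ (fun j => (ε.1 j : ℕ)) (Finset.mem_univ i)]
    have : ∑ j ∈ Finset.univ.erase i, (f j : ℕ) = ∑ j ∈ Finset.univ.erase i, (ε.1 j : ℕ) :=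
      Finset.sum_congr rfl fun j hj => by simp [f, Finset.ne_of_mem_erase hj]
    rw [this]
    simp [f]
    omega

theorem colWt_add_sq_le {x : Cols m (n + m)} (hx : ColsLT n x) :
    colWt x.1 + m * m ≤ colWt (topCols m n).1 := by
  have h1 : ∀ i : Fin m, (x.1 i : ℕ) + m ≤ n + i := by
    have key : ∀ k : ℕ, ∀ j : Fin m, (j : ℕ) + k + 1 = m → (x.1 j : ℕ) + k + 1 ≤ n := by
      intro k
      induction k with
      | zero => exact fun j _ => hx j
      | succ k ih =>
        intro j hj
        have h1 := ih ⟨j + 1, by omega⟩ (by simp; omega)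
        have h2 : x.1 j < x.1 ⟨j + 1, by omega⟩ := x.2 (by rw [Fin.lt_def]; simp)
        rw [Fin.lt_def] at h2
        omega
    intro i
    have := key (m - 1 - i) i (by omega)
    omega
  have h2 : colWt x.1 + m * m = ∑ i : Fin m, ((x.1 i : ℕ) + m) := by
    simp [colWt, Finset.sum_add_distrib]
  rw [h2]
  exact Finset.sum_le_sum fun i _ => by simpa [topCols] using h1 i

end ColsCombinatorics

section

open Pointwise

theorem GradeGE.quotient_of_mul {S : Type u} [CommRing S] {J A B P P' Q : Ideal S} {v : S}
    {k : ℕ} (hPP : P ≤ P') (hBA : ∀ b ∈ B, v * b ∈ A) (hBP : ∀ b ∈ B, v * b ∈ P')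
    (hBQ : ∀ b ∈ B, v * b ∈ P ↔ b ∈ Q)
    (hex : ∀ a ∈ A, a ∈ P' → ∃ b ∈ B, a - v * b ∈ P)
    (hB : GradeGE J (B ⧸ Submodule.comap B.subtype Q) k)
    (hA : GradeGE J (A ⧸ Submodule.comap A.subtype P') k) :
    GradeGE J (A ⧸ Submodule.comap A.subtype P) k := by
  let f : B →ₗ[S] A := ((LinearMap.mulLeft S v).restrict hBA)
  have hf : ∀ b, ((f b : A) : S) = v * b := fun _ => rfl
  have hQ : Submodule.comap B.subtype Q = (Submodule.comap A.subtype P).comap f := by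
    ext b
    exact (hBQ b b.2).symm
  refine GradeGE.of_exact_middle (f := Submodule.mapQ _ _ f hQ.le)
    (g := Submodule.factor (p := Submodule.comap A.subtype P)
      (p' := Submodule.comap A.subtype P') (Submodule.comap_mono hPP)) ?_ ?_ ?_ hB hA
  · intro x
    obtain ⟨a, rfl⟩ := Submodule.mkQ_surjective _ x
    rw [Submodule.factor_mk, Submodule.mkQ_apply, Submodule.mkQ_apply,
      Submodule.Quotient.mk_eq_zero]
    constructor
    · intro ha
      obtain ⟨b, hb, h⟩ := hex a a.2 ha
      refine ⟨Submodule.Quotient.mk ⟨b, hb⟩, ?_⟩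
      rw [Submodule.mapQ_apply, eq_comm, Submodule.Quotient.eq]
      exact h
    · rintro ⟨y, hy⟩
      obtain ⟨b, rfl⟩ := Submodule.mkQ_surjective _ y
      rw [Submodule.mkQ_apply, Submodule.mapQ_apply, eq_comm, Submodule.Quotient.eq] at hy
      have h1 : ((a : S) - v * b) ∈ P' := hPP hy
      have := add_mem h1 (hBP b b.2)
      rwa [sub_add_cancel] at this
  · rw [← LinearMap.ker_eq_bot, Submodule.mapQ, Submodule.ker_liftQ, LinearMap.ker_comp,
      Submodule.ker_mkQ, ← hQ, Submodule.mkQ_map_self]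
  · exact Submodule.factor_surjective _

theorem GradeGE.quotient_of_regular {S : Type u} [CommRing S] {J P P' : Ideal S} {v : S}
    {k : ℕ} (hv : v ∈ J) (hreg : ∀ b, v * b ∈ P → b ∈ P) (hP' : P' = P ⊔ Ideal.span {v})
    (h : GradeGE J (S ⧸ P') k) : GradeGE J (S ⧸ P) (k + 1) := by
  refine GradeGE.of_regular hv ?_ ?_
  · intro x y hxy
    obtain ⟨a, rfl⟩ := Submodule.mkQ_surjective _ x
    obtain ⟨b, rfl⟩ := Submodule.mkQ_surjective _ y
    have hxy : Submodule.Quotient.mk (v • a) = (Submodule.Quotient.mk (v • b) : S ⧸ P) := hxy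
    rw [Submodule.Quotient.eq] at hxy
    change Submodule.Quotient.mk a = Submodule.Quotient.mk b
    rw [Submodule.Quotient.eq]
    refine hreg _ ?_
    rwa [mul_sub]
  · have he : Submodule.map P.mkQ (Ideal.span {v}) = v • (⊤ : Submodule S (S ⧸ P)) := by
      rw [← Submodule.ideal_span_singleton_smul, ← Submodule.range_mkQ P, ← Submodule.map_top,
        ← Submodule.map_smul'']
      congr 1
      simp
    refine h.of_linearEquiv ?_
    exact (Submodule.quotEquivOfEq _ _ hP').trans
      ((Submodule.quotientQuotientEquivQuotientSup P (Ideal.span {v})).symm.trans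
        (Submodule.quotEquivOfEq _ _ he))

end

section GradeOfPowers

open MvPolynomial

variable {m n : ℕ} (R : Type u) [CommRing R] {𝔟 : Ideal (MvPolynomial (Fin m × Fin n) R)}
  {rs : List R}

theorem gradeGE_layer_topCols (hm : 0 < m) (hrs : RingTheory.Sequence.IsWeaklyRegular R rs)
    (hb : ∀ r ∈ rs, C r ∈ 𝔟) :
    GradeGE 𝔟 (MvPolynomial (Fin m × Fin n) R ⧸ layer R (Set.Ici (topCols m n))) rs.length := by
  let P := layer R (Set.Ici (topCols m n))
  let g : R →ₗ[R] MvPolynomial (Fin m × Fin n) R ⧸ P :=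
    Algebra.linearMap R (MvPolynomial (Fin m × Fin n) R ⧸ P)
  have hg : Function.Bijective g := by
    constructor
    · rw [← LinearMap.ker_eq_bot, eq_bot_iff]
      intro r hr
      have h1 : (C r : MvPolynomial (Fin m × Fin n) R) ∈ P :=
        Ideal.Quotient.eq_zero_iff_mem.1 (LinearMap.mem_ker.1 hr)
      have h2 := mem_layer.1 h1 _ (Set.mem_Ici.2 le_rfl)
      rw [← algebraMap_eq, AlgHom.commutes, algebraMap_eq] at h2
      exact C_injective _ _ (h2.trans C_0.symm)
    · intro y
      obtain ⟨a, rfl⟩ := Ideal.Quotient.mk_surjective y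
      obtain ⟨c, hc, rfl⟩ := exists_linearCombination_genWord R hm a
      refine ⟨c [], ?_⟩
      change Ideal.Quotient.mk P (C (c [])) = _
      rw [Ideal.Quotient.eq]
      have h1 : (C (c []) : MvPolynomial (Fin m × Fin n) R) =
          Finsupp.linearCombination R (genWord R) (Finsupp.single [] (c [])) := by
        rw [Finsupp.linearCombination_single, genWord, List.map_nil, List.prod_nil,
          Algebra.smul_def, mul_one, algebraMap_eq]
      rw [h1, ← map_sub]
      refine linearCombination_genWord_mem R fun l hl => ?_
      refine genWord_mem_layer R (isUpperSet_Ici _) fun hle => ?_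
      have hne : l ≠ [] := by
        rintro rfl
        simp at hl
      have hlc : l ∈ c.support := by
        rw [Finsupp.mem_support_iff] at hl ⊢
        simpa [Finsupp.single_apply, hne.symm] using hl
      exact hne (eq_nil_of_headD_eq_top (hc l hlc) (le_antisymm (le_topCols _) hle))
  have h1 := ((LinearEquiv.ofBijective g hg).isWeaklyRegular_congr rs).1 hrs
  have h2 := (RingTheory.Sequence.isWeaklyRegular_map_algebraMap_iff
    (MvPolynomial (Fin m × Fin n) R) (MvPolynomial (Fin m × Fin n) R ⧸ P) rs).2 h1
  have h3 := GradeGE.of_isWeaklyRegular (J := 𝔟) (by simpa using hb) h2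
  rwa [List.length_map] at h3

/-- The union of the principal upper sets generated by a finite set. -/
def upperOf (D : Finset (Cols m (n + m))) : Set (Cols m (n + m)) := {x | ∃ δ ∈ D, δ ≤ x}

theorem isUpperSet_upperOf (D : Finset (Cols m (n + m))) : IsUpperSet (upperOf D) :=
  fun _ _ hab ⟨δ, hδ, h⟩ => ⟨δ, hδ, h.trans hab⟩

theorem gradeGE_layer_aux (hm : 0 < m) (hrs : RingTheory.Sequence.IsWeaklyRegular R rs)
    (hb : ∀ r ∈ rs, C r ∈ 𝔟) (hX : ∀ p, X p ∈ 𝔟) (L : ℕ) :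
    (∀ ε : Cols m (n + m), colWt ε.1 + L = colWt (topCols m n).1 →
      GradeGE 𝔟 (MvPolynomial (Fin m × Fin n) R ⧸ layer R (Set.Ici ε)) (rs.length + L)) ∧
    (∀ ε : Cols m (n + m), colWt ε.1 + L = colWt (topCols m n).1 →
      ∀ D : Finset (Cols m (n + m)), (∀ δ ∈ D, ε ≤ δ ∧ colWt δ.1 = colWt ε.1 + 1) →
      GradeGE 𝔟 (MvPolynomial (Fin m × Fin n) R ⧸ layer R (upperOf D)) (rs.length + L - 1)) := by
  classical
  induction L with
  | zero =>
    have htop : ∀ ε : Cols m (n + m), colWt ε.1 + 0 = colWt (topCols m n).1 →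
        ε = topCols m n := fun ε h => eq_of_le_of_colWt_le (le_topCols ε) h.ge
    constructor
    · intro ε hε
      rw [htop ε hε]
      exact gradeGE_layer_topCols R hm hrs hb
    · intro ε hε D hD
      have : D = ∅ := Finset.eq_empty_of_forall_notMem fun δ hδ => by
        have h1 := colWt_mono (le_topCols δ)
        have h2 := (hD δ hδ).2
        omega
      have h2 : upperOf D = ∅ := by subst this; simp [upperOf]
      rw [h2, layer_empty]
      have := Ideal.Quotient.subsingleton_iff.2
        (rfl : (⊤ : Ideal (MvPolynomial (Fin m × Fin n) R)) = ⊤)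
      exact GradeGE.of_subsingleton
  | succ L ih =>
    have hQ : ∀ ε : Cols m (n + m), colWt ε.1 + (L + 1) = colWt (topCols m n).1 →
      ∀ D : Finset (Cols m (n + m)), (∀ δ ∈ D, ε ≤ δ ∧ colWt δ.1 = colWt ε.1 + 1) →
      GradeGE 𝔟 (MvPolynomial (Fin m × Fin n) R ⧸ layer R (upperOf D))
        (rs.length + (L + 1) - 1) := by
      intro ε hε D
      induction D using Finset.induction_on with
      | empty =>
        intro _
        have h2 : upperOf (∅ : Finset (Cols m (n + m))) = ∅ := by simp [upperOf]
        rw [h2, layer_empty]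
        have := Ideal.Quotient.subsingleton_iff.2
          (rfl : (⊤ : Ideal (MvPolynomial (Fin m × Fin n) R)) = ⊤)
        exact GradeGE.of_subsingleton
      | insert δ D hδ ihD =>
        intro hD
        have hδ1 := hD δ (Finset.mem_insert_self _ _)
        have hD1 : ∀ δ' ∈ D, ε ≤ δ' ∧ colWt δ'.1 = colWt ε.1 + 1 := fun δ' h =>
          hD δ' (Finset.mem_insert_of_mem h)
        have hun : upperOf (insert δ D) = upperOf D ∪ Set.Ici δ := by
          ext x
          simp only [upperOf, Set.mem_ofPred_eq, Finset.mem_insert, exists_eq_or_imp,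
            Set.mem_union, Set.mem_Ici]
          exact or_comm
        have hin : upperOf D ∩ Set.Ici δ = upperOf (D.image (colsSup δ)) := by
          ext x
          simp only [upperOf, Set.mem_ofPred_eq, Finset.mem_image, Set.mem_inter_iff,
            Set.mem_Ici, exists_exists_and_eq_and, colsSup_le_iff]
          constructor
          · rintro ⟨⟨δ', h1, h2⟩, h3⟩; exact ⟨δ', h1, h3, h2⟩
          · rintro ⟨δ', h1, h3, h2⟩; exact ⟨⟨δ', h1, h2⟩, h3⟩
        rw [hun, layer_union]
        refine GradeGE.quotient_inf (ihD hD1) ?_ ?_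
        · exact (ih.1 δ (by omega)).mono (by omega)
        · rw [← layer_inter R hm (isUpperSet_upperOf D) (isUpperSet_Ici δ), hin]
          refine (ih.2 δ (by omega) _ ?_).mono (by omega)
          intro η hη
          obtain ⟨δ', hδ', rfl⟩ := Finset.mem_image.1 hη
          refine ⟨le_colsSup_left _ _, colWt_colsSup hδ1.1 (hD1 δ' hδ').1 hδ1.2
            (hD1 δ' hδ').2 ?_⟩
          rintro rfl
          exact hδ hδ'
    refine ⟨fun ε hε => ?_, hQ⟩
    have htop : ε ≠ topCols m n := by rintro rfl; omega
    have hIoi : Set.Ioi ε = upperOf (Finset.univ.filter fun δ : Cols m (n + m) =>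
        ε ≤ δ ∧ colWt δ.1 = colWt ε.1 + 1) := by
      ext x
      simp only [upperOf, Set.mem_ofPred_eq, Finset.mem_filter, Finset.mem_univ, true_and,
        Set.mem_Ioi]
      constructor
      · intro h
        obtain ⟨δ, h1, h2, h3⟩ := exists_le_colWt_succ h
        exact ⟨δ, ⟨h1, h3⟩, h2⟩
      · rintro ⟨δ, ⟨h1, h3⟩, h2⟩
        refine lt_of_lt_of_le (lt_of_le_of_ne h1 ?_) h2
        rintro rfl
        omega
    have h := hQ ε hε (Finset.univ.filter fun δ : Cols m (n + m) =>
        ε ≤ δ ∧ colWt δ.1 = colWt ε.1 + 1) fun δ hδ => (Finset.mem_filter.1 hδ).2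
    rw [← hIoi] at h
    exact GradeGE.quotient_of_regular (genMinor_mem_of_X_mem R hX htop)
      (fun b => (genMinor_mul_mem_layer_Ici_iff R).1) (layer_Ioi R hm htop) h

theorem gradeGE_layer_Ici (hm : 0 < m) (hrs : RingTheory.Sequence.IsWeaklyRegular R rs)
    (hb : ∀ r ∈ rs, C r ∈ 𝔟) (hX : ∀ p, X p ∈ 𝔟) {x : Cols m (n + m)} (hx : ColsLT n x) :
    GradeGE 𝔟 (MvPolynomial (Fin m × Fin n) R ⧸ layer R (Set.Ici x)) (rs.length + m * m) := by
  have h1 := colWt_add_sq_le hx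
  exact ((gradeGE_layer_aux R hm hrs hb hX (colWt (topCols m n).1 - colWt x.1)).1 x
    (by omega)).mono (by omega)

theorem exists_sub_mul_mem_layer (hm : 0 < m) {k : ℕ} {U : Set (Cols m (n + m))}
    (hU : IsUpperSet U) {x : Cols m (n + m)} (hx : x ≠ topCols m n)
    {a : MvPolynomial (Fin m × Fin n) R} (ha : a ∈ genIdeal m n R ^ (k + 1))
    (haU : a ∈ layer R (U \ {x})) :
    ∃ b ∈ genIdeal m n R ^ k, a - genMinor R x * b ∈ layer R U := by
  obtain ⟨c, hc, rfl⟩ := exists_linearCombination_of_mem_pow R hm ha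
  have h1 := headD_notMem_of_mem_layer R (fun l hl => (hc l hl).1) haU
  rw [Finsupp.linearCombination_apply, Finsupp.sum]
  have h2 : ∀ l ∈ c.support, ∃ b ∈ genIdeal m n R ^ k,
      c l • genWord R l - genMinor R x * b ∈ layer R U := by
    intro l hl
    by_cases hlx : l.headD (topCols m n) = x
    · obtain ⟨l', rfl⟩ := eq_cons_of_headD_eq hx hlx
      have hg := (hc _ hl).2
      refine ⟨c (x :: l') • genWord R l', Submodule.smul_of_tower_mem _ _
        (genWord_mem_pow R (by simpa using hg.1) hg.2.2), ?_⟩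
      rw [mul_smul_comm, ← smul_sub]
      have : genWord R (x :: l') = genMinor R x * genWord R l' := by simp [genWord]
      rw [this, sub_self, smul_zero]
      exact zero_mem _
    · refine ⟨0, zero_mem _, ?_⟩
      rw [mul_zero, sub_zero]
      exact Submodule.smul_of_tower_mem _ _
        (genWord_mem_layer R hU fun h => h1 l hl ⟨h, hlx⟩)
  choose! b hb hbU using h2
  refine ⟨∑ l ∈ c.support, b l, sum_mem hb, ?_⟩
  rw [Finset.mul_sum, ← Finset.sum_sub_distrib]
  exact sum_mem hbU

theorem genIdeal_pow_le_layer (hm : 0 < m) (k : ℕ) {U : Set (Cols m (n + m))}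
    (hU : IsUpperSet U) (h : U ∩ {x | ColsLT n x} = ∅) :
    genIdeal m n R ^ (k + 1) ≤ layer R U := by
  intro a ha
  obtain ⟨c, hc, rfl⟩ := exists_linearCombination_of_mem_pow R hm ha
  refine linearCombination_genWord_mem R fun l hl => genWord_mem_layer R hU fun hlU => ?_
  obtain ⟨-, h1, h2⟩ := hc l hl
  cases l with
  | nil => simp at h1
  | cons y l => exact Set.eq_empty_iff_forall_notMem.1 h y ⟨hlU, h2.1⟩

theorem ne_topCols_of_colsLT (hm : 0 < m) {x : Cols m (n + m)} (hx : ColsLT n x) :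
    x ≠ topCols m n := by
  rintro rfl
  have := hx ⟨0, hm⟩
  simp [topCols] at this

theorem gradeGE_pow_succ_quotient_layer (hm : 0 < m) {k s : ℕ}
    (hB : ∀ x : Cols m (n + m), ColsLT n x → GradeGE 𝔟 (↥(genIdeal m n R ^ k) ⧸
      Submodule.comap (genIdeal m n R ^ k).subtype (layer R (Set.Ici x))) s) (j : ℕ)
    (U : Set (Cols m (n + m))) (hU : IsUpperSet U) (hj : (U ∩ {x | ColsLT n x}).ncard = j) :
    GradeGE 𝔟 (↥(genIdeal m n R ^ (k + 1)) ⧸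
      Submodule.comap (genIdeal m n R ^ (k + 1)).subtype (layer R U)) s := by
  induction j generalizing U with
  | zero =>
    rw [Set.ncard_eq_zero] at hj
    have h1 := genIdeal_pow_le_layer R hm k hU hj
    rw [Submodule.comap_subtype_eq_top.2 h1]
    have := Submodule.Quotient.subsingleton_iff.2
      (rfl : (⊤ : Submodule (MvPolynomial (Fin m × Fin n) R) ↥(genIdeal m n R ^ (k + 1))) = ⊤)
    exact GradeGE.of_subsingleton
  | succ j ih =>
    have hne : (U ∩ {x | ColsLT n x}).Nonempty := by
      rw [← Set.ncard_pos]; omega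
    obtain ⟨x, hx⟩ := (Set.toFinite (U ∩ {x | ColsLT n x})).exists_minimal hne
    have hxU : x ∈ U := hx.prop.1
    have hxT : ColsLT n x := hx.prop.2
    have hmin : ∀ z ∈ U, z ≤ x → z = x := fun z hz hzx => le_antisymm hzx <|
      hx.le_of_le ⟨hz, fun i => lt_of_le_of_lt (Fin.le_def.1 (hzx i)) (hxT i)⟩ hzx
    have hU' : IsUpperSet (U \ {x}) := fun a b hab ha =>
      ⟨hU hab ha.1, fun hb => ha.2 (hmin a ha.1 (hab.trans (le_of_eq hb)))⟩
    have hv : ∀ z ∈ U \ {x}, degen R z (genMinor R x) = 0 := fun z hz =>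
      degen_genMinor_eq_zero R fun hle => hz.2 (hmin z hz.1 hle)
    have hcard : ((U \ {x}) ∩ {x | ColsLT n x}).ncard = j := by
      have : (U \ {x}) ∩ {x | ColsLT n x} = (U ∩ {x | ColsLT n x}) \ {x} := by
        ext z; simp only [Set.mem_inter_iff, Set.mem_sdiff]; tauto
      rw [this, Set.ncard_sdiff_singleton_of_mem hx.prop, hj]
      rfl
    have hmul : ∀ b, genMinor R x * b ∈ layer R (U \ {x}) := fun b =>
      mem_layer.2 fun z hz => by rw [map_mul, hv z hz, zero_mul]
    refine GradeGE.quotient_of_mul (B := genIdeal m n R ^ k) (Q := layer R (Set.Ici x))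
      (P' := layer R (U \ {x})) (v := genMinor R x) (layer_anti R Set.sdiff_subset) ?_
      (fun b _ => hmul b) ?_ (fun a ha haU => exists_sub_mul_mem_layer R hm hU
        (ne_topCols_of_colsLT hm hxT) ha haU) (hB x hxT) (ih _ hU' hcard)
    · intro b hb
      rw [pow_succ', genIdeal]
      exact Ideal.mul_mem_mul (Ideal.subset_span ⟨x, hxT, rfl⟩) hb
    · intro b _
      rw [← genMinor_mul_mem_layer_Ici_iff R]
      constructor
      · exact fun h => layer_anti R (fun z hz => hU hz hxU) h
      · intro h
        refine mem_layer.2 fun z hz => ?_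
        by_cases hzx : z = x
        · subst hzx; exact mem_layer.1 h z (Set.mem_Ici.2 le_rfl)
        · exact mem_layer.1 (hmul b) z ⟨hz, hzx⟩

theorem gradeGE_pow_quotient_layer (hm : 0 < m)
    (hrs : RingTheory.Sequence.IsWeaklyRegular R rs)
    (hb : ∀ r ∈ rs, C r ∈ 𝔟) (hX : ∀ p, X p ∈ 𝔟) (k : ℕ)
    (U : Set (Cols m (n + m))) (hU : IsUpperSet U) :
    GradeGE 𝔟 (↥(genIdeal m n R ^ (k + 1)) ⧸
      Submodule.comap (genIdeal m n R ^ (k + 1)).subtype (layer R U)) (rs.length + m * m) := by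
  induction k generalizing U with
  | zero =>
    refine gradeGE_pow_succ_quotient_layer R hm (fun x hx => ?_) _ U hU rfl
    rw [pow_zero, Ideal.one_eq_top]
    refine (gradeGE_layer_Ici R hm hrs hb hX hx).of_linearEquiv ?_
    refine Submodule.Quotient.equiv _ _ Submodule.topEquiv.symm ?_
    ext y
    simp
  | succ k ih =>
    exact gradeGE_pow_succ_quotient_layer R hm (fun x _ => ih _ (isUpperSet_Ici x)) _ U hU rfl

/-- Powers of the ideal of maximal minors of the generic matrix have large grade. -/
theorem gradeGE_genIdeal_pow (hm : 0 < m) (hmn : m ≤ n)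
    (hrs : RingTheory.Sequence.IsWeaklyRegular R rs)
    (hb : ∀ r ∈ rs, C r ∈ 𝔟) (hX : ∀ p, X p ∈ 𝔟) (k : ℕ) :
    GradeGE 𝔟 ↥(genIdeal m n R ^ k) (rs.length + m * m) := by
  cases k with
  | zero =>
    rw [pow_zero, Ideal.one_eq_top]
    let x : Cols m (n + m) := ⟨fun i => ⟨i, by omega⟩, fun _ _ h => h⟩
    have h0 : ∀ z, x ≤ z := by
      intro z i
      rw [Fin.le_def]
      change (i : ℕ) ≤ z.1 i
      have key : ∀ k : ℕ, ∀ j : Fin m, (j : ℕ) = k → k ≤ z.1 j := by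
        intro k
        induction k with
        | zero => exact fun j _ => Nat.zero_le _
        | succ k ih =>
          intro j hj
          have h1 := ih ⟨k, by omega⟩ rfl
          have h2 : z.1 ⟨k, by omega⟩ < z.1 j := z.2 (by rw [Fin.lt_def]; simp; omega)
          rw [Fin.lt_def] at h2
          omega
      exact key i i rfl
    have h := gradeGE_layer_Ici R hm hrs hb hX (x := x) fun i => lt_of_lt_of_le i.2 hmn
    rw [Set.eq_univ_of_forall (s := Set.Ici x) h0, layer_univ R hm] at h
    exact h.of_linearEquiv ((Submodule.quotEquivOfEqBot _ rfl).trans Submodule.topEquiv.symm)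
  | succ k =>
    have h := gradeGE_pow_quotient_layer R hm hrs hb hX k Set.univ isUpperSet_univ
    rw [layer_univ R hm] at h
    exact h.of_linearEquiv (Submodule.quotEquivOfEqBot _ (by simp))

end GradeOfPowers

section GradeTransfer

open RingTheory.Sequence

theorem GradeGE.top {S M : Type u} [CommRing S] [AddCommGroup M] [Module S M] (k : ℕ) :
    GradeGE (⊤ : Ideal S) M k := by
  cases k with
  | zero => exact GradeGE.zero
  | succ k =>
    refine GradeGE.of_regular (x := 1) Submodule.mem_top (IsSMulRegular.one M) ?_
    have : Subsingleton (QuotSMulTop (1 : S) M) := by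
      refine Submodule.Quotient.subsingleton_iff.2 ?_
      rw [one_smul]
    exact GradeGE.of_subsingleton

theorem GradeGE.exists_isWeaklyRegular_map {S S' : Type u} [CommRing S] [CommRing S']
    [Algebra S S'] (T : Submonoid S) [IsLocalization T S'] [IsNoetherianRing S'] {M : Type u}
    [AddCommGroup M] [Module S' M] [Module.Finite S' M] {J : Ideal S} {k : ℕ}
    (h : GradeGE (J.map (algebraMap S S')) M k) :
    ∃ rs : List S, rs.length = k ∧ (∀ r ∈ rs, r ∈ J) ∧
      IsWeaklyRegular M (rs.map (algebraMap S S')) := by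
  induction k generalizing M with
  | zero => exact ⟨[], rfl, by simp, .nil _ _⟩
  | succ k ih =>
    obtain ⟨x, hx, hreg⟩ := h.exists_regular
    obtain ⟨⟨y, t⟩, hyt⟩ := (IsLocalization.mem_map_algebraMap_iff T S').1 hx
    have hy : IsSMulRegular M (algebraMap S S' y) := by
      change x * algebraMap S S' t = algebraMap S S' y at hyt
      rw [← hyt]
      exact hreg.mul ((IsLocalization.map_units S' t).isSMulRegular M)
    obtain ⟨rs, hlen, hmem, hrs⟩ := ih (h.quotSMulTop hy)
    refine ⟨y :: rs, by simp [hlen], by simpa using hmem, ?_⟩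
    rw [List.map_cons]
    exact hrs.cons hy

/-- Grade over a localization bounds the grade over the base ring. -/
theorem GradeGE.of_map_algebraMap {S S' : Type u} [CommRing S] [CommRing S']
    [Algebra S S'] (T : Submonoid S) [IsLocalization T S'] [IsNoetherianRing S'] {M : Type u}
    [AddCommGroup M] [Module S' M] [Module.Finite S' M] [Module S M] [IsScalarTower S S' M]
    {J : Ideal S} {k : ℕ} (h : GradeGE (J.map (algebraMap S S')) M k) : GradeGE J M k := by
  obtain ⟨rs, rfl, hmem, hrs⟩ := h.exists_isWeaklyRegular_map T
  exact GradeGE.of_isWeaklyRegular hmem ((isWeaklyRegular_map_algebraMap_iff S' M rs).1 hrs)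

end GradeTransfer

section PolynomialGrade

open MvPolynomial

variable {R : Type u} [CommRing R] {σ : Type} (a : σ → R)

theorem eq_zero_of_X_sub_C_mul (s : σ) {b : MvPolynomial σ R}
    (h : (X s - C (a s)) * b = 0) : b = 0 := by
  let τ : MvPolynomial σ R →ₐ[R] MvPolynomial σ R := aeval fun t => X t + C (a t)
  let τ' : MvPolynomial σ R →ₐ[R] MvPolynomial σ R := aeval fun t => X t - C (a t)
  have hτ : τ'.comp τ = AlgHom.id R _ := by
    refine MvPolynomial.algHom_ext fun t => ?_
    simp [τ, τ', ← algebraMap_eq]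
  have h1 : X s * τ b = X s * 0 := by
    have := congrArg τ h
    simpa [τ, ← algebraMap_eq] using this
  have h2 : τ b = 0 := isRegular_X.left h1
  have h3 : τ' (τ b) = b := congrArg (fun f : MvPolynomial σ R →ₐ[R] _ => f b) hτ
  rw [← h3, h2, map_zero]

variable [DecidableEq σ]

/-- Substitution of the values `a` for the variables in `T`. -/
noncomputable def partialEval (T : Finset σ) : MvPolynomial σ R →ₐ[R] MvPolynomial σ R :=
  aeval fun s => if s ∈ T then C (a s) else X s

theorem sub_partialEval_mem (T : Finset σ) (p : MvPolynomial σ R) :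
    p - partialEval a T p ∈ Ideal.span ((fun s => (X s - C (a s) : MvPolynomial σ R)) '' T) := by
  rw [← Ideal.Quotient.eq]
  change (Ideal.Quotient.mkₐ R _) p = ((Ideal.Quotient.mkₐ R _).comp (partialEval a T)) p
  congr 1
  refine MvPolynomial.algHom_ext fun s => ?_
  change Ideal.Quotient.mk _ _ = Ideal.Quotient.mk _ (partialEval a T (X s))
  rw [partialEval, aeval_X, Ideal.Quotient.eq]
  split_ifs with hs
  · exact Ideal.subset_span ⟨s, hs, rfl⟩
  · rw [sub_self]; exact zero_mem _

theorem ker_partialEval (T : Finset σ) :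
    RingHom.ker (partialEval a T) =
      Ideal.span ((fun s => (X s - C (a s) : MvPolynomial σ R)) '' T) := by
  apply le_antisymm
  · intro p hp
    have h := sub_partialEval_mem a T p
    rwa [(RingHom.mem_ker).1 hp, sub_zero] at h
  · rw [Ideal.span_le]
    rintro _ ⟨s, hs, rfl⟩
    rw [SetLike.mem_coe, RingHom.mem_ker, partialEval, map_sub, aeval_X, if_pos (Finset.mem_coe.1 hs), aeval_C,
      algebraMap_eq, sub_self]

variable [Fintype σ]

theorem gradeGE_quotient_ker_partialEval_univ {rs : List R}
    (hrs : RingTheory.Sequence.IsWeaklyRegular R rs) {𝔟 : Ideal (MvPolynomial σ R)}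
    (hb : ∀ r ∈ rs, C r ∈ 𝔟) :
    GradeGE 𝔟 (MvPolynomial σ R ⧸ RingHom.ker (partialEval a Finset.univ)) rs.length := by
  let P := RingHom.ker (partialEval a Finset.univ)
  let g : R →ₗ[R] MvPolynomial σ R ⧸ P := Algebra.linearMap R (MvPolynomial σ R ⧸ P)
  have hC : ∀ p, partialEval a Finset.univ p = C (aeval a p) := by
    intro p
    change _ = ((Algebra.ofId R (MvPolynomial σ R)).comp (aeval a)) p
    congr 1
    refine MvPolynomial.algHom_ext fun s => ?_
    simp [partialEval, Algebra.ofId_apply, algebraMap_eq]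
  have hg : Function.Bijective g := by
    constructor
    · rw [← LinearMap.ker_eq_bot, eq_bot_iff]
      intro r hr
      have h1 : (C r : MvPolynomial σ R) ∈ P :=
        Ideal.Quotient.eq_zero_iff_mem.1 (LinearMap.mem_ker.1 hr)
      have h2 := RingHom.mem_ker.1 h1
      rw [← algebraMap_eq, AlgHom.commutes, algebraMap_eq] at h2
      exact C_injective _ _ (h2.trans C_0.symm)
    · intro y
      obtain ⟨p, rfl⟩ := Ideal.Quotient.mk_surjective y
      refine ⟨aeval a p, ?_⟩
      change Ideal.Quotient.mk P (C (aeval a p)) = _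
      rw [Ideal.Quotient.eq, RingHom.mem_ker, map_sub, hC p, ← algebraMap_eq, AlgHom.commutes,
        sub_self]
  have h1 := ((LinearEquiv.ofBijective g hg).isWeaklyRegular_congr rs).1 hrs
  have h2 := (RingTheory.Sequence.isWeaklyRegular_map_algebraMap_iff
    (MvPolynomial σ R) (MvPolynomial σ R ⧸ P) rs).2 h1
  have h3 := GradeGE.of_isWeaklyRegular (J := 𝔟) (by simpa using hb) h2
  rwa [List.length_map] at h3

/-- Adjoining elements `X s - a s` to a regular sequence of constants. -/
theorem gradeGE_mvPolynomial {rs : List R} (hrs : RingTheory.Sequence.IsWeaklyRegular R rs)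
    {𝔟 : Ideal (MvPolynomial σ R)} (hb : ∀ r ∈ rs, C r ∈ 𝔟) (hX : ∀ s, X s - C (a s) ∈ 𝔟) :
    GradeGE 𝔟 (MvPolynomial σ R) (rs.length + Fintype.card σ) := by
  have key : ∀ U : Finset σ,
      GradeGE 𝔟 (MvPolynomial σ R ⧸ RingHom.ker (partialEval a Uᶜ)) (rs.length + U.card) := by
    intro U
    induction U using Finset.induction_on with
    | empty =>
      rw [Finset.compl_empty]
      exact gradeGE_quotient_ker_partialEval_univ a hrs hb
    | insert s U hs ih =>
      rw [Finset.card_insert_of_notMem hs, ← add_assoc]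
      have hU : Uᶜ = insert s (insert s U)ᶜ := by
        ext t
        by_cases h : t = s <;> simp [h, hs]
      refine GradeGE.quotient_of_regular (hX s) ?_ ?_ ih
      · intro b hb
        rw [RingHom.mem_ker] at hb ⊢
        have h1 : partialEval a (insert s U)ᶜ (X s - C (a s)) = X s - C (a s) := by
          rw [partialEval, map_sub, aeval_X, if_neg (by simp), aeval_C, algebraMap_eq]
        rw [map_mul, h1] at hb
        exact eq_zero_of_X_sub_C_mul a s hb
      · rw [ker_partialEval, ker_partialEval, hU, Finset.coe_insert, Set.image_insert_eq,
          Ideal.span_insert, sup_comm]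
  have h := key Finset.univ
  rw [Finset.compl_univ, ker_partialEval, Finset.coe_empty, Set.image_empty, Ideal.span_empty] at h
  exact h.of_linearEquiv (Submodule.quotEquivOfEqBot _ rfl)

end PolynomialGrade

section SchurComplement

variable {Q : Type*} [CommRing Q]

theorem det_mem_minorsIdeal {α β : Type*} {t : ℕ} (A : Matrix α β Q) (f : Fin t → α)
    (g : Fin t → β) : (A.submatrix f g).det ∈ minorsIdeal t A := by
  by_cases hf : Function.Injective f
  · by_cases hg : Function.Injective g
    · exact Ideal.subset_span ⟨f, g, hf, hg, rfl⟩
    · rw [Function.not_injective_iff] at hg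
      obtain ⟨i, j, hij, hne⟩ := hg
      rw [Matrix.det_zero_of_column_eq hne fun k => by simp [hij]]
      exact zero_mem _
  · rw [Function.not_injective_iff] at hf
    obtain ⟨i, j, hij, hne⟩ := hf
    rw [Matrix.det_zero_of_row_eq hne (by funext k; simp [hij])]
    exact zero_mem _

theorem minorsIdeal_map {Q' : Type*} [CommRing Q'] (φ : Q →+* Q') {α β : Type*} (t : ℕ)
    (A : Matrix α β Q) : (minorsIdeal t A).map φ = minorsIdeal t (A.map φ) := by
  rw [minorsIdeal, Ideal.map_span]
  refine congrArg Ideal.span (Set.ext fun d => ?_)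
  constructor
  · rintro ⟨_, ⟨f, g, hf, hg, rfl⟩, rfl⟩
    exact ⟨f, g, hf, hg, φ.map_det _⟩
  · rintro ⟨f, g, hf, hg, rfl⟩
    exact ⟨_, ⟨f, g, hf, hg, rfl⟩, φ.map_det _⟩

theorem det_eq_mul_det_schur {t : ℕ} (M : Matrix (Fin (t + 1)) (Fin (t + 1)) Q) {v : Q}
    (hv : M 0 0 * v = 1) :
    M.det = M 0 0 * (Matrix.of fun i j : Fin t =>
      M i.succ j.succ - M i.succ 0 * v * M 0 j.succ).det := by
  let c : Fin (t + 1) → Q := Fin.cons 0 fun i => M i.succ 0 * v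
  let N : Matrix (Fin (t + 1)) (Fin (t + 1)) Q := Matrix.of fun i j => M i j - c i * M 0 j
  have hN0 : ∀ j, N 0 j = M 0 j := fun j => by simp [N, c]
  have h1 : M.det = N.det := Matrix.det_eq_of_forall_row_eq_smul_add_const c 0 (by simp [c])
    fun i j => by rw [hN0]; simp [N]
  rw [h1, Matrix.det_succ_column_zero, Fin.sum_univ_succ]
  have h2 : ∀ i : Fin t, N i.succ 0 = 0 := by
    intro i
    simp only [N, c, Matrix.of_apply, Fin.cons_succ]
    linear_combination (-(M i.succ 0)) * hv
  simp only [h2, mul_zero, zero_mul, Finset.sum_const_zero, add_zero, Fin.val_zero, pow_zero,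
    one_mul, hN0]
  congr 2

theorem det_mem_minorsIdeal_pred {t : ℕ} (M : Matrix (Fin (t + 1)) (Fin (t + 1)) Q) :
    M.det ∈ minorsIdeal t M := by
  rw [Matrix.det_succ_row_zero]
  exact sum_mem fun j _ => Ideal.mul_mem_left _ _ (det_mem_minorsIdeal M _ _)

theorem det_add_rankOne_mem {t : ℕ} (M : Matrix (Fin (t + 1)) (Fin (t + 1)) Q)
    (w z : Fin (t + 1) → Q) :
    (Matrix.of fun i j => M i j + w i * z j).det ∈ minorsIdeal t M := by
  let B : Matrix (Fin (t + 2)) (Fin (t + 2)) Q :=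
    Matrix.of (Fin.cons (Fin.cons 1 (-z)) fun i => Fin.cons (w i) (M i))
  have h1 : (Matrix.of fun i j => M i j + w i * z j).det = B.det := by
    rw [det_eq_mul_det_schur B (v := 1) (by simp [B])]
    simp [B]
  rw [h1, Matrix.det_succ_row_zero]
  refine sum_mem fun j _ => Ideal.mul_mem_left _ _ ?_
  refine Fin.cases ?_ (fun j => ?_) j
  · have : B.submatrix Fin.succ (Fin.succAbove 0) = M := by
      refine Matrix.ext fun i k => ?_
      simp [B]
    rw [this]
    exact det_mem_minorsIdeal_pred M
  · rw [Matrix.det_succ_column_zero]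
    refine sum_mem fun i _ => Ideal.mul_mem_left _ _ ?_
    have : (B.submatrix Fin.succ j.succ.succAbove).submatrix i.succAbove Fin.succ =
        M.submatrix i.succAbove j.succAbove := by
      refine Matrix.ext fun k l => ?_
      simp [B, Fin.succ_succAbove_succ]
    rw [this]
    exact det_mem_minorsIdeal _ _ _

/-- The Schur complement of the entry at `(p, q)`, whose inverse is `v`. -/
def schurAt {m n : ℕ} (B : Matrix (Fin (m + 1)) (Fin (n + 1)) Q) (p : Fin (m + 1))
    (q : Fin (n + 1)) (v : Q) : Matrix (Fin m) (Fin n) Q :=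
  Matrix.of fun i j => B (p.succAbove i) (q.succAbove j) -
    B (p.succAbove i) q * v * B p (q.succAbove j)

theorem minorsIdeal_schurAt {m n : ℕ} (B : Matrix (Fin (m + 1)) (Fin (n + 1)) Q)
    (p : Fin (m + 1)) (q : Fin (n + 1)) {v : Q} (hv : B p q * v = 1) (t : ℕ) :
    minorsIdeal (t + 1) B = minorsIdeal t (schurAt B p q v) := by
  apply le_antisymm
  · rw [minorsIdeal, Ideal.span_le]
    rintro _ ⟨f, g, -, -, rfl⟩
    let D : Matrix (Fin (m + 1)) (Fin (n + 1)) Q :=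
      Matrix.of fun i j => B i j - B i q * v * B p j
    have hDp : ∀ j, D p j = 0 := fun j => by
      simp only [D, Matrix.of_apply]; linear_combination (-(B p j)) * hv
    have hDq : ∀ i, D i q = 0 := fun i => by
      simp only [D, Matrix.of_apply]; linear_combination (-(B i q)) * hv
    have h1 : B.submatrix f g = Matrix.of fun i j =>
        (D.submatrix f g) i j + (B (f i) q * v) * B p (g j) := by
      refine Matrix.ext fun i j => ?_
      simp [D]
    have h2 := det_add_rankOne_mem (D.submatrix f g) (fun i => B (f i) q * v)
      fun j => B p (g j)
    rw [← h1] at h2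
    refine (Ideal.span_le.2 ?_) h2
    rintro _ ⟨f', g', -, -, rfl⟩
    by_cases hf : ∃ i, f (f' i) = p
    · obtain ⟨i, hi⟩ := hf
      rw [Matrix.det_eq_zero_of_row_eq_zero i fun j => by simp [hi, hDp]]
      exact zero_mem _
    by_cases hg : ∃ i, g (g' i) = q
    · obtain ⟨i, hi⟩ := hg
      rw [Matrix.det_eq_zero_of_column_eq_zero i fun j => by simp [hi, hDq]]
      exact zero_mem _
    push Not at hf hg
    choose f'' hf'' using fun i => Fin.exists_succAbove_eq (hf i)
    choose g'' hg'' using fun i => Fin.exists_succAbove_eq (hg i)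
    have h3 : (D.submatrix f g).submatrix f' g' = (schurAt B p q v).submatrix f'' g'' := by
      refine Matrix.ext fun i j => ?_
      simp [D, schurAt, hf'', hg'']
    rw [h3]
    exact det_mem_minorsIdeal _ _ _
  · conv_lhs => rw [minorsIdeal]
    rw [Ideal.span_le]
    rintro _ ⟨f, g, -, -, rfl⟩
    let M : Matrix (Fin (t + 1)) (Fin (t + 1)) Q :=
      B.submatrix (Fin.cons p (p.succAbove ∘ f)) (Fin.cons q (q.succAbove ∘ g))
    have h1 := det_eq_mul_det_schur M (v := v) (by simpa [M] using hv)
    have h2 : (Matrix.of fun i j : Fin t => M i.succ j.succ - M i.succ 0 * v * M 0 j.succ) =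
        (schurAt B p q v).submatrix f g := by
      refine Matrix.ext fun i j => ?_
      simp [M, schurAt]
    have h3 : ((schurAt B p q v).submatrix f g).det = v * M.det := by
      rw [h1, h2]
      have : M 0 0 = B p q := by simp [M]
      rw [this]
      linear_combination (-((schurAt B p q v).submatrix f g).det) * hv
    rw [SetLike.mem_coe, h3]
    exact Ideal.mul_mem_left _ _ (det_mem_minorsIdeal _ _ _)

end SchurComplement

section Pivot

open MvPolynomial

/-- The matrix with prescribed entry, row, column and complementary block at `(p, q)`. -/
def pivotMatrix {T : Type*} {m n : ℕ} (p : Fin (m + 1)) (q : Fin (n + 1)) (u : T)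
    (r : Fin n → T) (c : Fin m → T) (D : Fin m → Fin n → T) :
    Matrix (Fin (m + 1)) (Fin (n + 1)) T :=
  Matrix.of (p.insertNth (α := fun _ => Fin (n + 1) → T) (q.insertNth (α := fun _ => T) u r)
    fun i => q.insertNth (α := fun _ => T) (c i) (D i))

section
variable {T : Type*} {m n : ℕ} (p : Fin (m + 1)) (q : Fin (n + 1)) (u : T)
    (r : Fin n → T) (c : Fin m → T) (D : Fin m → Fin n → T)

theorem pivotMatrix_same : pivotMatrix p q u r c D p q = u := by
  simp [pivotMatrix]

theorem pivotMatrix_row (j : Fin n) : pivotMatrix p q u r c D p (q.succAbove j) = r j := by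
  simp [pivotMatrix]

theorem pivotMatrix_col (i : Fin m) : pivotMatrix p q u r c D (p.succAbove i) q = c i := by
  simp [pivotMatrix]

theorem pivotMatrix_succAbove (i : Fin m) (j : Fin n) :
    pivotMatrix p q u r c D (p.succAbove i) (q.succAbove j) = D i j := by
  simp [pivotMatrix]

end

variable {m n : ℕ} {R : Type*} [CommRing R] (R' : Type*) [CommRing R']
  [Algebra (MvPolynomial (Option (Fin m ⊕ Fin n)) R) R']
  [IsLocalization.Away (X none : MvPolynomial (Option (Fin m ⊕ Fin n)) R) R']

/-- The image in `R'` of a variable of the pivot cross. -/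
noncomputable def crossVar (m n : ℕ) (R : Type*) [CommRing R] (R' : Type*) [CommRing R']
    [Algebra (MvPolynomial (Option (Fin m ⊕ Fin n)) R) R'] (s : Option (Fin m ⊕ Fin n)) : R' :=
  algebraMap (MvPolynomial (Option (Fin m ⊕ Fin n)) R) R' (X s)

/-- The inverse of the pivot. -/
noncomputable def pivotInv (m n : ℕ) (R : Type*) [CommRing R] (R' : Type*) [CommRing R']
    [Algebra (MvPolynomial (Option (Fin m ⊕ Fin n)) R) R']
    [IsLocalization.Away (X none : MvPolynomial (Option (Fin m ⊕ Fin n)) R) R'] : R' :=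
  IsLocalization.Away.invSelf (X none : MvPolynomial (Option (Fin m ⊕ Fin n)) R)

theorem crossVar_mul_pivotInv :
    crossVar m n R R' none * pivotInv m n R R' = 1 :=
  IsLocalization.Away.mul_invSelf _

variable (m n R) in
/-- The inclusion of constants. -/
noncomputable def constHom : R →+* R' :=
  (algebraMap (MvPolynomial (Option (Fin m ⊕ Fin n)) R) R').comp C

/-- The image of the generic matrix after inverting the pivot. -/
noncomputable def pivotGeneric (R : Type*) [CommRing R] (R' : Type*) [CommRing R']
    [Algebra (MvPolynomial (Option (Fin m ⊕ Fin n)) R) R']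
    [IsLocalization.Away (X none : MvPolynomial (Option (Fin m ⊕ Fin n)) R) R']
    (p : Fin (m + 1)) (q : Fin (n + 1)) :
    Matrix (Fin (m + 1)) (Fin (n + 1)) (MvPolynomial (Fin m × Fin n) R') :=
  pivotMatrix p q (C (crossVar m n R R' none)) (fun j => C (crossVar m n R R' (some (.inr j))))
    (fun i => C (crossVar m n R R' (some (.inl i)))) fun i j => X (i, j) +
      C (crossVar m n R R' (some (.inl i))) * C (pivotInv m n R R') *
        C (crossVar m n R R' (some (.inr j)))

/-- The change of variables after inverting the pivot. -/
noncomputable def pivotHom (R : Type*) [CommRing R] (R' : Type*) [CommRing R']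
    [Algebra (MvPolynomial (Option (Fin m ⊕ Fin n)) R) R']
    [IsLocalization.Away (X none : MvPolynomial (Option (Fin m ⊕ Fin n)) R) R']
    (p : Fin (m + 1)) (q : Fin (n + 1)) :
    MvPolynomial (Fin (m + 1) × Fin (n + 1)) R →+* MvPolynomial (Fin m × Fin n) R' :=
  eval₂Hom (C.comp (constHom m n R R')) fun s => pivotGeneric R R' p q s.1 s.2

theorem pivotHom_C (p : Fin (m + 1)) (q : Fin (n + 1)) (r : R) :
    pivotHom R R' p q (C r) = C (constHom m n R R' r) := by
  simp [pivotHom]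

theorem pivotHom_X (p : Fin (m + 1)) (q : Fin (n + 1)) (i : Fin (m + 1)) (j : Fin (n + 1)) :
    pivotHom R R' p q (X (i, j)) = pivotGeneric R R' p q i j := by
  simp [pivotHom]

theorem schurAt_pivotGeneric (p : Fin (m + 1)) (q : Fin (n + 1)) :
    schurAt (pivotGeneric R R' p q) p q (C (pivotInv m n R R')) =
      Matrix.mvPolynomialX (Fin m) (Fin n) R' := by
  refine Matrix.ext fun i j => ?_
  simp only [schurAt, pivotGeneric, Matrix.of_apply, pivotMatrix_row,
    pivotMatrix_col, pivotMatrix_succAbove, Matrix.mvPolynomialX_apply]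
  ring

theorem map_pivotHom_minorsIdeal (p : Fin (m + 1)) (q : Fin (n + 1)) (t : ℕ) :
    (minorsIdeal (t + 1) (Matrix.mvPolynomialX (Fin (m + 1)) (Fin (n + 1)) R)).map
        (pivotHom R R' p q) =
      minorsIdeal t (Matrix.mvPolynomialX (Fin m) (Fin n) R') := by
  rw [minorsIdeal_map, ← schurAt_pivotGeneric (R := R) R' p q]
  have : (Matrix.mvPolynomialX (Fin (m + 1)) (Fin (n + 1)) R).map (pivotHom R R' p q) =
      pivotGeneric R R' p q := Matrix.ext fun i j => pivotHom_X R' p q i j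
  rw [this]
  refine minorsIdeal_schurAt _ p q ?_ t
  rw [pivotGeneric, pivotMatrix_same, ← C_mul, crossVar_mul_pivotInv, C_1]

section Inverse

variable (p : Fin (m + 1)) (q : Fin (n + 1)) (L : Type*) [CommRing L]
  [Algebra (MvPolynomial (Fin (m + 1) × Fin (n + 1)) R) L]
  [IsLocalization.Away (X (p, q) : MvPolynomial (Fin (m + 1) × Fin (n + 1)) R) L]

/-- The value in `L` of a variable of the pivot cross. -/
noncomputable def crossVal (R : Type*) [CommRing R] (p : Fin (m + 1)) (q : Fin (n + 1))
    (L : Type*) [CommRing L] [Algebra (MvPolynomial (Fin (m + 1) × Fin (n + 1)) R) L] :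
    Option (Fin m ⊕ Fin n) → L
  | none => algebraMap (MvPolynomial (Fin (m + 1) × Fin (n + 1)) R) L (X (p, q))
  | some (.inl i) =>
    algebraMap (MvPolynomial (Fin (m + 1) × Fin (n + 1)) R) L (X (p.succAbove i, q))
  | some (.inr j) =>
    algebraMap (MvPolynomial (Fin (m + 1) × Fin (n + 1)) R) L (X (p, q.succAbove j))

theorem exists_crossHom : ∃ f : R' →+* L,
    (∀ r, f (constHom m n R R' r) =
      algebraMap (MvPolynomial (Fin (m + 1) × Fin (n + 1)) R) L (C r)) ∧
    ∀ s, f (crossVar m n R R' s) = crossVal R p q L s := by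
  let f₁ : MvPolynomial (Option (Fin m ⊕ Fin n)) R →+* L :=
    eval₂Hom ((algebraMap (MvPolynomial (Fin (m + 1) × Fin (n + 1)) R) L).comp C)
      (crossVal R p q L)
  have hu : IsUnit (f₁ (X none)) := by
    have : f₁ (X none) =
        algebraMap (MvPolynomial (Fin (m + 1) × Fin (n + 1)) R) L (X (p, q)) := by
      simp [f₁, crossVal]
    rw [this]
    exact IsLocalization.Away.algebraMap_isUnit _
  refine ⟨IsLocalization.Away.lift (X none) hu, fun r => ?_, fun s => ?_⟩
  · rw [constHom, RingHom.comp_apply, IsLocalization.Away.lift_eq]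
    simp [f₁]
  · rw [crossVar, IsLocalization.Away.lift_eq]
    simp [f₁]

theorem isLocalization_pivotHom :
    @IsLocalization _ _ (Submonoid.powers
      (X (p, q) : MvPolynomial (Fin (m + 1) × Fin (n + 1)) R)) (MvPolynomial (Fin m × Fin n) R') _
      (pivotHom R R' p q).toAlgebra := by
  let L := Localization.Away (X (p, q) : MvPolynomial (Fin (m + 1) × Fin (n + 1)) R)
  let aL := algebraMap (MvPolynomial (Fin (m + 1) × Fin (n + 1)) R) L
  let φ := pivotHom R R' p q
  obtain ⟨f, hf1, hf2⟩ := exists_crossHom (R := R) R' p q L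
  have hv : f (crossVar m n R R' none) * f (pivotInv m n R R') = 1 := by
    rw [← map_mul, crossVar_mul_pivotInv, map_one]
  let ψ : MvPolynomial (Fin m × Fin n) R' →+* L := eval₂Hom f fun s =>
    aL (X (p.succAbove s.1, q.succAbove s.2)) -
      f (crossVar m n R R' (some (.inl s.1))) * f (pivotInv m n R R') *
        f (crossVar m n R R' (some (.inr s.2)))
  have hψC : ∀ r, ψ (C r) = f r := fun r => by simp [ψ]
  have hψX : ∀ i j, ψ (X (i, j)) = aL (X (p.succAbove i, q.succAbove j)) -
      f (crossVar m n R R' (some (.inl i))) * f (pivotInv m n R R') *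
        f (crossVar m n R R' (some (.inr j))) := fun i j => by simp [ψ]
  have hψφ : ψ.comp φ = aL := by
    refine MvPolynomial.ringHom_ext (fun r => ?_) ?_
    · rw [RingHom.comp_apply, pivotHom_C, hψC, hf1]
    · rintro ⟨i, j⟩
      rw [RingHom.comp_apply, pivotHom_X, pivotGeneric]
      refine Fin.succAboveCases p ?_ (fun i => ?_) i <;>
        refine Fin.succAboveCases q ?_ (fun j => ?_) j
      · rw [pivotMatrix_same, hψC, hf2]; rfl
      · rw [pivotMatrix_row, hψC, hf2]; rfl
      · rw [pivotMatrix_col, hψC, hf2]; rfl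
      · rw [pivotMatrix_succAbove, map_add, map_mul, map_mul, hψX, hψC, hψC, hψC]
        ring
  have hφu : φ (X (p, q)) * C (pivotInv m n R R') = 1 := by
    rw [pivotHom_X, pivotGeneric, pivotMatrix_same, ← C_mul, crossVar_mul_pivotInv, C_1]
  let φ' : L →+* MvPolynomial (Fin m × Fin n) R' :=
    IsLocalization.Away.lift (X (p, q)) (IsUnit.of_mul_eq_one _ hφu)
  have hφ' : ∀ a, φ' (aL a) = φ a := IsLocalization.Away.lift_eq _ _
  have hψφ' : ψ.comp φ' = RingHom.id L := by
    refine IsLocalization.ringHom_ext (Submonoid.powers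
      (X (p, q) : MvPolynomial (Fin (m + 1) × Fin (n + 1)) R)) (RingHom.ext fun a => ?_)
    change ψ (φ' (aL a)) = aL a
    rw [hφ', ← hψφ]; rfl
  have hcross : ∀ s, φ' (f (crossVar m n R R' s)) = C (crossVar m n R R' s) := by
    intro s
    rw [hf2]
    rcases s with _ | i | j
    · exact (hφ' _).trans ((pivotHom_X R' p q _ _).trans (pivotMatrix_same ..))
    · exact (hφ' _).trans ((pivotHom_X R' p q _ _).trans (pivotMatrix_col ..))
    · exact (hφ' _).trans ((pivotHom_X R' p q _ _).trans (pivotMatrix_row ..))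
  have hC : ∀ r, φ' (f r) = C r := by
    have : (φ'.comp f) = C := by
      refine IsLocalization.ringHom_ext (Submonoid.powers
        (X none : MvPolynomial (Option (Fin m ⊕ Fin n)) R)) ?_
      refine MvPolynomial.ringHom_ext (fun r => ?_) fun s => hcross s
      exact (congrArg φ' (hf1 r)).trans ((hφ' _).trans (pivotHom_C R' p q r))
    exact fun r => RingHom.congr_fun this r
  have hφ'ψ : φ'.comp ψ = RingHom.id _ := by
    refine MvPolynomial.ringHom_ext (fun r => ?_) ?_
    · rw [RingHom.comp_apply, hψC, hC]; rfl
    · rintro ⟨i, j⟩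
      rw [RingHom.comp_apply, hψX, map_sub, map_mul, map_mul, hC, hC, hC, hφ', pivotHom_X,
        pivotGeneric, pivotMatrix_succAbove, RingHom.id_apply]
      ring
  let _ : Algebra (MvPolynomial (Fin (m + 1) × Fin (n + 1)) R) (MvPolynomial (Fin m × Fin n) R') :=
    φ.toAlgebra
  let e : L ≃ₐ[MvPolynomial (Fin (m + 1) × Fin (n + 1)) R] MvPolynomial (Fin m × Fin n) R' :=
    { RingEquiv.ofRingHom φ' ψ hφ'ψ hψφ' with commutes' := hφ' }
  exact IsLocalization.isLocalization_of_algEquiv _ e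

end Inverse

end Pivot

section MinorsIdeal

open MvPolynomial

variable {m n : ℕ}

theorem genMinor_eq_colMinor (R : Type*) [CommRing R] {x : Cols m (n + m)}
    {a : Fin m → Fin n} (h : ∀ i, x.1 i = Fin.castAdd m (a i)) :
    genMinor R x = colMinor (Matrix.mvPolynomialX (Fin m) (Fin n) R) a := by
  rw [genMinor, colMinor, colMinor]
  congr 1
  refine Matrix.ext fun i j => ?_
  simp [augGeneric, h]

theorem minorsIdeal_mvPolynomialX (m n : ℕ) (R : Type*) [CommRing R] :
    minorsIdeal m (Matrix.mvPolynomialX (Fin m) (Fin n) R) = genIdeal m n R := by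
  apply le_antisymm
  · rw [minorsIdeal, Ideal.span_le]
    rintro _ ⟨f, g, hf, hg, rfl⟩
    let e : Equiv.Perm (Fin m) := Equiv.ofBijective f (Finite.injective_iff_bijective.1 hf)
    have h1 : (Matrix.mvPolynomialX (Fin m) (Fin n) R).submatrix f g =
        ((Matrix.mvPolynomialX (Fin m) (Fin n) R).submatrix id (g ∘ e.symm)).submatrix e e := by
      refine Matrix.ext fun i j => ?_
      simp [e]
    rw [SetLike.mem_coe, h1, Matrix.det_submatrix_equiv_self]
    obtain ⟨s, σ, hs⟩ := exists_cols_of_injective (hg.comp e.symm.injective)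
    have h2 := colMinor_comp (Matrix.mvPolynomialX (Fin m) (Fin n) R) s.1 σ⁻¹
    have h3 : s.1 ∘ ⇑σ⁻¹ = g ∘ e.symm := by
      rw [hs]; funext i; simp
    rw [h3] at h2
    change colMinor _ _ ∈ _
    rw [h2]
    refine Ideal.mul_mem_left _ _ (Ideal.subset_span ?_)
    refine ⟨⟨fun i => Fin.castAdd m (s.1 i), fun i j h => s.2 h⟩, fun i => (s.1 i).2, ?_⟩
    exact genMinor_eq_colMinor R fun i => rfl
  · rw [genIdeal, Ideal.span_le]
    rintro _ ⟨x, hx, rfl⟩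
    rw [SetLike.mem_coe, genMinor_eq_colMinor R (a := fun i => ⟨x.1 i, hx i⟩) fun i => rfl]
    exact det_mem_minorsIdeal _ _ _

theorem minorsIdeal_le_sup_of_sub_mem {Q α β : Type*} [CommRing Q] {B B' : Matrix α β Q}
    {𝔞 : Ideal Q} (h : ∀ i j, B i j - B' i j ∈ 𝔞) (t : ℕ) :
    minorsIdeal t B ≤ minorsIdeal t B' ⊔ 𝔞 := by
  rw [minorsIdeal, Ideal.span_le]
  rintro _ ⟨f, g, -, -, rfl⟩
  have h1 : (B.submatrix f g).det - (B'.submatrix f g).det ∈ 𝔞 := by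
    rw [← Ideal.Quotient.eq, RingHom.map_det, RingHom.map_det]
    congr 1
    exact Matrix.ext fun i j => Ideal.Quotient.eq.2 (h _ _)
  have h2 := Submodule.add_mem_sup (det_mem_minorsIdeal B' f g) h1
  rwa [add_sub_cancel] at h2

end MinorsIdeal

section Induction

open MvPolynomial RingTheory.Sequence

theorem GradeGE.exists_localized {S S' : Type u} [CommRing S] [CommRing S'] [Algebra S S']
    (T : Submonoid S) [IsLocalization T S'] [IsNoetherianRing S'] {I J : Ideal S} {g : ℕ}
    (h : GradeGE (J.map (algebraMap S S')) ↥(I.map (algebraMap S S')) g) :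
    ∃ (N : Type u) (_ : AddCommGroup N) (_ : Module S N) (f : ↥I →ₗ[S] N),
      IsLocalizedModule T f ∧ GradeGE J N g := by
  rw [← Ideal.localized'_eq_map S' T I] at h
  exact ⟨_, _, _, Submodule.toLocalized' S' T (Algebra.linearMap S S') I, inferInstance,
    h.of_map_algebraMap T⟩

theorem GradeGE.map_algebraMap {S S' : Type u} [CommRing S] [CommRing S'] [Algebra S S']
    [Module.Flat S S'] [IsNoetherianRing S] {J : Ideal S} {g : ℕ}
    (h : GradeGE J S g) : GradeGE (J.map (algebraMap S S')) S' g := by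
  obtain ⟨rs, rfl, hmem, hrs⟩ := h.exists_isWeaklyRegular
  have h1 := hrs.of_flat (S := S')
  have h2 := GradeGE.of_isWeaklyRegular (J := J.map (algebraMap S S')) (fun r hr => by
    obtain ⟨a, ha, rfl⟩ := List.mem_map.1 hr
    exact Ideal.mem_map_of_mem _ (hmem a ha)) h1
  rwa [List.length_map] at h2

variable {m n : ℕ} {R : Type u} [CommRing R]

/-- The ideal defining the specialization of the generic matrix to `A`. -/
noncomputable def specIdeal (A : Matrix (Fin m) (Fin n) R) :
    Ideal (MvPolynomial (Fin m × Fin n) R) :=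
  Ideal.span (Set.range fun s : Fin m × Fin n => X s - C (A s.1 s.2))

theorem X_sub_C_mem_specIdeal (A : Matrix (Fin m) (Fin n) R) (i : Fin m) (j : Fin n) :
    X (i, j) - C (A i j) ∈ specIdeal A := Ideal.subset_span ⟨(i, j), rfl⟩

section Step

variable (A : Matrix (Fin (m + 1)) (Fin (n + 1)) R) (p : Fin (m + 1)) (q : Fin (n + 1))
  (R' : Type u) [CommRing R']
  [Algebra (MvPolynomial (Option (Fin m ⊕ Fin n)) R) R']
  [IsLocalization.Away (X none : MvPolynomial (Option (Fin m ⊕ Fin n)) R) R']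

/-- The position in the matrix of a variable of the pivot cross. -/
def crossCell : Option (Fin m ⊕ Fin n) → Fin (m + 1) × Fin (n + 1)
  | none => (p, q)
  | some (.inl i) => (p.succAbove i, q)
  | some (.inr j) => (p, q.succAbove j)

/-- The ideal specializing the pivot cross to the entries of `A`. -/
noncomputable def crossIdeal : Ideal R' :=
  Ideal.span (Set.range fun s : Option (Fin m ⊕ Fin n) => crossVar m n R R' s -
    constHom m n R R' (A (crossCell p q s).1 (crossCell p q s).2))

/-- The matrix `A` with its pivot cross made generic. -/
noncomputable def crossGeneric : Matrix (Fin (m + 1)) (Fin (n + 1)) R' :=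
  pivotMatrix p q (crossVar m n R R' none) (fun j => crossVar m n R R' (some (.inr j)))
    (fun i => crossVar m n R R' (some (.inl i)))
    fun i j => constHom m n R R' (A (p.succAbove i) (q.succAbove j))

theorem minorsIdeal_map_constHom_le (t : ℕ) :
    (minorsIdeal (t + 1) A).map (constHom m n R R') ≤
      minorsIdeal t (schurAt (crossGeneric A p q R') p q (pivotInv m n R R')) ⊔
        crossIdeal A p q R' := by
  rw [minorsIdeal_map, ← minorsIdeal_schurAt _ p q (by
    rw [crossGeneric, pivotMatrix_same, crossVar_mul_pivotInv])]
  refine minorsIdeal_le_sup_of_sub_mem (fun i j => ?_) _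
  have key : ∀ s : Option (Fin m ⊕ Fin n),
      constHom m n R R' (A (crossCell p q s).1 (crossCell p q s).2) - crossVar m n R R' s ∈
        crossIdeal A p q R' := fun s => by
    rw [← neg_sub]
    exact neg_mem (Ideal.subset_span ⟨s, rfl⟩)
  rw [crossGeneric, Matrix.map_apply]
  refine Fin.succAboveCases p ?_ (fun i => ?_) i <;>
    refine Fin.succAboveCases q ?_ (fun j => ?_) j
  · rw [pivotMatrix_same]; exact key none
  · rw [pivotMatrix_row]; exact key (some (.inr j))
  · rw [pivotMatrix_col]; exact key (some (.inl i))
  · rw [pivotMatrix_succAbove, sub_self]; exact zero_mem _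

theorem gradeGE_schurAt_crossGeneric [IsNoetherianRing R] {𝔠 : Ideal R} {t g : ℕ}
    (h : GradeGE (minorsIdeal (t + 1) A ⊔ 𝔠) R g) :
    GradeGE (minorsIdeal t (schurAt (crossGeneric A p q R') p q (pivotInv m n R R')) ⊔
      (𝔠.map (constHom m n R R') ⊔ crossIdeal A p q R')) R' (g + (m + n + 1)) := by
  obtain ⟨rs, rfl, hmem, hrs⟩ := h.exists_isWeaklyRegular
  have : IsNoetherianRing R' := IsLocalization.isNoetherianRing
    (Submonoid.powers (X none : MvPolynomial (Option (Fin m ⊕ Fin n)) R)) _ inferInstance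
  have : Module.Flat (MvPolynomial (Option (Fin m ⊕ Fin n)) R) R' := IsLocalization.flat _
    (Submonoid.powers (X none : MvPolynomial (Option (Fin m ⊕ Fin n)) R))
  let a : Option (Fin m ⊕ Fin n) → R := fun s => A (crossCell p q s).1 (crossCell p q s).2
  let 𝔟 : Ideal (MvPolynomial (Option (Fin m ⊕ Fin n)) R) :=
    (minorsIdeal (t + 1) A ⊔ 𝔠).map C ⊔ Ideal.span (Set.range fun s => X s - C (a s))
  have h1 : GradeGE 𝔟 (MvPolynomial (Option (Fin m ⊕ Fin n)) R)
      (rs.length + Fintype.card (Option (Fin m ⊕ Fin n))) :=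
    gradeGE_mvPolynomial a hrs
      (fun r hr => Ideal.mem_sup_left (Ideal.mem_map_of_mem _ (hmem r hr)))
      fun s => Ideal.mem_sup_right (Ideal.subset_span ⟨s, rfl⟩)
  have h2 := h1.map_algebraMap (S' := R')
  rw [Fintype.card_option, Fintype.card_sum, Fintype.card_fin, Fintype.card_fin] at h2
  refine h2.mono_ideal ?_
  rw [Ideal.map_sup, Ideal.map_map, Ideal.map_sup]
  refine sup_le (sup_le ?_ ?_) ?_
  · refine (minorsIdeal_map_constHom_le A p q R' t).trans ?_
    exact sup_le_sup_left le_sup_right _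
  · exact le_sup_left.trans le_sup_right
  · refine le_trans ?_ (le_sup_right.trans le_sup_right)
    rw [Ideal.map_span, Ideal.span_le]
    rintro _ ⟨_, ⟨s, rfl⟩, rfl⟩
    refine Ideal.subset_span ⟨s, ?_⟩
    rw [map_sub]
    rfl

theorem specIdeal_schurAt_le (𝔠 : Ideal R) :
    specIdeal (schurAt (crossGeneric A p q R') p q (pivotInv m n R R')) ⊔
        minorsIdeal m (Matrix.mvPolynomialX (Fin m) (Fin n) R') ⊔
        (𝔠.map (constHom m n R R') ⊔ crossIdeal A p q R').map C ≤
      (specIdeal A ⊔ minorsIdeal (m + 1) (Matrix.mvPolynomialX (Fin (m + 1)) (Fin (n + 1)) R) ⊔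
        𝔠.map C).map (pivotHom R R' p q) := by
  have key : ∀ i j, pivotGeneric R R' p q i j - C (constHom m n R R' (A i j)) ∈
      (specIdeal A).map (pivotHom R R' p q) := fun i j => by
    have := Ideal.mem_map_of_mem (pivotHom R R' p q) (X_sub_C_mem_specIdeal A i j)
    rwa [map_sub, pivotHom_X, pivotHom_C] at this
  rw [Ideal.map_sup (pivotHom R R' p q), Ideal.map_sup (pivotHom R R' p q),
    map_pivotHom_minorsIdeal]
  refine sup_le (sup_le ?_ ?_) ?_
  · refine le_trans ?_ (le_sup_left.trans le_sup_left)
    rw [specIdeal, Ideal.span_le]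
    rintro _ ⟨⟨i, j⟩, rfl⟩
    have h1 := key (p.succAbove i) (q.succAbove j)
    rw [pivotGeneric, pivotMatrix_succAbove] at h1
    rw [SetLike.mem_coe]
    convert h1 using 1
    simp only [schurAt, crossGeneric, Matrix.of_apply, pivotMatrix_row, pivotMatrix_col,
      pivotMatrix_succAbove, map_sub, map_mul]
    ring
  · exact le_sup_right.trans le_sup_left
  · rw [Ideal.map_sup]
    refine sup_le ?_ ?_
    · refine le_trans ?_ le_sup_right
      rw [Ideal.map_map, Ideal.map_map]
      refine le_of_eq (congrArg (fun f => Ideal.map f 𝔠) (RingHom.ext fun r => ?_))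
      exact (pivotHom_C R' p q r).symm
    · refine le_trans ?_ (le_sup_left.trans le_sup_left)
      rw [crossIdeal, Ideal.map_span, Ideal.span_le]
      rintro _ ⟨_, ⟨s, rfl⟩, rfl⟩
      have h1 := key (crossCell p q s).1 (crossCell p q s).2
      rw [SetLike.mem_coe, map_sub]
      convert h1 using 2
      rcases s with _ | i | j
      · exact (pivotMatrix_same ..).symm
      · change _ = pivotGeneric R R' p q (p.succAbove i) q
        rw [pivotGeneric, pivotMatrix_col]
      · change _ = pivotGeneric R R' p q p (q.succAbove j)
        rw [pivotGeneric, pivotMatrix_row]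

end Step

theorem map_C_minorsIdeal_one_le (A : Matrix (Fin m) (Fin n) R) :
    (minorsIdeal 1 A).map C ≤ specIdeal A ⊔ Ideal.span (Set.range X) := by
  rw [minorsIdeal, Ideal.map_span, Ideal.span_le]
  rintro _ ⟨_, ⟨f, g, -, -, rfl⟩, rfl⟩
  rw [Matrix.det_fin_one, Matrix.submatrix_apply, SetLike.mem_coe,
    ← sub_sub_cancel (X (f 0, g 0)) (C (A (f 0) (g 0)))]
  exact sub_mem (Ideal.mem_sup_right (Ideal.subset_span ⟨_, rfl⟩))
    (Ideal.mem_sup_left (X_sub_C_mem_specIdeal A _ _))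

/-- Grade of the powers of the ideal of generic maximal minors along a specialization. -/
theorem gradeGE_minorsIdeal_pow (d m : ℕ) : ∀ (n : ℕ) (_ : n = m + d) (R : Type u) [CommRing R]
    [IsNoetherianRing R] (A : Matrix (Fin m) (Fin n) R) (𝔠 : Ideal R) (c : ℕ)
    (_ : ∀ j, 1 ≤ j → j ≤ m → GradeGE (minorsIdeal j A ⊔ 𝔠) R ((m - j + 1) * d + 1 + c)) (k : ℕ),
    GradeGE (specIdeal A ⊔ minorsIdeal m (Matrix.mvPolynomialX (Fin m) (Fin n) R) ⊔ 𝔠.map C)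
      ↥(minorsIdeal m (Matrix.mvPolynomialX (Fin m) (Fin n) R) ^ k) (m * n + 1 + c) := by
  induction m with
  | zero =>
    intro n _ R _ _ A 𝔠 c _ k
    have h1 : specIdeal A ⊔ minorsIdeal 0 (Matrix.mvPolynomialX (Fin 0) (Fin n) R) ⊔ 𝔠.map C =
        ⊤ := by
      rw [Ideal.eq_top_iff_one]
      refine Ideal.mem_sup_left (Ideal.mem_sup_right ?_)
      have := det_mem_minorsIdeal (Matrix.mvPolynomialX (Fin 0) (Fin n) R) Fin.elim0 Fin.elim0
      rwa [Matrix.det_fin_zero] at this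
    rw [h1]
    exact GradeGE.top _
  | succ m ih =>
    intro n hn R _ _ A 𝔠 c h k
    obtain ⟨n, rfl⟩ : ∃ n', n = n' + 1 := ⟨m + d, by omega⟩
    have hn' : n = m + d := by omega
    refine GradeGE.of_sup_of_localized (Set.range X) ?_ ?_
    · obtain ⟨rs, hlen, hmem, hrs⟩ := (h 1 le_rfl (by omega)).exists_isWeaklyRegular
      rw [minorsIdeal_mvPolynomialX]
      have h1 := gradeGE_genIdeal_pow R (m := m + 1) (n := n + 1)
        (𝔟 := specIdeal A ⊔ genIdeal (m + 1) (n + 1) R ⊔ 𝔠.map C ⊔ Ideal.span (Set.range X))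
        (by omega) (by omega) hrs (fun r hr => ?_)
        (fun s => Ideal.mem_sup_right (Ideal.subset_span ⟨s, rfl⟩)) k
      · refine h1.mono (le_of_eq ?_)
        rw [hlen, hn', Nat.add_sub_cancel]
        ring
      · have h2 := Ideal.mem_map_of_mem (C : R →+* MvPolynomial (Fin (m + 1) × Fin (n + 1)) R)
          (hmem r hr)
        rw [Ideal.map_sup] at h2
        refine (sup_le ((map_C_minorsIdeal_one_le A).trans ?_) ?_ :
          (minorsIdeal 1 A).map C ⊔ 𝔠.map C ≤ _) h2
        · exact sup_le_sup_right (le_sup_left.trans le_sup_left) _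
        · exact le_sup_right.trans le_sup_left
    · rintro _ ⟨⟨p, q⟩, rfl⟩
      let R' := Localization.Away (X none : MvPolynomial (Option (Fin m ⊕ Fin n)) R)
      have : IsNoetherianRing R' := IsLocalization.isNoetherianRing
        (Submonoid.powers (X none : MvPolynomial (Option (Fin m ⊕ Fin n)) R)) _ inferInstance
      have h1 := ih n hn' R' (schurAt (crossGeneric A p q R') p q (pivotInv m n R R'))
        (𝔠.map (constHom m n R R') ⊔ crossIdeal A p q R') (c + (m + n + 1)) (fun j hj1 hj2 => by
          refine (gradeGE_schurAt_crossGeneric A p q R' (h (j + 1) (by omega) (by omega))).mono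
            (le_of_eq ?_)
          rw [Nat.add_sub_add_right]
          ring) k
      have h2 := (h1.mono_ideal (specIdeal_schurAt_le A p q R' 𝔠)).mono
        (l := (m + 1) * (n + 1) + 1 + c) (le_of_eq (by ring))
      let _ : Algebra (MvPolynomial (Fin (m + 1) × Fin (n + 1)) R)
        (MvPolynomial (Fin m × Fin n) R') := (pivotHom R R' p q).toAlgebra
      have : IsLocalization (Submonoid.powers
          (X (p, q) : MvPolynomial (Fin (m + 1) × Fin (n + 1)) R))
          (MvPolynomial (Fin m × Fin n) R') := isLocalization_pivotHom R' p q
      refine GradeGE.exists_localized (S' := MvPolynomial (Fin m × Fin n) R') _ ?_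
      have h3 : (minorsIdeal (m + 1) (Matrix.mvPolynomialX (Fin (m + 1)) (Fin (n + 1)) R) ^ k).map
          (algebraMap (MvPolynomial (Fin (m + 1) × Fin (n + 1)) R)
            (MvPolynomial (Fin m × Fin n) R')) =
          minorsIdeal m (Matrix.mvPolynomialX (Fin m) (Fin n) R') ^ k := by
        rw [Ideal.map_pow]
        exact congrArg (· ^ k) (map_pivotHom_minorsIdeal R' p q m)
      rw [h3]
      exact h2

end Induction

section Specialization

open MvPolynomial

variable {m n : ℕ} {R : Type u} [CommRing R]

/-- Substituting the entries of `A` for the variables of the generic matrix. -/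
noncomputable def specHom (A : Matrix (Fin m) (Fin n) R) :
    MvPolynomial (Fin m × Fin n) R →+* R :=
  eval fun s => A s.1 s.2

theorem specHom_C (A : Matrix (Fin m) (Fin n) R) (r : R) : specHom A (C r) = r := eval_C r

theorem specHom_eq_zero_of_mem_specIdeal (A : Matrix (Fin m) (Fin n) R)
    {p : MvPolynomial (Fin m × Fin n) R} (hp : p ∈ specIdeal A) : specHom A p = 0 := by
  suffices h : specIdeal A ≤ RingHom.ker (specHom A) from h hp
  rw [specIdeal, Ideal.span_le]
  rintro _ ⟨s, rfl⟩
  rw [SetLike.mem_coe, RingHom.mem_ker, map_sub, specHom_C, specHom, eval_X, sub_self]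

theorem mem_specIdeal_of_specHom_eq_zero (A : Matrix (Fin m) (Fin n) R)
    {p : MvPolynomial (Fin m × Fin n) R} (hp : specHom A p = 0) : p ∈ specIdeal A := by
  have h : ((Ideal.Quotient.mk (specIdeal A)).comp C).comp (specHom A) =
      Ideal.Quotient.mk (specIdeal A) := by
    refine MvPolynomial.ringHom_ext (fun r => ?_) fun s => ?_
    · rw [RingHom.comp_apply, specHom_C, RingHom.comp_apply]
    · rw [RingHom.comp_apply, RingHom.comp_apply, specHom, eval_X]
      exact (Ideal.Quotient.eq.2 (X_sub_C_mem_specIdeal A s.1 s.2)).symm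
  rw [← Ideal.Quotient.eq_zero_iff_mem, ← h, RingHom.comp_apply, hp, map_zero]

theorem gradeGE_specIdeal [IsNoetherianRing R] (A : Matrix (Fin m) (Fin n) R) :
    GradeGE (specIdeal A) (MvPolynomial (Fin m × Fin n) R) (m * n) := by
  have h := gradeGE_mvPolynomial (R := R) (fun s : Fin m × Fin n => A s.1 s.2)
    (RingTheory.Sequence.IsWeaklyRegular.nil R R) (𝔟 := specIdeal A)
    (fun r hr => absurd hr List.not_mem_nil) fun s => X_sub_C_mem_specIdeal A s.1 s.2
  rwa [List.length_nil, zero_add, Fintype.card_prod, Fintype.card_fin, Fintype.card_fin] at h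

theorem gradeGE_specIdeal_pow [IsNoetherianRing R] (A : Matrix (Fin m) (Fin n) R)
    {d k : ℕ} (hn : n = m + d)
    (h : ∀ j, 1 ≤ j → j ≤ m → GradeGE (minorsIdeal j A) R ((m - j + 1) * d + 1)) :
    GradeGE (specIdeal A ⊔ minorsIdeal m (Matrix.mvPolynomialX (Fin m) (Fin n) R))
      ↥(minorsIdeal m (Matrix.mvPolynomialX (Fin m) (Fin n) R) ^ k) (m * n + 1) := by
  have h1 := gradeGE_minorsIdeal_pow d m n hn R A ⊥ 0
    (fun j hj hjm => by rw [sup_bot_eq]; exact h j hj hjm) k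
  rwa [Ideal.map_bot, sup_bot_eq] at h1

theorem gradeGE_specIdeal_minorsIdeal_pow [IsNoetherianRing R] (A : Matrix (Fin m) (Fin n) R)
    {d k : ℕ} (hn : n = m + d)
    (h : ∀ j, 1 ≤ j → j ≤ m → GradeGE (minorsIdeal j A) R ((m - j + 1) * d + 1)) :
    GradeGE (specIdeal A)
      ↥(minorsIdeal m (Matrix.mvPolynomialX (Fin m) (Fin n) R) ^ k) (m * n) := by
  refine GradeGE.of_sup_of_localized
    (minorsIdeal m (Matrix.mvPolynomialX (Fin m) (Fin n) R) : Set _) ?_ fun g hg => ?_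
  · rw [Ideal.span_eq]
    exact (gradeGE_specIdeal_pow A hn h).mono (Nat.le_succ _)
  · have := IsLocalization.isNoetherianRing (Submonoid.powers g) (Localization.Away g)
      inferInstance
    have := IsLocalization.flat (Localization.Away g) (Submonoid.powers g)
    refine GradeGE.exists_localized (S' := Localization.Away g) (Submonoid.powers g) ?_
    have htop : (minorsIdeal m (Matrix.mvPolynomialX (Fin m) (Fin n) R) ^ k).map
        (algebraMap _ (Localization.Away g)) = ⊤ :=
      Ideal.eq_top_of_isUnit_mem _
        (Ideal.mem_map_of_mem _ (Ideal.pow_mem_pow hg k))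
        (by rw [map_pow]; exact (IsLocalization.Away.algebraMap_isUnit g).pow k)
    rw [htop]
    exact (gradeGE_specIdeal A).map_algebraMap.of_linearEquiv Submodule.topEquiv.symm

theorem mem_specIdeal_mul_of_forall_mul_mem [IsNoetherianRing R] (A : Matrix (Fin m) (Fin n) R)
    {d k : ℕ} (hn : n = m + d)
    (h : ∀ j, 1 ≤ j → j ≤ m → GradeGE (minorsIdeal j A) R ((m - j + 1) * d + 1))
    {ξ : MvPolynomial (Fin m × Fin n) R}
    (hξ : ξ ∈ minorsIdeal m (Matrix.mvPolynomialX (Fin m) (Fin n) R) ^ k)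
    (hI : ∀ a ∈ minorsIdeal m (Matrix.mvPolynomialX (Fin m) (Fin n) R),
      a * ξ ∈ specIdeal A * minorsIdeal m (Matrix.mvPolynomialX (Fin m) (Fin n) R) ^ k) :
    ξ ∈ specIdeal A * minorsIdeal m (Matrix.mvPolynomialX (Fin m) (Fin n) R) ^ k := by
  set I := minorsIdeal m (Matrix.mvPolynomialX (Fin m) (Fin n) R) ^ k
  have hmap : (specIdeal A • (⊤ : Submodule _ ↥I)).map I.subtype = specIdeal A * I := by
    rw [Submodule.map_smul'', Submodule.map_top, Submodule.range_subtype, smul_eq_mul]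
  have hmem : ∀ η : ↥I,
      η ∈ specIdeal A • (⊤ : Submodule (MvPolynomial (Fin m × Fin n) R) ↥I) ↔
      (η : MvPolynomial (Fin m × Fin n) R) ∈ specIdeal A * I := by
    intro η
    rw [← hmap]
    exact (Function.Injective.mem_set_image I.subtype_injective).symm
  let ys : List (MvPolynomial (Fin m × Fin n) R) :=
    (Finset.univ : Finset (Fin m × Fin n)).toList.map fun s => X s - C (A s.1 s.2)
  have hlen : ys.length = m * n := by
    rw [List.length_map, Finset.length_toList, Finset.card_univ, Fintype.card_prod,
      Fintype.card_fin, Fintype.card_fin]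
  have hys : Ideal.ofList ys = specIdeal A := by
    refine congrArg Ideal.span (Set.ext fun p => ?_)
    simp [ys]
  refine (hmem ⟨ξ, hξ⟩).1 (mem_smul_top_of_forall_smul_mem
    (I' := minorsIdeal m (Matrix.mvPolynomialX (Fin m) (Fin n) R)) ys hys.le
    (hys.ge.trans le_sup_left) ?_ ?_ fun a ha => (hmem _).2 (hI a ha))
  · rw [hlen]
    exact gradeGE_specIdeal_minorsIdeal_pow A hn h
  · rw [hlen]
    exact gradeGE_specIdeal_pow A hn h

theorem specIdeal_inf_minorsIdeal_pow_le [IsNoetherianRing R] (A : Matrix (Fin m) (Fin n) R)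
    {d : ℕ} (k : ℕ) (hn : n = m + d)
    (h : ∀ j, 1 ≤ j → j ≤ m → GradeGE (minorsIdeal j A) R ((m - j + 1) * d + 1)) :
    specIdeal A ⊓ minorsIdeal m (Matrix.mvPolynomialX (Fin m) (Fin n) R) ^ k ≤
      specIdeal A * minorsIdeal m (Matrix.mvPolynomialX (Fin m) (Fin n) R) ^ k := by
  have key : ∀ r ξ, ξ ∈ minorsIdeal m (Matrix.mvPolynomialX (Fin m) (Fin n) R) ^ k →
      (∀ a ∈ minorsIdeal m (Matrix.mvPolynomialX (Fin m) (Fin n) R) ^ r,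
        a * ξ ∈ specIdeal A * minorsIdeal m (Matrix.mvPolynomialX (Fin m) (Fin n) R) ^ k) →
      ξ ∈ specIdeal A * minorsIdeal m (Matrix.mvPolynomialX (Fin m) (Fin n) R) ^ k := by
    intro r
    induction r with
    | zero =>
      intro ξ _ hI
      have := hI 1 (by rw [pow_zero, Ideal.one_eq_top]; trivial)
      rwa [one_mul] at this
    | succ r ih =>
      intro ξ hξ hI
      refine mem_specIdeal_mul_of_forall_mul_mem A hn h hξ fun b hb =>
        ih _ (Ideal.mul_mem_left _ _ hξ) fun a ha => ?_
      rw [← mul_assoc]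
      refine hI _ ?_
      rw [pow_succ]
      exact Ideal.mul_mem_mul ha hb
  rintro ξ ⟨hJ, hξ⟩
  refine key k ξ hξ fun a ha => ?_
  rw [mul_comm a ξ]
  exact Ideal.mul_mem_mul hJ ha

end Specialization

section SpecializedFiber

open MvPolynomial

theorem exists_isHomogeneous_map_eq_zero {S R ι : Type*} [CommRing S] [CommRing R] (φ : S →+* R)
    (f : ι → S) {k : ℕ} {ξ : S} (hξ : ξ ∈ RingHom.ker φ * Ideal.span (Set.range f) ^ k) :
    ∃ H : MvPolynomial ι S, H.IsHomogeneous k ∧ aeval f H = ξ ∧ map φ H = 0 := by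
  induction hξ using Submodule.mul_induction_on' with
  | mem_mul_mem y hy z hz =>
    obtain ⟨G, hG, rfl⟩ := (Ideal.mem_span_pow_iff_exists_isHomogeneous f z).1 hz
    refine ⟨C y * G, ?_, ?_, ?_⟩
    · have h := (isHomogeneous_C ι y).mul hG
      rwa [zero_add] at h
    · rw [map_mul, ← algebraMap_eq, AlgHom.commutes]
      rfl
    · rw [map_mul, map_C, (RingHom.mem_ker).1 hy, map_zero, zero_mul]
  | add y _ z _ hy hz =>
    obtain ⟨G, hG, rfl, hG0⟩ := hy
    obtain ⟨H, hH, rfl, hH0⟩ := hz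
    exact ⟨G + H, hG.add hH, map_add _ _ _, by rw [map_add, hG0, hH0, add_zero]⟩

theorem aeval_map_eq {S R ι : Type*} [CommRing S] [CommRing R] (φ : S →+* R) {f : ι → S}
    {g : ι → R} (hfg : ∀ i, φ (f i) = g i) (p : MvPolynomial ι S) :
    aeval g (map φ p) = φ (aeval f p) := by
  rw [aeval_def, aeval_def, eval₂_map, ← funext hfg]
  exact (eval₂_comp_left φ (algebraMap S S) f p).symm

theorem map_mem_reesDefIdeal {S R ι : Type*} [CommRing S] [CommRing R] (φ : S →+* R) {f : ι → S}
    {g : ι → R} (hfg : ∀ i, φ (f i) = g i) {p : MvPolynomial ι S} (hp : p ∈ reesDefIdeal f) :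
    map φ p ∈ reesDefIdeal g := by
  rw [mem_reesDefIdeal_iff] at hp ⊢
  intro k
  have h : homogeneousComponent k (map φ p) = map φ (homogeneousComponent k p) := by
    refine MvPolynomial.ext _ _ fun μ => ?_
    rw [coeff_homogeneousComponent, coeff_map, coeff_map, coeff_homogeneousComponent, apply_ite φ,
      map_zero]
  rw [h, aeval_map_eq φ hfg, hp k, map_zero]

theorem map_mem_fiberIdeal {S R ι : Type*} [CommRing S] [CommRing R] (K : Type*) [CommRing K]
    [Algebra K R] (φ : S →+* R) {f : ι → S} {g : ι → R} (hfg : ∀ i, φ (f i) = g i)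
    {p : MvPolynomial ι S} (hp : p ∈ fiberIdeal ℤ f) : map φ p ∈ fiberIdeal K g := by
  suffices h : (fiberIdeal ℤ f).map (map φ) ≤ fiberIdeal K g from h (Ideal.mem_map_of_mem _ hp)
  rw [fiberIdeal, Ideal.map_span, Ideal.span_le]
  rintro _ ⟨p, hp | ⟨hp, q, rfl⟩, rfl⟩
  · exact Ideal.subset_span (Or.inl ⟨map_mem_reesDefIdeal φ hfg hp.1, hp.2.map φ⟩)
  · refine Ideal.subset_span (Or.inr ⟨map_mem_reesDefIdeal φ hfg hp,
      map (algebraMap ℤ K) q, ?_⟩)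
    rw [MvPolynomial.map_map, MvPolynomial.map_map]
    exact congrArg (fun ψ => MvPolynomial.map ψ q) (RingHom.ext_int _ _)

/-- Being of fiber type descends along a split specialization compatible with the powers of the
ideal. -/
theorem isFiberType_of_specialization {S R ι : Type*} [CommRing S] [CommRing R] (K : Type*)
    [CommRing K] [Algebra K R] (φ : S →+* R) (σ : R →+* S) (hσ : ∀ r, φ (σ r) = r) {f : ι → S}
    {g : ι → R} (hfg : ∀ i, φ (f i) = g i) (hf : IsFiberType ℤ f)
    (hker : ∀ k, RingHom.ker φ ⊓ Ideal.span (Set.range f) ^ k ≤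
      RingHom.ker φ * Ideal.span (Set.range f) ^ k) : IsFiberType K g := by
  refine isFiberType_of_isHomogeneous K fun k F hF hF0 => ?_
  have hmap : map φ (map σ F) = F := by
    rw [MvPolynomial.map_map]
    exact (congrArg (fun ψ => MvPolynomial.map ψ F) (RingHom.ext hσ)).trans (map_id F)
  obtain ⟨H, hH, hHF, hH0⟩ := exists_isHomogeneous_map_eq_zero φ f (ξ := aeval f (map σ F)) (hker k
    ⟨by rw [SetLike.mem_coe, RingHom.mem_ker, ← aeval_map_eq φ hfg, hmap, hF0],
      (Ideal.mem_span_pow_iff_exists_isHomogeneous f _).2 ⟨map σ F, hF.map σ, rfl⟩⟩)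
  have hrees : map σ F - H ∈ reesDefIdeal f := by
    rw [mem_reesDefIdeal_of_isHomogeneous ((hF.map σ).sub hH), map_sub, hHF, sub_self]
  have h1 := map_mem_fiberIdeal K φ hfg (hf.le hrees)
  rwa [map_sub, hmap, hH0, sub_zero] at h1

end SpecializedFiber

section Columns

variable {m n : ℕ}

theorem Fin.orderEmbedding_eq_refl (f : Fin m ↪o Fin m) : f = RelEmbedding.refl _ :=
  DFunLike.coe_injective ((f.strictMono.range_inj strictMono_id).1 (by
    rw [(Finite.injective_iff_surjective.1 f.injective).range_eq, Set.range_id]))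

/-- The index set of the maximal minors corresponds to the column sequences
avoiding the identity block. -/
noncomputable def colsEquiv (m n : ℕ) :
    (Fin m ↪o Fin m) × (Fin m ↪o Fin n) ≃ {x : Cols m (n + m) // ColsLT n x} where
  toFun q := ⟨⟨fun i => Fin.castAdd m (q.2 i), (Fin.strictMono_castAdd m).comp q.2.strictMono⟩,
    fun i => (q.2 i).2⟩
  invFun x := (RelEmbedding.refl _, OrderEmbedding.ofStrictMono (fun i => ⟨x.1.1 i, x.2 i⟩)
    fun _ _ h => x.1.2 h)
  left_inv q := Prod.ext (Fin.orderEmbedding_eq_refl q.1).symm rfl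
  right_inv _ := rfl

end Columns

theorem statement_19 (K : Type*) [Field K] (d : ℕ) (hd : 0 < d)
    (m n : ℕ) (h1m : 1 ≤ m) (hmn : m ≤ n)
    (A : Matrix (Fin m) (Fin n) (MvPolynomial (Fin d) K))
    (δ : ℕ) (hA : ∀ i j, MvPolynomial.IsHomogeneous (A i j) δ)
    (hgen : idealHeight (minorsIdeal m A) = ((n - m + 1 : ℕ) : ℕ∞))
    (hj : ∀ j : ℕ, 1 ≤ j → j ≤ m - 1 →
      (((m - j + 1) * (n - m) + 1 : ℕ) : ℕ∞) ≤ idealHeight (minorsIdeal j A)) :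
    IsFiberType K (fun q : (Fin m ↪o Fin m) × (Fin m ↪o Fin n) =>
      (A.submatrix ⇑q.1 ⇑q.2).det) := by
  have hreg : IsRegularRing (MvPolynomial (Fin d) K) :=
    MvPolynomial.isRegularRing_of_isRegularRing K
  have hheight : ∀ j, 1 ≤ j → j ≤ m →
      (((m - j + 1) * (n - m) + 1 : ℕ) : ℕ∞) ≤ idealHeight (minorsIdeal j A) := by
    intro j h1 h2
    rcases h2.eq_or_lt with rfl | h2
    · rw [hgen, Nat.sub_self, zero_add, one_mul]
    · exact hj j h1 (Nat.le_sub_one_of_lt h2)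
  have hspan : Ideal.span (Set.range fun q => genMinor (MvPolynomial (Fin d) K)
      (colsEquiv m n q).1) = minorsIdeal m (Matrix.mvPolynomialX (Fin m) (Fin n) _) := by
    rw [minorsIdeal_mvPolynomialX, genIdeal]
    refine congrArg Ideal.span (Set.ext fun p => ⟨?_, ?_⟩)
    · rintro ⟨q, rfl⟩
      exact ⟨_, (colsEquiv m n q).2, rfl⟩
    · rintro ⟨x, hx, rfl⟩
      exact ⟨(colsEquiv m n).symm ⟨x, hx⟩, congrArg (fun y => genMinor _ y.1)
        ((colsEquiv m n).apply_symm_apply ⟨x, hx⟩)⟩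
  have hker : RingHom.ker (specHom A) = specIdeal A :=
    le_antisymm (fun p hp => mem_specIdeal_of_specHom_eq_zero A hp)
      fun p hp => specHom_eq_zero_of_mem_specIdeal A hp
  refine isFiberType_of_specialization K (specHom A) MvPolynomial.C (specHom_C A)
    (f := fun q => genMinor (MvPolynomial (Fin d) K) (colsEquiv m n q).1) (fun q => ?_)
    (isFiberType_genMinor _ _ h1m) fun k => ?_
  · rw [genMinor_eq_colMinor (a := q.2) _ fun i => rfl, colMinor, RingHom.map_det, Fin.orderEmbedding_eq_refl q.1]
    refine congrArg Matrix.det (Matrix.ext fun i j => ?_)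
    exact MvPolynomial.eval_X _
  · rw [hspan, hker]
    exact specIdeal_inf_minorsIdeal_pow_le A k (d := n - m) (by omega) fun j h1 h2 =>
      IsRegularRing.gradeGE_of_le_height fun P hP hIP =>
        le_height_of_le_idealHeight (hheight j h1 h2) P hP hIP
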